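/- arXiv:1504.01431 — 2 statements merged into one kernel-verified Lean document; each statement's English description precedes it below -/
import Mathlib

section
/- Let N = |C_k| be the number of k-cliques of G. There is an integer E_C depending only on n, k and N (the paper computes E_C = 6N·ℓ₃ + E₃) such that the weighted RNA folding score of the clique-detecting sequence S_G equals E_C if G contains a 3k-clique, and is at most E_C − 1 otherwise. -/
/-!
Formalization of (weighted) RNA folding from
"If the Current Clique Algorithms are Optimal, so is Valiant's Parser"
(Abboud, Backurs, Vassilevska Williams), Section 3.

Letters come from `Σ ∪ Σ'`, modelled as `σ ⊕ σ`: `Sum.inl a` is the letter `a ∈ Σ` and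
`Sum.inr a` is its matching letter `a' ∈ Σ'`.
-/

namespace RNAFolding

/-- Letters `x` and `y` match iff `y = x'` or `x = y'`. -/
def LMatches {σ : Type*} : σ ⊕ σ → σ ⊕ σ → Prop
  | .inl a, .inr b => a = b
  | .inr a, .inl b => a = b
  | _, _ => False

/-- Two pairs of indices `(i₁,j₁)`, `(i₂,j₂)` with `i₁<j₁` and `i₂<j₂` "cross" iff they share an
index, or `i₁<i₂<j₁<j₂`, or `i₂<i₁<j₂<j₁`. -/
def Crosses (p q : ℕ × ℕ) : Prop :=
  p.1 = q.1 ∨ p.1 = q.2 ∨ p.2 = q.1 ∨ p.2 = q.2 ∨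
    (p.1 < q.1 ∧ q.1 < p.2 ∧ p.2 < q.2) ∨ (q.1 < p.1 ∧ p.1 < q.2 ∧ q.2 < p.2)

/-- `A` is a valid folding of `S`: every pair `(i,j) ∈ A` satisfies `i < j < |S|` and the letters
`S[i]`, `S[j]` match, and no two pairs of `A` cross. -/
def IsFolding {σ : Type*} (S : List (σ ⊕ σ)) (A : Finset (ℕ × ℕ)) : Prop :=
  (∀ p ∈ A, p.1 < p.2 ∧ p.2 < S.length ∧ ∃ x ∈ S[p.1]?, ∃ y ∈ S[p.2]?, LMatches x y) ∧
    ∀ p ∈ A, ∀ q ∈ A, p ≠ q → ¬ Crosses p q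

/-- The weighted RNA folding score `WRNA(S)`: the maximum of `∑_{(i,j) ∈ A} w(S[i])` over all
valid foldings `A` of `S` (with the weight function extended to `Σ'` by `w(σ') = w(σ)`). -/
noncomputable def WRNA {σ : Type*} (w : σ → ℕ) (S : List (σ ⊕ σ)) : ℕ :=
  sSup {m | ∃ A : Finset (ℕ × ℕ),
    IsFolding S A ∧ ∑ p ∈ A, (S.map (Sum.elim w w)).getD p.1 0 = m}

/-- The (unweighted) RNA folding score `RNA(S)`: the maximum number of non-crossing matching
pairs, i.e. the weighted score with all weights equal to `1`. -/
noncomputable def RNA {σ : Type*} (S : List (σ ⊕ σ)) : ℕ := WRNA (fun _ => 1) S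

/-! ### The clique-detecting RNA sequence -/

/-- The three pairs of types `αβ`, `αγ`, `βγ`. -/
inductive PT
  | ab | ag | bg
  deriving DecidableEq

/-- The base symbols `0, 1, $, #, g` that get marked with a pair of types. -/
inductive RBase
  | b0 | b1 | dollar | hash | g
  deriving DecidableEq

/-- The 18 plain letters: `Σ = {α, β, γ} ∪ ⋃_{xy ∈ {αβ,αγ,βγ}} {0, 1, $, #, g}_xy`
(together with the matching copies `Σ'` this makes 36 letters). -/
inductive RSig
  | alpha | beta | gamma
  | mk (b : RBase) (p : PT)
  deriving DecidableEq

/-- Letters: a plain (`Sum.inl`) or primed (`Sum.inr`) copy of each symbol of `Σ`. -/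
abbrev RL := RSig ⊕ RSig

/-- A "core" symbol: a base symbol with a primed-ness flag, before marking by a pair of types. -/
abbrev RCore := Bool × RBase

/-- Marking a core symbol with the pair of types `xy`. -/
def mark (p : PT) : RCore → RL
  | (false, b) => .inl (.mk b p)
  | (true, b) => .inr (.mk b p)

/-- `[s]_xy`: marking every letter of a core string with the pair of types `xy`. -/
def markStr (p : PT) (s : List RCore) : List RL := s.map (mark p)

/-- `p(s)`: replacing every letter `σ` by its matching letter `σ'` (and conversely). -/
def primeStr (s : List RCore) : List RCore := s.map (fun x => (!x.1, x.2))

/-- `m`-fold repetition `l^m` of a list. -/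
def rep {α : Type*} (l : List α) (m : ℕ) : List α := (List.replicate m l).flatten

/-- The binary encoding `v̄` of a node `v`, of length exactly `2⌈log n⌉`, as a core string. -/
def bin (n : ℕ) (v : Fin n) : List RCore :=
  (List.range (2 * Nat.clog 2 n)).map
    (fun i => (false, if v.val.testBit i then RBase.b1 else RBase.b0))

/-- The (unprimed) letter `$`. -/
def dol : RCore := (false, .dollar)

/-- The (unprimed) letter `#`. -/
def hsh : RCore := (false, .hash)

open Classical in
/-- The neighbors of `v`, in some fixed order. -/
noncomputable def nbrs (n : ℕ) (G : SimpleGraph (Fin n)) (v : Fin n) : List (Fin n) :=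
  (Finset.univ.filter (fun u => G.Adj v u)).toList

open Classical in
/-- The non-neighbors of `v`, in some fixed order. -/
noncomputable def nonNbrs (n : ℕ) (G : SimpleGraph (Fin n)) (v : Fin n) : List (Fin n) :=
  (Finset.univ.filter (fun u => ¬ G.Adj v u)).toList

/-- The node gadget `NG(v) = $^{2n} v̄ $^{2n}`. -/
def NGr (n : ℕ) (v : Fin n) : List RCore :=
  List.replicate (2 * n) dol ++ bin n v ++ List.replicate (2 * n) dol

/-- The list gadget `LG(v) = (∘_{u ∈ N(v)} ($ ū $)) ∘ (∘_{u ∉ N(v)} ($ $))`. -/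
noncomputable def LGr (n : ℕ) (G : SimpleGraph (Fin n)) (v : Fin n) : List RCore :=
  (nbrs n G v).flatMap (fun u => [dol] ++ bin n u ++ [dol]) ++
    (nonNbrs n G v).flatMap (fun _ => [dol, dol])

/-- The clique node gadget `CNG(t) = ∘_{v ∈ t} (# NG(v) #)^k`. -/
noncomputable def CNGr (n k : ℕ) (t : Finset (Fin n)) : List RCore :=
  t.toList.flatMap (fun v => rep ([hsh] ++ NGr n v ++ [hsh]) k)

/-- The clique list gadget `CLG(t) = (∘_{v ∈ t} (# LG(v) #))^k`. -/
noncomputable def CLGr (n k : ℕ) (G : SimpleGraph (Fin n)) (t : Finset (Fin n)) : List RCore :=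
  rep (t.toList.flatMap (fun v => [hsh] ++ LGr n G v ++ [hsh])) k

/-- `CG_α(t) = [g CNG(t) g]_{αγ} ∘ [g' p(CLG(t))^R g']_{αβ}`. -/
noncomputable def CGa (n k : ℕ) (G : SimpleGraph (Fin n)) (t : Finset (Fin n)) : List RL :=
  markStr .ag ([(false, .g)] ++ CNGr n k t ++ [(false, .g)]) ++
    markStr .ab ([(true, .g)] ++ (primeStr (CLGr n k G t)).reverse ++ [(true, .g)])

/-- `CG_β(t) = [g CNG(t) g]_{αβ} ∘ [g' p(CLG(t))^R g']_{βγ}`. -/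
noncomputable def CGb (n k : ℕ) (G : SimpleGraph (Fin n)) (t : Finset (Fin n)) : List RL :=
  markStr .ab ([(false, .g)] ++ CNGr n k t ++ [(false, .g)]) ++
    markStr .bg ([(true, .g)] ++ (primeStr (CLGr n k G t)).reverse ++ [(true, .g)])

/-- `CG_γ(t) = [g CNG(t) g]_{βγ} ∘ [g' p(CLG(t))^R g']_{αγ}`. -/
noncomputable def CGg (n k : ℕ) (G : SimpleGraph (Fin n)) (t : Finset (Fin n)) : List RL :=
  markStr .bg ([(false, .g)] ++ CNGr n k t ++ [(false, .g)]) ++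
    markStr .ag ([(true, .g)] ++ (primeStr (CLGr n k G t)).reverse ++ [(true, .g)])

/-- `log n` (base 2). -/
def logn (n : ℕ) : ℕ := Nat.log 2 n

/-- `ℓ₁ = 10·k²·n·log n`. -/
def l1 (n k : ℕ) : ℕ := 10 * k ^ 2 * n * logn n

/-- `ℓ₂ = 10·k²·ℓ₁`. -/
def l2 (n k : ℕ) : ℕ := 10 * k ^ 2 * l1 n k

/-- `ℓ₃ = 10·ℓ₂`. -/
def l3 (n k : ℕ) : ℕ := 10 * l2 n k

/-- The weight function: `w(0) = w(1) = 1`, `w($) = 10·log n`, `w(#) = ℓ₁`, `w(g) = ℓ₂`,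
`w(α) = w(β) = w(γ) = ℓ₃`. -/
def wt (n k : ℕ) : RSig → ℕ
  | .alpha => l3 n k
  | .beta => l3 n k
  | .gamma => l3 n k
  | .mk .b0 _ => 1
  | .mk .b1 _ => 1
  | .mk .dollar _ => 10 * logn n
  | .mk .hash _ => l1 n k
  | .mk .g _ => l2 n k

open Classical in
/-- The set `C_k` of `k`-cliques of `G`, in some fixed order. -/
noncomputable def cliqueList (n k : ℕ) (G : SimpleGraph (Fin n)) : List (Finset (Fin n)) :=
  (Finset.univ.filter (fun t => G.IsNClique k t)).toList

/-- The clique-detecting sequence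
`S_G = α^{2n^k} (∘_t α' CG_α(t) α') α^{2n^k} ∘ β^{2n^k} (∘_t β' CG_β(t) β') β^{2n^k} ∘
γ^{2n^k} (∘_t γ' CG_γ(t) γ') γ^{2n^k}`. -/
noncomputable def SG (n k : ℕ) (G : SimpleGraph (Fin n)) : List RL :=
  List.replicate (2 * n ^ k) (.inl .alpha) ++
    (cliqueList n k G).flatMap (fun t => [.inr .alpha] ++ CGa n k G t ++ [.inr .alpha]) ++
    List.replicate (2 * n ^ k) (.inl .alpha) ++
  (List.replicate (2 * n ^ k) (.inl .beta) ++
    (cliqueList n k G).flatMap (fun t => [.inr .beta] ++ CGb n k G t ++ [.inr .beta]) ++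
    List.replicate (2 * n ^ k) (.inl .beta)) ++
  (List.replicate (2 * n ^ k) (.inl .gamma) ++
    (cliqueList n k G).flatMap (fun t => [.inr .gamma] ++ CGg n k G t ++ [.inr .gamma]) ++
    List.replicate (2 * n ^ k) (.inl .gamma))


/-- Inductive generation of foldings. -/
inductive Fold {σ : Type*} (w : σ → ℕ) : List (σ ⊕ σ) → ℕ → Prop
  | zero (S) : Fold w S 0
  | app {S T a b} : Fold w S a → Fold w T b → Fold w (S ++ T) (a + b)
  | wrap {x y S a} : LMatches x y → Fold w S a → Fold w (x :: (S ++ [y])) (Sum.elim w w x + a)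

def shiftE (d : ℕ) : ℕ × ℕ ↪ ℕ × ℕ :=
  ⟨fun p => (d + p.1, d + p.2), fun p q h => by
    simp only [Prod.mk.injEq] at h
    ext <;> omega⟩

theorem shiftE_apply (d : ℕ) (p : ℕ × ℕ) : shiftE d p = (d + p.1, d + p.2) := rfl

theorem isFolding_append {σ : Type*} {S T : List (σ ⊕ σ)} {A B : Finset (ℕ × ℕ)}
    (hA : IsFolding S A) (hB : IsFolding T B) :
    IsFolding (S ++ T) (A ∪ B.map (shiftE S.length)) := by
  have hAb : ∀ p ∈ A, p.1 < p.2 ∧ p.2 < S.length := fun p hp =>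
    ⟨(hA.1 p hp).1, (hA.1 p hp).2.1⟩
  have hBb : ∀ p ∈ B, p.1 < p.2 := fun p hp => (hB.1 p hp).1
  refine ⟨?_, ?_⟩
  · intro p hp
    rw [Finset.mem_union, Finset.mem_map] at hp
    rcases hp with hp | ⟨q, hq, rfl⟩
    · obtain ⟨h1, h2, x, hx, y, hy, hm⟩ := hA.1 p hp
      refine ⟨h1, by simp; omega, x, ?_, y, ?_, hm⟩
      · rw [List.getElem?_append_left (by omega)]; exact hx
      · rw [List.getElem?_append_left (by omega)]; exact hy
    · obtain ⟨h1, h2, x, hx, y, hy, hm⟩ := hB.1 q hq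
      refine ⟨by simp [shiftE_apply]; omega, by simp [shiftE_apply]; omega, x, ?_, y, ?_, hm⟩
      · simp only [shiftE_apply]
        rw [List.getElem?_append_right (by omega), Nat.add_sub_cancel_left]; exact hx
      · simp only [shiftE_apply]
        rw [List.getElem?_append_right (by omega), Nat.add_sub_cancel_left]; exact hy
  · intro p hp q hq hne
    rw [Finset.mem_union, Finset.mem_map] at hp hq
    rcases hp with hp | ⟨p, hp, rfl⟩ <;> rcases hq with hq | ⟨q, hq, rfl⟩
    · exact hA.2 p hp q hq hne
    · have := hAb p hp
      have := hBb q hq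
      simp only [Crosses, shiftE_apply]; omega
    · have := hAb q hq
      have := hBb p hp
      simp only [Crosses, shiftE_apply]; omega
    · have := hB.2 p hp q hq (fun h => hne (by rw [h]))
      simp only [Crosses, shiftE_apply] at this ⊢
      omega

theorem isFolding_wrap {σ : Type*} {S : List (σ ⊕ σ)} {A : Finset (ℕ × ℕ)} {x y : σ ⊕ σ}
    (hm : LMatches x y) (hA : IsFolding S A) :
    IsFolding (x :: (S ++ [y])) (insert (0, S.length + 1) (A.map (shiftE 1))) := by
  have hAb : ∀ p ∈ A, p.1 < p.2 ∧ p.2 < S.length := fun p hp =>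
    ⟨(hA.1 p hp).1, (hA.1 p hp).2.1⟩
  refine ⟨?_, ?_⟩
  · intro p hp
    rw [Finset.mem_insert, Finset.mem_map] at hp
    rcases hp with rfl | ⟨q, hq, rfl⟩
    · refine ⟨by simp, by simp, x, by simp, y, by simp, hm⟩
    · obtain ⟨h1, h2, x, hx, y, hy, hm⟩ := hA.1 q hq
      refine ⟨by simp [shiftE_apply]; omega, by simp [shiftE_apply]; omega, x, ?_, y, ?_, hm⟩
      · simp only [shiftE_apply]
        rw [Nat.add_comm 1, List.getElem?_cons_succ, List.getElem?_append_left (by omega)]; exact hx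
      · simp only [shiftE_apply]
        rw [Nat.add_comm 1, List.getElem?_cons_succ, List.getElem?_append_left (by omega)]; exact hy
  · intro p hp q hq hne
    rw [Finset.mem_insert, Finset.mem_map] at hp hq
    rcases hp with rfl | ⟨p, hp, rfl⟩ <;> rcases hq with rfl | ⟨q, hq, rfl⟩
    · exact absurd rfl hne
    · have := hAb q hq
      simp only [Crosses, shiftE_apply]; omega
    · have := hAb p hp
      simp only [Crosses, shiftE_apply]; omega
    · have := hA.2 p hp q hq (fun h => hne (by rw [h]))
      simp only [Crosses, shiftE_apply] at this ⊢
      omega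

theorem Fold.sound {σ : Type*} {w : σ → ℕ} {S : List (σ ⊕ σ)} {m : ℕ} (h : Fold w S m) :
    ∃ A : Finset (ℕ × ℕ), IsFolding S A ∧
      ∑ p ∈ A, (S.map (Sum.elim w w)).getD p.1 0 = m := by
  induction h with
  | zero S => exact ⟨∅, ⟨by simp, by simp⟩, by simp⟩
  | @app S T a b _ _ ihS ihT =>
    obtain ⟨A, hA, rfl⟩ := ihS
    obtain ⟨B, hB, rfl⟩ := ihT
    refine ⟨_, isFolding_append hA hB, ?_⟩
    rw [Finset.sum_union, Finset.sum_map]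
    · congr 1
      · refine Finset.sum_congr rfl fun p hp => ?_
        have := hA.1 p hp
        rw [List.map_append, List.getD_append _ _ _ _ (by simp; omega)]
      · refine Finset.sum_congr rfl fun p hp => ?_
        rw [List.map_append, List.getD_append_right _ _ _ _ (by simp [shiftE_apply])]
        simp [shiftE_apply]
    · rw [Finset.disjoint_left]
      intro p hp hq
      rw [Finset.mem_map] at hq
      obtain ⟨q, hq, rfl⟩ := hq
      have := hA.1 _ hp
      simp only [shiftE_apply] at this
      omega
  | @wrap x y S a hm _ ih =>
    obtain ⟨A, hA, rfl⟩ := ih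
    refine ⟨_, isFolding_wrap hm hA, ?_⟩
    rw [Finset.sum_insert, Finset.sum_map]
    · congr 1
      refine Finset.sum_congr rfl fun p hp => ?_
      have := hA.1 p hp
      simp only [shiftE_apply]
      rw [Nat.add_comm 1, List.map_cons, List.getD_cons_succ, List.map_append,
        List.getD_append _ _ _ _ (by simp; omega)]
    · simp [shiftE_apply]

theorem Fold.mono {σ : Type*} {w : σ → ℕ} {S S' : List (σ ⊕ σ)} {m : ℕ} (h : Fold w S m)
    (hs : S.Sublist S') : Fold w S' m := by
  induction h generalizing S' with
  | zero S => exact .zero _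
  | @app S T a b _ _ ihS ihT =>
    rw [List.append_sublist_iff] at hs
    obtain ⟨r1, r2, rfl, h1, h2⟩ := hs
    exact .app (ihS h1) (ihT h2)
  | @wrap x y S a hm _ ih =>
    rw [List.cons_sublist_iff] at hs
    obtain ⟨r1, r2, rfl, h1, h2⟩ := hs
    rw [List.append_sublist_iff] at h2
    obtain ⟨r3, r4, rfl, h3, h4⟩ := h2
    rw [List.singleton_sublist] at h4
    obtain ⟨a1, a2, rfl⟩ := List.append_of_mem h1
    obtain ⟨b1, b2, rfl⟩ := List.append_of_mem h4
    have h5 : Fold w (a2 ++ r3 ++ b1) a := ih (by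
      refine h3.trans ?_
      rw [List.append_assoc]
      exact (List.sublist_append_left _ _).trans (List.sublist_append_right _ _))
    have h6 := Fold.app (Fold.app (Fold.zero (w := w) a1) (Fold.wrap hm h5)) (Fold.zero b2)
    simpa using h6

theorem Fold.nest {σ ι : Type*} {w : σ → ℕ} (f f' : ι → σ ⊕ σ)
    (hm : ∀ x, LMatches (f x) (f' x)) (Z X Y : List ι) (hX : Z.Sublist X) (hY : Z.Sublist Y)
    {M : List (σ ⊕ σ)} {a : ℕ} (h : Fold w M a) :
    Fold w (X.map f ++ M ++ (Y.map f').reverse)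
      ((Z.map (fun z => Sum.elim w w (f z))).sum + a) := by
  have h0 : Fold w (Z.map f ++ M ++ (Z.map f').reverse)
      ((Z.map (fun z => Sum.elim w w (f z))).sum + a) := by
    clear hX hY
    induction Z with
    | nil => simpa using h
    | cons z Z ih =>
      have := Fold.wrap (hm z) ih
      simpa [add_assoc] using this
  refine h0.mono ?_
  exact ((hX.map f).append (List.Sublist.refl _)).append ((hY.map f').reverse)

theorem Fold.nest' {σ ι : Type*} {w : σ → ℕ} (f f' : ι → σ ⊕ σ)
    (hm : ∀ x, LMatches (f' x) (f x)) (hw : ∀ x, Sum.elim w w (f' x) = Sum.elim w w (f x))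
    (Z X Y : List ι) (hX : Z.Sublist X) (hY : Z.Sublist Y)
    {M : List (σ ⊕ σ)} {a : ℕ} (h : Fold w M a) :
    Fold w ((Y.map f').reverse ++ M ++ X.map f)
      ((Z.map (fun z => Sum.elim w w (f z))).sum + a) := by
  have h0 : Fold w ((Z.map f').reverse ++ M ++ Z.map f)
      ((Z.map (fun z => Sum.elim w w (f z))).sum + a) := by
    clear hX hY
    induction Z generalizing M a with
    | nil => simpa using h
    | cons z Z ih =>
      have := ih (Fold.wrap (hm z) h)
      rw [hw] at this
      simp only [List.map_cons, List.reverse_cons, List.sum_cons]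
      convert this using 1
      · simp
      · ring
  refine h0.mono ?_
  exact ((hY.map f').reverse.append (List.Sublist.refl _)).append (hX.map f)

theorem Fold.repL {σ : Type*} [DecidableEq (σ ⊕ σ)] {w : σ → ℕ} (q : σ) (T : List (σ ⊕ σ)) (m : ℕ)
    (hm : T.countP (fun z => decide (z = .inr q)) ≤ m) :
    Fold w (List.replicate m (.inl q) ++ T) (T.countP (fun z => decide (z = .inr q)) * w q) := by
  induction T using List.reverseRecOn generalizing m with
  | nil => simpa using Fold.zero _
  | append_singleton T x ih =>
    by_cases hx : x = .inr q
    · subst hx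
      simp only [List.countP_append, List.countP_singleton, decide_true, if_true] at hm ⊢
      obtain ⟨m, rfl⟩ : ∃ m', m = m' + 1 := ⟨m - 1, by omega⟩
      have := Fold.wrap (w := w) (x := .inl q) (y := .inr q) rfl (ih m (by omega))
      convert this using 1
      · simp [List.replicate_succ]
      · simp; ring
    · have h0 : [x].countP (fun z => decide (z = .inr q)) = 0 := by simpa using hx
      rw [List.countP_append, h0] at hm ⊢
      simpa using Fold.app (ih m (by omega)) (Fold.zero [x])

theorem Fold.repR {σ : Type*} [DecidableEq (σ ⊕ σ)] {w : σ → ℕ} (q : σ) (T : List (σ ⊕ σ)) (m : ℕ)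
    (hm : T.countP (fun z => decide (z = .inr q)) ≤ m) :
    Fold w (T ++ List.replicate m (.inl q)) (T.countP (fun z => decide (z = .inr q)) * w q) := by
  induction T generalizing m with
  | nil => simpa using Fold.zero _
  | cons x T ih =>
    by_cases hx : x = .inr q
    · subst hx
      simp only [List.countP_cons, decide_true, if_true] at hm ⊢
      obtain ⟨m, rfl⟩ : ∃ m', m = m' + 1 := ⟨m - 1, by omega⟩
      have := Fold.wrap (w := w) (x := .inr q) (y := .inl q) rfl (ih m (by omega))
      convert this using 1
      · simp [List.replicate_succ']
      · simp; ring
    · rw [List.countP_cons_of_neg (by simpa using hx)] at hm ⊢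
      simpa using Fold.app (Fold.zero [x]) (ih m (by omega))



section comb
variable {α : Type*}

theorem full_split {p : α → Bool} {Z A B : List α} (hs : Z.Sublist (A ++ B))
    (hc : Z.countP p = (A ++ B).countP p) :
    ∃ A' B', Z = A' ++ B' ∧ A'.Sublist A ∧ B'.Sublist B ∧ A'.countP p = A.countP p ∧
      B'.countP p = B.countP p := by
  rw [List.sublist_append_iff] at hs
  obtain ⟨A', B', rfl, hA, hB⟩ := hs
  have h1 := hA.countP_le (p := p)
  have h2 := hB.countP_le (p := p)
  rw [List.countP_append, List.countP_append] at hc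
  exact ⟨A', B', rfl, hA, hB, by omega, by omega⟩

theorem full_single {p : α → Bool} {Z : List α} {h : α} (hp : p h = true)
    (hs : Z.Sublist [h]) (hc : Z.countP p = [h].countP p) : Z = [h] := by
  refine hs.eq_of_length ?_
  have := List.countP_le_length (p := p) (l := Z)
  have h2 := hs.length_le
  rw [List.countP_singleton, if_pos hp] at hc
  simp at h2 ⊢
  omega

theorem full_all {p : α → Bool} {Z A : List α} (hp : ∀ a ∈ A, p a = true)
    (hs : Z.Sublist A) (hc : Z.countP p = A.countP p) : Z = A := by
  refine hs.eq_of_length ?_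
  rw [← List.countP_eq_length.2 hp, ← hc, eq_comm, List.countP_eq_length]
  exact fun a ha => hp a (hs.subset ha)

theorem full_block {p : α → Bool} {Z A B : List α} {h : α} (hp : p h = true)
    (hs : Z.Sublist (h :: (A ++ [h]) ++ B)) (hc : Z.countP p = (h :: (A ++ [h]) ++ B).countP p) :
    ∃ A' B', Z = h :: (A' ++ h :: B') ∧ A'.Sublist A ∧ B'.Sublist B ∧ A'.countP p = A.countP p ∧
      B'.countP p = B.countP p := by
  have e : h :: (A ++ [h]) ++ B = [h] ++ (A ++ ([h] ++ B)) := by simp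
  rw [e] at hs hc
  obtain ⟨Z1, Z2, rfl, h1, h2, c1, c2⟩ := full_split hs hc
  obtain ⟨Z3, Z4, rfl, h3, h4, c3, c4⟩ := full_split h2 c2
  obtain ⟨Z5, Z6, rfl, h5, h6, c5, c6⟩ := full_split h4 c4
  rw [full_single hp h1 c1, full_single hp h5 c5]
  exact ⟨Z3, Z6, by simp, h3, h6, c3, c6⟩

theorem cons_inj_of_notMem {h : α} {A A' B B' : List α} (hA : h ∉ A) (hA' : h ∉ A')
    (e : A ++ h :: B = A' ++ h :: B') : A = A' ∧ B = B' := by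
  induction A generalizing A' with
  | nil =>
    cases A' with
    | nil => simpa using e
    | cons a A' => simp at e hA'; exact absurd e.1 hA'.1
  | cons a A ih =>
    cases A' with
    | nil => simp at e hA; exact absurd e.1.symm hA.1
    | cons a' A' =>
      simp only [List.cons_append, List.cons.injEq, List.mem_cons, not_or] at e hA hA'
      obtain ⟨h1, h2⟩ := ih hA.2 hA'.2 e.2
      exact ⟨by rw [e.1, h1], h2⟩

theorem split_blocks {ι : Type*} {p q : α → Bool} {h : α} (hp : p h = true) (hq : q h = true)
    (N L : ι → List α) (hN : ∀ v, h ∉ N v) (hL : ∀ v, h ∉ L v) (vs us : List ι)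
    (hlen : vs.length = us.length) (Z : List α)
    (h1 : Z.Sublist (vs.flatMap (fun v => h :: (N v ++ [h]))))
    (h2 : Z.Sublist (us.flatMap (fun v => h :: (L v ++ [h]))))
    (c1 : Z.countP p = (vs.flatMap (fun v => h :: (N v ++ [h]))).countP p)
    (c2 : Z.countP q = (us.flatMap (fun v => h :: (L v ++ [h]))).countP q) :
    ∀ x ∈ vs.zip us, ∃ W : List α, W.Sublist (N x.1) ∧ W.Sublist (L x.2) ∧
      W.countP p = (N x.1).countP p ∧ W.countP q = (L x.2).countP q := by
  induction vs generalizing us Z with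
  | nil => simp
  | cons v vs ih =>
    cases us with
    | nil => simp
    | cons u us =>
      rw [List.flatMap_cons] at h1 h2 c1 c2
      obtain ⟨A, B, rfl, hA, hB, cA, cB⟩ := full_block hp h1 c1
      obtain ⟨A', B', e, hA', hB', cA', cB'⟩ := full_block hq h2 c2
      rw [List.cons.injEq] at e
      obtain ⟨rfl, rfl⟩ := cons_inj_of_notMem (fun hh => hN v (hA.subset hh))
        (fun hh => hL u (hA'.subset hh)) e.2
      intro x hx
      rw [List.zip_cons_cons, List.mem_cons] at hx
      rcases hx with rfl | hx
      · exact ⟨A, hA, hA', cA, cA'⟩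
      · exact ih us (by simpa using hlen) B hB hB' cB cB' x hx

theorem base_pieces {q : α → Bool} {d : α} (hq : q d = true) (ps : List (List α))
    (hps : ∀ s ∈ ps, d ∉ s) (V : List α) (hV : V ≠ []) (hVd : d ∉ V) (a b : ℕ)
    (h : (List.replicate a d ++ (V ++ List.replicate b d)).Sublist
      (ps.flatMap (fun s => d :: (s ++ [d]))))
    (hc : (List.replicate a d ++ (V ++ List.replicate b d)).countP q =
      (ps.flatMap (fun s => d :: (s ++ [d]))).countP q) : ∃ s ∈ ps, V.Sublist s := by
  induction ps generalizing a with
  | nil => simp at h; exact absurd h.2.1 hV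
  | cons s ps ih =>
    rw [List.flatMap_cons] at h hc
    obtain ⟨A, B, e, hA, hB, cA, cB⟩ := full_block hq h hc
    have hdA : d ∉ A := fun hh => hps s (by simp) (hA.subset hh)
    obtain ⟨v, V', rfl⟩ := List.exists_cons_of_ne_nil hV
    match a with
    | 0 =>
      simp at e hVd
      exact absurd e.1.symm hVd.1
    | 1 =>
      simp only [List.replicate_one, List.cons_append, List.nil_append, List.cons.injEq,
        true_and] at e
      match b with
      | 0 =>
        exfalso
        apply hVd
        have : v :: V' = A ++ d :: B := by simpa using e
        rw [this]; simp
      | b + 1 =>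
        rw [List.replicate_succ, ← List.cons_append] at e
        obtain ⟨rfl, -⟩ := cons_inj_of_notMem hVd hdA e
        exact ⟨s, by simp, hA⟩
    | a + 2 =>
      simp only [List.replicate_succ, List.cons_append, List.cons.injEq, true_and] at e
      have := cons_inj_of_notMem (A := []) (by simp) hdA e
      obtain ⟨rfl, rfl⟩ := this
      obtain ⟨s', hs', h'⟩ := ih (fun s hs => hps s (by simp [hs])) a hB cB
      exact ⟨s', by simp [hs'], h'⟩

theorem base_node {p : α → Bool} {d : α} {V W : List α} {m : ℕ} (hVp : ∀ a ∈ V, p a = true)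
    (h : W.Sublist (List.replicate m d ++ V ++ List.replicate m d))
    (hc : W.countP p = (List.replicate m d ++ V ++ List.replicate m d).countP p) :
    ∃ a b, W = List.replicate a d ++ (V ++ List.replicate b d) := by
  obtain ⟨W1, W3, rfl, h1, h3, c1, c3⟩ := full_split h hc
  obtain ⟨W1, W2, rfl, h1, h2, c1, c2⟩ := full_split h1 c1
  obtain ⟨a, -, rfl⟩ := List.sublist_replicate_iff.1 h1
  obtain ⟨b, -, rfl⟩ := List.sublist_replicate_iff.1 h3
  rw [full_all hVp h2 c2]
  exact ⟨a, b, by simp⟩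

end comb

theorem dol_notMem_bin (n : ℕ) (v : Fin n) : dol ∉ bin n v := by
  simp only [bin, dol, List.mem_map, not_exists, not_and]
  intro x _
  split <;> simp

theorem hsh_notMem_bin (n : ℕ) (v : Fin n) : hsh ∉ bin n v := by
  simp only [bin, hsh, List.mem_map, not_exists, not_and]
  intro x _
  split <;> simp

theorem bin_length (n : ℕ) (v : Fin n) : (bin n v).length = 2 * Nat.clog 2 n := by simp [bin]

theorem bin_inj {n : ℕ} {u v : Fin n} (h : bin n u = bin n v) : u = v := by
  apply Fin.ext
  apply Nat.eq_of_testBit_eq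
  intro i
  by_cases hi : i < 2 * Nat.clog 2 n
  · have := congrArg (fun l => l[i]?) h
    simp only [bin, List.getElem?_map, List.getElem?_range hi, Option.map_some, Option.some.injEq,
      Prod.mk.injEq, true_and] at this
    cases hu : u.val.testBit i <;> cases hv : v.val.testBit i <;> simp_all
  · have key : ∀ x : Fin n, x.val < 2 ^ i := fun x => by
      refine x.2.trans_le ((Nat.le_pow_clog (b := 2) (by norm_num) n).trans ?_)
      exact Nat.pow_le_pow_right (by norm_num) (by omega)
    rw [Nat.testBit_lt_two_pow (key u), Nat.testBit_lt_two_pow (key v)]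

theorem hsh_notMem_NGr (n : ℕ) (v : Fin n) : hsh ∉ NGr n v := by
  simp [NGr, hsh_notMem_bin, List.mem_replicate]
  simp [hsh, dol]

theorem hsh_notMem_LGr (n : ℕ) (G : SimpleGraph (Fin n)) (v : Fin n) : hsh ∉ LGr n G v := by
  simp [LGr, hsh_notMem_bin, List.mem_flatMap]
  simp [hsh, dol]

/-- pieces of the list gadget -/
noncomputable def pieces (n : ℕ) (G : SimpleGraph (Fin n)) (v : Fin n) : List (List RCore) :=
  (nbrs n G v).map (bin n) ++ (nonNbrs n G v).map (fun _ => [])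

theorem LGr_eq (n : ℕ) (G : SimpleGraph (Fin n)) (v : Fin n) :
    LGr n G v = (pieces n G v).flatMap (fun s => dol :: (s ++ [dol])) := by
  simp only [LGr, pieces, List.flatMap_append, List.flatMap_map, List.cons_append,
    List.nil_append]

/-- predicates -/
def pN (x : RCore) : Bool := decide (x ≠ dol)
def pL (x : RCore) : Bool := decide (x = dol ∨ x = hsh)

theorem pair_adj {n : ℕ} (hn : 2 ≤ n) {G : SimpleGraph (Fin n)} {v u : Fin n} {W : List RCore}
    (h1 : W.Sublist (NGr n v)) (h2 : W.Sublist (LGr n G u))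
    (c1 : W.countP pN = (NGr n v).countP pN) (c2 : W.countP pL = (LGr n G u).countP pL) :
    G.Adj u v := by
  have hb : ∀ a ∈ bin n v, pN a = true := by
    intro a ha
    simp only [pN, decide_eq_true_eq]
    rintro rfl
    exact dol_notMem_bin n v ha
  obtain ⟨a, b, rfl⟩ := base_node hb h1 c1
  rw [LGr_eq] at h2 c2
  have hpos : 0 < Nat.clog 2 n := Nat.clog_pos (by norm_num) hn
  have hne : bin n v ≠ [] := by
    intro h
    have := bin_length n v
    rw [h] at this; simp at this; omega
  obtain ⟨s, hs, hsub⟩ := base_pieces (by simp [pL]) (pieces n G u) (by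
    intro s hs
    simp only [pieces, List.mem_append, List.mem_map] at hs
    rcases hs with ⟨x, _, rfl⟩ | ⟨x, _, rfl⟩
    · exact dol_notMem_bin n x
    · simp) _ hne (dol_notMem_bin n v) a b h2 c2
  simp only [pieces, List.mem_append, List.mem_map] at hs
  rcases hs with ⟨x, hx, rfl⟩ | ⟨x, _, rfl⟩
  · have := hsub.eq_of_length (by rw [bin_length, bin_length])
    rw [bin_inj this]
    simpa [nbrs] using hx
  · exact absurd (List.sublist_nil.1 hsub) hne

/-- node sequence of CNG -/
noncomputable def vsL (n k : ℕ) (t : Finset (Fin n)) : List (Fin n) :=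
  t.toList.flatMap (fun v => List.replicate k v)
noncomputable def usL (n k : ℕ) (t : Finset (Fin n)) : List (Fin n) := rep t.toList k

theorem flatMap_rep {ι α : Type*} (f : ι → List α) (v : ι) (k : ℕ) :
    (List.replicate k v).flatMap f = rep (f v) k := by
  simp [rep, List.flatMap_def, List.map_replicate]

theorem rep_flatMap {ι α : Type*} (f : ι → List α) (l : List ι) (k : ℕ) :
    (rep l k).flatMap f = rep (l.flatMap f) k := by
  unfold rep
  induction k with
  | zero => simp
  | succ k ih => simp [List.replicate_succ, List.flatMap_append, ih]

theorem CNGr_eq (n k : ℕ) (t : Finset (Fin n)) :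
    CNGr n k t = (vsL n k t).flatMap (fun v => hsh :: (NGr n v ++ [hsh])) := by
  unfold CNGr vsL
  rw [List.flatMap_assoc]
  congr 1
  funext v
  rw [flatMap_rep]
  simp

theorem CLGr_eq (n k : ℕ) (G : SimpleGraph (Fin n)) (t : Finset (Fin n)) :
    CLGr n k G t = (usL n k t).flatMap (fun v => hsh :: (LGr n G v ++ [hsh])) := by
  unfold CLGr usL
  rw [rep_flatMap]
  simp

theorem rep_length {α : Type*} (l : List α) (k : ℕ) : (rep l k).length = k * l.length := by
  simp [rep]

theorem vsL_length (n k : ℕ) (t : Finset (Fin n)) : (vsL n k t).length = t.card * k := by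
  simp [vsL, List.length_flatMap]

theorem usL_length (n k : ℕ) (t : Finset (Fin n)) : (usL n k t).length = k * t.card := by
  simp [usL, rep_length]

theorem zip_mem_aux {ι : Type*} (l us : List ι) (v u : ι) (hv : v ∈ l) (hu : u ∈ us) :
    (v, u) ∈ (l.flatMap (fun v => List.replicate us.length v)).zip (rep us l.length) := by
  induction l with
  | nil => simp at hv
  | cons a l ih =>
    simp only [List.flatMap_cons, rep, List.length_cons, List.replicate_succ, List.flatten_cons]
    rw [List.zip_append (by simp), List.mem_append]
    rw [List.mem_cons] at hv
    rcases hv with rfl | hv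
    · left
      obtain ⟨i, hi, rfl⟩ := List.getElem_of_mem hu
      rw [List.mem_iff_getElem]
      exact ⟨i, by simpa using hi, by simp⟩
    · right
      exact ih hv

theorem zip_mem {n k : ℕ} {t t' : Finset (Fin n)} (ht : t.card = k) (ht' : t'.card = k)
    {v u : Fin n} (hv : v ∈ t) (hu : u ∈ t') : (v, u) ∈ (vsL n k t).zip (usL n k t') := by
  have := zip_mem_aux t.toList t'.toList v u (by simpa using hv) (by simpa using hu)
  rw [Finset.length_toList, Finset.length_toList, ht, ht'] at this
  exact this

/-- A full common subsequence gives full adjacency. -/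
theorem full_adj {n k : ℕ} (hn : 2 ≤ n) {G : SimpleGraph (Fin n)} {t t' : Finset (Fin n)}
    (ht : t.card = k) (ht' : t'.card = k) {Z : List RCore}
    (h1 : Z.Sublist (CNGr n k t)) (h2 : Z.Sublist (CLGr n k G t'))
    (c1 : Z.countP pN = (CNGr n k t).countP pN) (c2 : Z.countP pL = (CLGr n k G t').countP pL) :
    ∀ v ∈ t, ∀ u ∈ t', G.Adj u v := by
  intro v hv u hu
  rw [CNGr_eq] at h1 c1
  rw [CLGr_eq] at h2 c2
  obtain ⟨W, w1, w2, w3, w4⟩ := split_blocks (h := hsh) (p := pN) (q := pL) (by decide) (by decide)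
    (NGr n) (LGr n G)
    (hsh_notMem_NGr n) (hsh_notMem_LGr n G) _ _ (by rw [vsL_length, usL_length, ht, ht']) Z
    h1 h2 c1 c2 (v, u) (zip_mem ht ht' hv hu)
  exact pair_adj hn w1 w2 w3 w4

/-! lower bound -/

theorem nbrs_length_add (n : ℕ) (G : SimpleGraph (Fin n)) (v : Fin n) :
    (nbrs n G v).length + (nonNbrs n G v).length = n := by
  classical
  simp only [nbrs, nonNbrs, Finset.length_toList]
  rw [Finset.card_filter_add_card_filter_not]; simp

theorem flatMap_dol_sub {ι : Type*} (f : ι → List RCore) (l : List ι) :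
    (List.replicate (2 * l.length) dol).Sublist (l.flatMap (fun u => [dol] ++ f u ++ [dol])) := by
  induction l with
  | nil => simp
  | cons a l ih =>
    have e : List.replicate (2 * (a :: l).length) dol =
      ([dol] ++ [] ++ [dol]) ++ List.replicate (2 * l.length) dol := by
      simp [Nat.mul_add, List.replicate_succ]
    rw [e, List.flatMap_cons]
    refine List.Sublist.append ?_ ih
    exact ((List.Sublist.refl _).append (List.nil_sublist _)).append (List.Sublist.refl _)

theorem exists_W {n : ℕ} {G : SimpleGraph (Fin n)} {v u : Fin n} (h : G.Adj u v) :
    ∃ a b, a + b = 2 * n ∧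
      (List.replicate a dol ++ bin n v ++ List.replicate b dol).Sublist (NGr n v) ∧
      (List.replicate a dol ++ bin n v ++ List.replicate b dol).Sublist (LGr n G u) := by
  have hv : v ∈ nbrs n G u := by simpa [nbrs] using h
  have hl := nbrs_length_add n G u
  obtain ⟨l1, l2, e⟩ := List.append_of_mem hv
  rw [e] at hl
  simp only [List.length_append, List.length_cons] at hl
  refine ⟨2 * l1.length + 1, 2 * l2.length + 1 + 2 * (nonNbrs n G u).length, by omega, ?_, ?_⟩
  · unfold NGr
    refine ((List.replicate_sublist_replicate _).2 (by omega)).append (List.Sublist.refl _)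
      |>.append ((List.replicate_sublist_replicate _).2 (by omega))
  · unfold LGr
    rw [e]
    have h1 := flatMap_dol_sub (bin n) l1
    have h2 := flatMap_dol_sub (bin n) l2
    have h3 := flatMap_dol_sub (fun _ => []) (nonNbrs n G u)
    have := ((h1.append (List.Sublist.refl ([dol] ++ bin n v ++ [dol]))).append h2).append h3
    have e2 : List.replicate (2 * l1.length + 1) dol ++ bin n v ++
        List.replicate (2 * l2.length + 1 + 2 * (nonNbrs n G u).length) dol =
        List.replicate (2 * l1.length) dol ++ ([dol] ++ bin n v ++ [dol]) ++
        List.replicate (2 * l2.length) dol ++ List.replicate (2 * (nonNbrs n G u).length) dol := by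
      rw [List.replicate_succ', show 2 * l2.length + 1 + 2 * (nonNbrs n G u).length =
        1 + (2 * l2.length + 2 * (nonNbrs n G u).length) by omega, List.replicate_add,
        List.replicate_add]
      simp
    rw [e2]
    convert this using 1
    simp

/-- core weights -/
def wc (n k : ℕ) (x : RCore) : ℕ := wt n k (.mk x.2 .ab)

theorem sum_bin (n k : ℕ) (v : Fin n) : ((bin n v).map (wc n k)).sum = 2 * Nat.clog 2 n := by
  have : (bin n v).map (wc n k) = List.replicate (2 * Nat.clog 2 n) 1 := by
    rw [List.eq_replicate_iff]
    refine ⟨by simp [bin], ?_⟩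
    intro b hb
    simp only [bin, List.map_map, List.mem_map] at hb
    obtain ⟨i, _, rfl⟩ := hb
    simp only [wc, Function.comp]
    split <;> rfl
  rw [this]; simp

def E1 (n : ℕ) : ℕ := 2 * n * (10 * logn n) + 2 * Nat.clog 2 n

theorem exists_Z {n k : ℕ} {G : SimpleGraph (Fin n)} (vs us : List (Fin n))
    (hlen : vs.length = us.length) (hadj : ∀ v ∈ vs, ∀ u ∈ us, G.Adj u v) :
    ∃ Z : List RCore, Z.Sublist (vs.flatMap (fun v => hsh :: (NGr n v ++ [hsh]))) ∧
      Z.Sublist (us.flatMap (fun v => hsh :: (LGr n G v ++ [hsh]))) ∧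
      (Z.map (wc n k)).sum = vs.length * (2 * l1 n k + E1 n) := by
  induction vs generalizing us with
  | nil =>
    cases us with
    | nil => exact ⟨[], by simp, by simp, by simp⟩
    | cons u us => simp at hlen
  | cons v vs ih =>
    cases us with
    | nil => simp at hlen
    | cons u us =>
      obtain ⟨Z, h1, h2, h3⟩ := ih us (by simpa using hlen)
        (fun v hv u hu => hadj v (by simp [hv]) u (by simp [hu]))
      obtain ⟨a, b, hab, w1, w2⟩ := exists_W (hadj v (by simp) u (by simp))
      refine ⟨hsh :: ((List.replicate a dol ++ bin n v ++ List.replicate b dol) ++ [hsh]) ++ Z,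
        ?_, ?_, ?_⟩
      · rw [List.flatMap_cons]
        exact ((w1.append (List.Sublist.refl _)).cons_cons _).append h1
      · rw [List.flatMap_cons]
        exact ((w2.append (List.Sublist.refl _)).cons_cons _).append h2
      · have e1 : wc n k hsh = l1 n k := rfl
        have e2 : wc n k dol = 10 * logn n := rfl
        simp only [List.map_append, List.map_cons, List.sum_append, List.sum_cons, h3, sum_bin,
          List.map_replicate, List.sum_replicate, e1, e2, E1, List.length_cons, ← hab, smul_eq_mul,
          List.map_nil, List.sum_nil]
        ring

theorem exists_full {n k : ℕ} {G : SimpleGraph (Fin n)} {t t' : Finset (Fin n)}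
    (ht : t.card = k) (ht' : t'.card = k) (hadj : ∀ v ∈ t, ∀ u ∈ t', G.Adj u v) :
    ∃ Z : List RCore, Z.Sublist (CNGr n k t) ∧ Z.Sublist (CLGr n k G t') ∧
      (Z.map (wc n k)).sum = k * k * (2 * l1 n k + E1 n) := by
  rw [CNGr_eq, CLGr_eq]
  obtain ⟨Z, h1, h2, h3⟩ := exists_Z (n := n) (k := k) (G := G) (vsL n k t) (usL n k t')
    (by rw [vsL_length, usL_length, ht, ht']) (by
      intro v hv u hu
      apply hadj
      · simp [vsL] at hv; exact hv.1
      · simp [usL, rep] at hu; exact hu.2)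
  exact ⟨Z, h1, h2, by rw [h3, vsL_length, ht]⟩



def gC : RCore := (false, .g)

noncomputable def UU (n k : ℕ) (p : PT) (t : Finset (Fin n)) : List RL :=
  markStr p ([(false, .g)] ++ CNGr n k t ++ [(false, .g)])

noncomputable def VV (n k : ℕ) (G : SimpleGraph (Fin n)) (p : PT) (t : Finset (Fin n)) : List RL :=
  markStr p ([(true, .g)] ++ (primeStr (CLGr n k G t)).reverse ++ [(true, .g)])

def XX (l : List RCore) : List RCore := gC :: (l ++ [gC])

def markP (p : PT) (x : RCore) : RL := mark p (!x.1, x.2)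

theorem UU_eq (n k : ℕ) (p : PT) (t : Finset (Fin n)) :
    UU n k p t = (XX (CNGr n k t)).map (mark p) := by
  simp [UU, XX, markStr, gC]

theorem VV_eq (n k : ℕ) (G : SimpleGraph (Fin n)) (p : PT) (t : Finset (Fin n)) :
    VV n k G p t = ((XX (CLGr n k G t)).map (markP p)).reverse := by
  simp [VV, XX, markStr, gC, primeStr, markP, List.map_reverse, Function.comp_def]

theorem match_mark (p : PT) (x : RCore) : LMatches (mark p x) (markP p x) := by
  obtain ⟨b, x⟩ := x
  cases b <;> simp [mark, markP, LMatches]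

theorem match_mark' (p : PT) (x : RCore) : LMatches (markP p x) (mark p x) := by
  obtain ⟨b, x⟩ := x
  cases b <;> simp [mark, markP, LMatches]

theorem wt_mark (n k : ℕ) (p : PT) (x : RCore) :
    Sum.elim (wt n k) (wt n k) (mark p x) = wc n k x := by
  obtain ⟨b, x⟩ := x
  cases b <;> cases x <;> simp [mark, wc, wt]

theorem wt_markP (n k : ℕ) (p : PT) (x : RCore) :
    Sum.elim (wt n k) (wt n k) (markP p x) = wc n k x := by
  obtain ⟨b, x⟩ := x
  cases b <;> cases x <;> simp [mark, markP, wc, wt]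

def DD (n k : ℕ) : ℕ := 2 * l2 n k + k * k * (2 * l1 n k + E1 n)

theorem exists_full' {n k : ℕ} {G : SimpleGraph (Fin n)} {t t' : Finset (Fin n)}
    (ht : t.card = k) (ht' : t'.card = k) (hadj : ∀ v ∈ t, ∀ u ∈ t', G.Adj u v) :
    ∃ Z : List RCore, Z.Sublist (XX (CNGr n k t)) ∧ Z.Sublist (XX (CLGr n k G t')) ∧
      (Z.map (wc n k)).sum = DD n k := by
  obtain ⟨Z, h1, h2, h3⟩ := exists_full (k := k) ht ht' hadj
  refine ⟨gC :: (Z ++ [gC]), (h1.append (.refl _)).cons_cons _,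
    (h2.append (.refl _)).cons_cons _, ?_⟩
  have e : wc n k gC = l2 n k := rfl
  simp [h3, e, DD]
  ring

theorem foldUV {n k : ℕ} {G : SimpleGraph (Fin n)} {t t' : Finset (Fin n)} (p : PT)
    (ht : t.card = k) (ht' : t'.card = k) (hadj : ∀ v ∈ t, ∀ u ∈ t', G.Adj u v)
    {M : List RL} {a : ℕ} (h : Fold (wt n k) M a) :
    Fold (wt n k) (UU n k p t ++ M ++ VV n k G p t') (DD n k + a) := by
  obtain ⟨Z, h1, h2, h3⟩ := exists_full' (k := k) ht ht' hadj
  rw [UU_eq, VV_eq]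
  have := Fold.nest (w := wt n k) (mark p) (markP p) (match_mark p) Z _ _ h1 h2 h
  simpa only [wt_mark, h3] using this

theorem foldVU {n k : ℕ} {G : SimpleGraph (Fin n)} {t t' : Finset (Fin n)} (p : PT)
    (ht : t.card = k) (ht' : t'.card = k) (hadj : ∀ v ∈ t, ∀ u ∈ t', G.Adj u v)
    {M : List RL} {a : ℕ} (h : Fold (wt n k) M a) :
    Fold (wt n k) (VV n k G p t' ++ M ++ UU n k p t) (DD n k + a) := by
  obtain ⟨Z, h1, h2, h3⟩ := exists_full' (k := k) ht ht' hadj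
  rw [UU_eq, VV_eq]
  have := Fold.nest' (w := wt n k) (mark p) (markP p) (match_mark' p)
    (fun x => by rw [wt_mark, wt_markP]) Z _ _ h1 h2 h
  simpa only [wt_mark, h3] using this

/-- gadget sequence -/
def gads {τ : Type*} (q : RSig) (C : τ → List RL) (cl : List τ) : List RL :=
  cl.flatMap (fun t => [.inr q] ++ C t ++ [.inr q])

def blk {τ : Type*} (M : ℕ) (q : RSig) (C : τ → List RL) (cl : List τ) : List RL :=
  List.replicate M (.inl q) ++ gads q C cl ++ List.replicate M (.inl q)

theorem SG_eq (n k : ℕ) (G : SimpleGraph (Fin n)) :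
    SG n k G = blk (2 * n ^ k) .alpha (CGa n k G) (cliqueList n k G) ++
      blk (2 * n ^ k) .beta (CGb n k G) (cliqueList n k G) ++
      blk (2 * n ^ k) .gamma (CGg n k G) (cliqueList n k G) := rfl

theorem count_gads {τ : Type*} (q : RSig) (C : τ → List RL) (cl : List τ)
    (hC : ∀ t, .inr q ∉ C t) :
    (gads q C cl).countP (fun z => decide (z = .inr q)) = 2 * cl.length := by
  induction cl with
  | nil => simp [gads]
  | cons t cl ih =>
    have h0 : (C t).countP (fun z => decide (z = .inr q)) = 0 := by
      rw [List.countP_eq_zero]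
      rintro x hx h
      simp only [decide_eq_true_eq] at h
      subst h
      exact hC t hx
    unfold gads at ih ⊢
    rw [List.flatMap_cons, List.countP_append, ih]
    simp [h0]
    ring

theorem blk_split {τ : Type*} {w : RSig → ℕ} (M : ℕ) (q : RSig) (C : τ → List RL) (cl : List τ)
    (hC : ∀ t, .inr q ∉ C t) (t : τ) (ht : t ∈ cl) (hM : 2 * cl.length ≤ M) :
    ∃ A B a b, blk M q C cl = A ++ C t ++ B ∧ Fold w A a ∧ Fold w B b ∧
      a + b = 2 * cl.length * w q := by
  obtain ⟨P, Q, rfl⟩ := List.append_of_mem ht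
  have cP : (gads q C P ++ [Sum.inr q]).countP (fun z => decide (z = Sum.inr q)) = 2 * P.length + 1 := by
    rw [List.countP_append, count_gads q C P hC]; simp
  have cQ : ((Sum.inr q : RL) :: gads q C Q).countP (fun z => decide (z = .inr q)) = 2 * Q.length + 1 := by
    rw [List.countP_cons, count_gads q C Q hC]; simp
  simp only [List.length_append, List.length_cons] at hM
  have h1 := Fold.repL (w := w) q (gads q C P ++ [.inr q]) M (by omega)
  have h2 := Fold.repR (w := w) q (.inr q :: gads q C Q) M (by omega)
  refine ⟨_, _, _, _, ?_, h1, h2, ?_⟩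
  · simp [blk, gads]
  · rw [cP, cQ]; simp only [List.length_append, List.length_cons]; ring

theorem alpha_notMem_mark {p : PT} {l : List RCore} {x : RL} (hx : x ∈ markStr p l) :
    x ≠ .inr .alpha ∧ x ≠ .inr .beta ∧ x ≠ .inr .gamma ∧
    x ≠ .inl .alpha ∧ x ≠ .inl .beta ∧ x ≠ .inl .gamma := by
  simp only [markStr, List.mem_map] at hx
  obtain ⟨⟨b, y⟩, _, rfl⟩ := hx
  cases b <;> simp [mark]

theorem fold_total {n k : ℕ} {G : SimpleGraph (Fin n)} (t1 t2 t3 : Finset (Fin n))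
    (h1 : t1 ∈ cliqueList n k G) (h2 : t2 ∈ cliqueList n k G) (h3 : t3 ∈ cliqueList n k G)
    (c1 : t1.card = k) (c2 : t2.card = k) (c3 : t3.card = k)
    (a12 : ∀ v ∈ t1, ∀ u ∈ t2, G.Adj u v) (a13 : ∀ v ∈ t1, ∀ u ∈ t3, G.Adj u v)
    (a23 : ∀ v ∈ t2, ∀ u ∈ t3, G.Adj u v) (hM : (cliqueList n k G).length ≤ n ^ k) :
    Fold (wt n k) (SG n k G)
      (3 * (2 * (cliqueList n k G).length * l3 n k + DD n k)) := by
  rw [SG_eq]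
  obtain ⟨A1, B1, x1, y1, e1, f1, g1, s1⟩ := blk_split (w := wt n k) (2 * n ^ k) .alpha
    (CGa n k G) (cliqueList n k G) (by
      intro t ht
      rw [CGa, List.mem_append] at ht
      rcases ht with ht | ht <;> exact (alpha_notMem_mark ht).1 rfl) t1 h1 (by omega)
  obtain ⟨A2, B2, x2, y2, e2, f2, g2, s2⟩ := blk_split (w := wt n k) (2 * n ^ k) .beta
    (CGb n k G) (cliqueList n k G) (by
      intro t ht
      rw [CGb, List.mem_append] at ht
      rcases ht with ht | ht <;> exact (alpha_notMem_mark ht).2.1 rfl) t2 h2 (by omega)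
  obtain ⟨A3, B3, x3, y3, e3, f3, g3, s3⟩ := blk_split (w := wt n k) (2 * n ^ k) .gamma
    (CGg n k G) (cliqueList n k G) (by
      intro t ht
      rw [CGg, List.mem_append] at ht
      rcases ht with ht | ht <;> exact (alpha_notMem_mark ht).2.2.1 rfl) t3 h3 (by omega)
  rw [e1, e2, e3]
  have hab := foldVU (G := G) .ab c2 c1 (fun v hv u hu => (a12 u hu v hv).symm) (.app g1 f2)
  have hbg := foldVU (G := G) .bg c3 c2 (fun v hv u hu => (a23 u hu v hv).symm) (.app g2 f3)
  have hag := foldUV (G := G) .ag c1 c3 a13 (.app hab hbg)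
  have := Fold.app (Fold.app f1 hag) g3
  simp only [wt] at s1 s2 s3
  have eq1 : CGa n k G t1 = UU n k .ag t1 ++ VV n k G .ab t1 := rfl
  have eq2 : CGb n k G t2 = UU n k .ab t2 ++ VV n k G .bg t2 := rfl
  have eq3 : CGg n k G t3 = UU n k .bg t3 ++ VV n k G .ag t3 := rfl
  rw [eq1, eq2, eq3]
  convert this using 1
  · simp only [List.append_assoc]
  · linarith



structure NC (s : ℕ → Option RL) (T : ℕ → ℕ → Prop) : Prop where
  symm : ∀ i j, T i j → T j i
  func : ∀ i j j', T i j → T i j' → j = j'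
  mtch : ∀ i j, T i j → ∃ x y, s i = some x ∧ s j = some y ∧ LMatches x y
  nc : ∀ i j i' j', T i j → T i' j' → i < i' → i' < j → j < j' → False

def Mtd (T : ℕ → ℕ → Prop) (i : ℕ) : Prop := ∃ j, T i j

def Seg (s : ℕ → Option RL) (o : ℕ) (X : List RL) : Prop :=
  ∀ i x, X[i]? = some x → s (o + i) = some x

theorem seg_append {s : ℕ → Option RL} {o : ℕ} {X Y : List RL} (h : Seg s o (X ++ Y)) :
    Seg s o X ∧ Seg s (o + X.length) Y := by
  refine ⟨fun i x hx => h i x ?_, fun i x hx => ?_⟩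
  · have : i < X.length := by
      by_contra hh
      rw [List.getElem?_eq_none (by omega)] at hx; simp at hx
    rw [List.getElem?_append_left this]; exact hx
  · rw [add_assoc]
    apply h
    rw [List.getElem?_append_right (by omega), Nat.add_sub_cancel_left]; exact hx

theorem seg_mem {s : ℕ → Option RL} {o : ℕ} {X : List RL} (h : Seg s o X) {i : ℕ}
    (h1 : o ≤ i) (h2 : i < o + X.length) : ∃ x ∈ X, s i = some x := by
  have h3 : i - o < X.length := by omega
  refine ⟨X[i - o], List.getElem_mem _, ?_⟩
  have := h (i - o) _ (List.getElem?_eq_getElem h3)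
  rwa [show o + (i - o) = i by omega] at this

open Classical in
noncomputable def mc (f : RL → ℕ) (M : ℕ → Prop) : ℕ → List RL → ℕ
  | _, [] => 0
  | o, x :: L => (if M o then f x else 0) + mc f M (o + 1) L

theorem mc_append (f : RL → ℕ) (M : ℕ → Prop) (o : ℕ) (X Y : List RL) :
    mc f M o (X ++ Y) = mc f M o X + mc f M (o + X.length) Y := by
  induction X generalizing o with
  | nil => simp [mc]
  | cons x X ih =>
    simp only [List.cons_append, mc, ih, List.length_cons]
    rw [show o + 1 + X.length = o + (X.length + 1) by omega]
    omega

theorem mc_le (f : RL → ℕ) (M : ℕ → Prop) (o : ℕ) (X : List RL) :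
    mc f M o X ≤ (X.map f).sum := by
  induction X generalizing o with
  | nil => simp [mc]
  | cons x X ih =>
    have := ih (o + 1)
    simp only [mc, List.map_cons, List.sum_cons]
    split <;> omega

theorem mc_full (f : RL → ℕ) (M : ℕ → Prop) (o : ℕ) (X : List RL)
    (h : mc f M o X = (X.map f).sum) (i : ℕ) (x : RL) (hx : X[i]? = some x) (hf : 0 < f x) :
    M (o + i) := by
  induction X generalizing o i with
  | nil => simp at hx
  | cons y X ih =>
    have := mc_le f M (o + 1) X
    simp only [mc, List.map_cons, List.sum_cons] at h
    cases i with
    | zero =>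
      simp at hx
      subst hx
      by_contra hM
      rw [if_neg (by simpa using hM)] at h
      omega
    | succ i =>
      have h2 : mc f M (o + 1) X = (X.map f).sum := by
        split at h <;> omega
      have := ih (o + 1) h2 i (by simpa using hx)
      rwa [show o + (i + 1) = o + 1 + i by omega]

theorem mc_zero (f : RL → ℕ) (M : ℕ → Prop) (o : ℕ) (X : List RL)
    (h : ∀ i, o ≤ i → i < o + X.length → ¬ M i) : mc f M o X = 0 := by
  induction X generalizing o with
  | nil => simp [mc]
  | cons x X ih =>
    simp only [mc]
    rw [if_neg (h o le_rfl (by simp)), ih (o + 1) (fun i h1 h2 => h i (by omega) (by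
      simp; omega))]

section gad
variable {s : ℕ → Option RL} {T : ℕ → ℕ → Prop}

theorem content_left (H : NC s T) (q : RSig) {lo0 lo : ℕ} {c : List RL}
    (hq : ∀ y, lo0 ≤ y → y < lo → s y = some (.inl q))
    (hc1 : ∀ x ∈ c, x ≠ .inr q) (hc2 : ∀ x ∈ c, ∀ y ∈ c, ¬ LMatches x y)
    {L R a b : ℕ} (hR : R = L + 1 + c.length) (hs : Seg s (L + 1) c) (hlo : lo ≤ L)
    (ha : T L a) (hb : T R b) (ha1 : a < lo) (hb0 : lo0 ≤ b) (hb1 : b < lo) :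
    ∀ i, L + 1 ≤ i → i < L + 1 + c.length → ¬ Mtd T i := by
  rintro i h1 h2 ⟨y, hy⟩
  have ha' := H.symm _ _ ha
  have hb' := H.symm _ _ hb
  have hy' := H.symm _ _ hy
  have hab : b < a := by
    rcases lt_trichotomy a b with h | h | h
    · exact (H.nc a L b R ha' hb' h (by omega) (by omega)).elim
    · subst h; have := H.func _ _ _ ha' hb'; omega
    · exact h
  obtain ⟨x, hx, hxi⟩ := seg_mem hs h1 h2
  obtain ⟨x', y', hx', hy'', hm⟩ := H.mtch _ _ hy
  have : x' = x := by rw [hxi] at hx'; exact (Option.some.inj hx').symm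
  subst this
  rcases lt_trichotomy y b with h | h | h
  · exact H.nc y i b R hy' hb' h (by omega) (by omega)
  · subst h; have := H.func _ _ _ hy' hb'; omega
  rcases lt_trichotomy y a with h3 | h3 | h3
  · rw [hq y (by omega) (by omega)] at hy''
    cases Option.some.inj hy''
    cases x' with
    | inl z => simp [LMatches] at hm
    | inr z => simp only [LMatches] at hm; subst hm; exact hc1 _ hx rfl
  · subst h3; have := H.func _ _ _ hy' ha'; omega
  rcases lt_trichotomy y L with h4 | h4 | h4
  · exact H.nc a L y i ha' hy' h3 h4 (by omega)
  · subst h4; have := H.func _ _ _ hy' ha; omega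
  rcases lt_trichotomy y R with h5 | h5 | h5
  · obtain ⟨z, hz, hzi⟩ := seg_mem hs (i := y) (by omega) (by omega)
    rw [hzi] at hy''
    cases Option.some.inj hy''
    exact hc2 _ hx _ hz hm
  · subst h5; have := H.func _ _ _ hy' hb; omega
  · exact H.nc b R i y hb' hy (by omega) (by omega) h5

theorem content_right (H : NC s T) (q : RSig) {hi hi1 : ℕ} {c : List RL}
    (hq : ∀ y, hi ≤ y → y < hi1 → s y = some (.inl q))
    (hc1 : ∀ x ∈ c, x ≠ .inr q) (hc2 : ∀ x ∈ c, ∀ y ∈ c, ¬ LMatches x y)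
    {L R a b : ℕ} (hR : R = L + 1 + c.length) (hs : Seg s (L + 1) c) (hlo : R < hi)
    (ha : T L a) (hb : T R b) (ha1 : a < hi1) (ha0 : hi ≤ a) (hb1 : hi ≤ b) :
    ∀ i, L + 1 ≤ i → i < L + 1 + c.length → ¬ Mtd T i := by
  rintro i h1 h2 ⟨y, hy⟩
  have ha' := H.symm _ _ ha
  have hb' := H.symm _ _ hb
  have hy' := H.symm _ _ hy
  have hab : b < a := by
    rcases lt_trichotomy a b with h | h | h
    · exact (H.nc L a R b ha hb (by omega) (by omega) h).elim
    · subst h; have := H.func _ _ _ ha' hb'; omega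
    · exact h
  obtain ⟨x, hx, hxi⟩ := seg_mem hs h1 h2
  obtain ⟨x', y', hx', hy'', hm⟩ := H.mtch _ _ hy
  have : x' = x := by rw [hxi] at hx'; exact (Option.some.inj hx').symm
  subst this
  rcases lt_trichotomy a y with h | h | h
  · exact H.nc L a i y ha hy (by omega) (by omega) h
  · subst h; have := H.func _ _ _ hy' ha'; omega
  rcases lt_trichotomy b y with h3 | h3 | h3
  · rw [hq y (by omega) (by omega)] at hy''
    cases Option.some.inj hy''
    cases x' with
    | inl z => simp [LMatches] at hm
    | inr z => simp only [LMatches] at hm; subst hm; exact hc1 _ hx rfl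
  · subst h3; have := H.func _ _ _ hy' hb'; omega
  rcases lt_trichotomy R y with h4 | h4 | h4
  · exact H.nc i y R b hy hb (by omega) h4 h3
  · subst h4; have := H.func _ _ _ hy' hb; omega
  rcases lt_trichotomy L y with h5 | h5 | h5
  · obtain ⟨z, hz, hzi⟩ := seg_mem hs (i := y) (by omega) (by omega)
    rw [hzi] at hy''
    cases Option.some.inj hy''
    exact hc2 _ hx _ hz hm
  · subst h5; have := H.func _ _ _ hy' ha; omega
  · exact H.nc y i L a hy' ha h5 (by omega) (by omega)

theorem gads_bound {τ : Type*} (H : NC s T) (q : RSig) (C : τ → List RL) (f : RL → ℕ) (l D : ℕ)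
    (hD0 : 0 < D) (hDl : D < l) (hfq : f (.inr q) = l) {lo0 lo hi hi1 : ℕ}
    (hq : ∀ y, s y = some (.inl q) ↔ (lo0 ≤ y ∧ y < lo) ∨ (hi ≤ y ∧ y < hi1)) (cl : List τ)
    (hC1 : ∀ t ∈ cl, ∀ x ∈ C t, x ≠ .inr q)
    (hC2 : ∀ t ∈ cl, ∀ x ∈ C t, ∀ y ∈ C t, ¬ LMatches x y)
    (hC3 : ∀ t ∈ cl, ((C t).map f).sum = D) (o : ℕ) (ho : lo ≤ o)
    (ho2 : o + (gads q C cl).length ≤ hi) (hs : Seg s o (gads q C cl)) :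
    (mc f (Mtd T) o (gads q C cl) < 2 * cl.length * l + D ∨
      (mc f (Mtd T) o (gads q C cl) = 2 * cl.length * l + D ∧ ∃ t ∈ cl, ∃ oc, o ≤ oc ∧
        oc + (C t).length ≤ o + (gads q C cl).length ∧ Seg s oc (C t) ∧
        mc f (Mtd T) oc (C t) = D ∧ ∀ i, o ≤ i → i < o + (gads q C cl).length → Mtd T i →
          s i ≠ some (.inr q) → oc ≤ i ∧ i < oc + (C t).length)) ∧
    ((∀ i j, o ≤ i → i < hi → s i = some (.inr q) → T i j → hi ≤ j) →
      mc f (Mtd T) o (gads q C cl) < 2 * cl.length * l ∨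
      (mc f (Mtd T) o (gads q C cl) = 2 * cl.length * l ∧
        ∀ i, o ≤ i → i < o + (gads q C cl).length → Mtd T i → s i = some (.inr q))) := by
  induction cl generalizing o with
  | nil =>
    refine ⟨Or.inl (by simpa [gads, mc] using hD0), fun _ => Or.inr ⟨by simp [gads, mc], ?_⟩⟩
    intro i h1 h2
    simp [gads] at h2
    omega
  | cons t cl ih =>
    have eg : gads q C (t :: cl) = [.inr q] ++ (C t ++ ([.inr q] ++ gads q C cl)) := by
      simp [gads]
    have elen : (gads q C (t :: cl)).length = (C t).length + 2 + (gads q C cl).length := by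
      rw [eg]; simp; omega
    rw [elen] at ho2 ⊢
    rw [eg] at hs ⊢
    obtain ⟨s1, hs⟩ := seg_append hs
    obtain ⟨s2, hs⟩ := seg_append hs
    obtain ⟨s3, s4⟩ := seg_append hs
    simp only [List.length_singleton] at s2 s3 s4
    rw [mc_append, mc_append, mc_append]
    simp only [List.length_singleton]
    rw [show (t :: cl).length = cl.length + 1 from rfl]
    obtain ⟨R, hR⟩ : ∃ R, R = o + 1 + (C t).length := ⟨_, rfl⟩
    rw [← hR] at s3 s4 ⊢
    have hL' : s o = some (.inr q) := s1 0 _ (by simp)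
    have hR' : s R = some (.inr q) := s3 0 _ (by simp)
    have part : ∀ i j, s i = some (.inr q) → T i j →
        (lo0 ≤ j ∧ j < lo) ∨ (hi ≤ j ∧ j < hi1) := by
      intro i j hi hT
      rw [← hq]
      obtain ⟨x, y, hx, hy, hm⟩ := H.mtch _ _ hT
      rw [hi] at hx
      cases Option.some.inj hx
      cases y with
      | inr z => simp [LMatches] at hm
      | inl z => simp only [LMatches] at hm; subst hm; exact hy
    have e1 : mc f (Mtd T) o [.inr q] ≤ l := by
      have := mc_le f (Mtd T) o [.inr q]; simpa [hfq] using this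
    have e2 : mc f (Mtd T) R [.inr q] ≤ l := by
      have := mc_le f (Mtd T) R [.inr q]; simpa [hfq] using this
    have e3 : mc f (Mtd T) (o + 1) (C t) ≤ D := by
      have := mc_le f (Mtd T) (o + 1) (C t); rwa [hC3 t (by simp)] at this
    have e4 : 2 * (cl.length + 1) * l = 2 * cl.length * l + 2 * l := by ring
    rw [e4]
    have IH := ih (fun t ht => hC1 t (by simp [ht])) (fun t ht => hC2 t (by simp [ht]))
      (fun t ht => hC3 t (by simp [ht])) (R + 1) (by omega) (by omega) s4
    obtain ⟨IH1, IH2⟩ := IH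
    have IH2' := fun h : (∀ i j, o ≤ i → i < hi → s i = some (.inr q) → T i j → hi ≤ j) =>
      IH2 (fun i j h1 h0 h2 h3 => h i j (by omega) h0 h2 h3)
    by_cases hML : Mtd T o
    swap
    · have z1 : mc f (Mtd T) o [.inr q] = 0 := mc_zero _ _ _ _ (by
        intro i h1 h2
        simp at h2
        rwa [show i = o by omega])
      constructor
      · left
        rcases IH1 with h | ⟨h, _⟩ <;> omega
      · intro hh
        left
        rcases IH2' hh with h | ⟨h, _⟩ <;> omega
    by_cases hMR : Mtd T R
    swap
    · have z1 : mc f (Mtd T) R [.inr q] = 0 := mc_zero _ _ _ _ (by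
        intro i h1 h2
        simp at h2
        rwa [show i = R by omega])
      constructor
      · left
        rcases IH1 with h | ⟨h, _⟩ <;> omega
      · intro hh
        left
        rcases IH2' hh with h | ⟨h, _⟩ <;> omega
    have f1 : mc f (Mtd T) o [.inr q] = l := by simp [mc, hML, hfq]
    have f2 : mc f (Mtd T) R [.inr q] = l := by simp [mc, hMR, hfq]
    obtain ⟨a, ha⟩ := hML
    obtain ⟨b, hb⟩ := hMR
    have ha' := H.symm _ _ ha
    have hb' := H.symm _ _ hb
    have pa := part _ _ hL' ha
    have pb := part _ _ hR' hb
    have restRight : hi ≤ b → ∀ i j, R + 1 ≤ i → i < hi → s i = some (.inr q) → T i j → hi ≤ j := by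
      intro hbh i j h1 h0 h2 h3
      rcases part _ _ h2 h3 with h | h
      · exact (H.nc j i R b (H.symm _ _ h3) hb (by omega) (by omega) (by omega)).elim
      · exact h.1
    have hlen : ∀ i, o ≤ i → i < o + ((C t).length + 2 + (gads q C cl).length) →
        s i ≠ some (.inr q) → (o + 1 ≤ i ∧ i < o + 1 + (C t).length) ∨
          (R + 1 ≤ i ∧ i < R + 1 + (gads q C cl).length) := by
      intro i h1 h2 h3
      have : i ≠ o := by rintro rfl; exact h3 hL'
      have : i ≠ R := by rintro rfl; exact h3 hR'
      omega
    rw [f1, f2]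
    rcases pa with pa | pa <;> rcases pb with pb | pb
    · -- both left
      have cz := content_left H q (fun y h1 h2 => (hq y).2 (Or.inl ⟨h1, h2⟩)) (hC1 t (by simp))
        (hC2 t (by simp)) hR s2 ho ha hb pa.2 pb.1 pb.2
      have z := mc_zero f (Mtd T) (o + 1) (C t) cz
      constructor
      · rcases IH1 with h | ⟨h, u, hu, oc, p1, p2, p3, p4, p5⟩
        · left; omega
        · right
          refine ⟨by omega, u, by simp [hu], oc, by omega, by omega, p3, p4, ?_⟩
          intro i h1 h2 h3 h4
          rcases hlen i h1 h2 h4 with h | h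
          · exact (cz i h.1 h.2 h3).elim
          · exact p5 i h.1 h.2 h3 h4
      · intro hh
        have := hh o a le_rfl (by omega) hL' ha
        omega
    · -- left, right
      constructor
      · rcases IH2 (restRight pb.1) with h | ⟨h, h'⟩
        · left; omega
        · by_cases hc : mc f (Mtd T) (o + 1) (C t) = D
          · right
            refine ⟨by omega, t, by simp, o + 1, by omega, by omega, s2, hc, ?_⟩
            intro i h1 h2 h3 h4
            rcases hlen i h1 h2 h4 with h | h
            · exact h
            · exact (h4 (h' i h.1 h.2 h3)).elim
          · left; omega
      · intro hh
        have := hh o a le_rfl (by omega) hL' ha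
        omega
    · exact (H.nc b R o a hb' ha (by omega) (by omega) (by omega)).elim
    · -- both right
      have cz := content_right H q (fun y h1 h2 => (hq y).2 (Or.inr ⟨h1, h2⟩)) (hC1 t (by simp))
        (hC2 t (by simp)) hR s2 (by omega) ha hb pa.2 pa.1 pb.1
      have z := mc_zero f (Mtd T) (o + 1) (C t) cz
      constructor
      · left
        rcases IH2 (restRight pb.1) with h | ⟨h, h'⟩ <;> omega
      · intro _
        rcases IH2 (restRight pb.1) with h | ⟨h, h'⟩
        · left; omega
        · right
          refine ⟨by omega, ?_⟩
          intro i h1 h2 h3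
          by_contra h4
          rcases hlen i h1 h2 h4 with h | h
          · exact (cz i h.1 h.2 h3).elim
          · exact h4 (h' i h.1 h.2 h3)

end gad


def chg (n k : ℕ) : RL → ℕ
  | .inr .alpha => l3 n k
  | .inr .beta => l3 n k
  | .inr .gamma => l3 n k
  | .inr (.mk .b0 _) => 0
  | .inr (.mk .b1 _) => 0
  | .inr (.mk .dollar _) => 10 * logn n
  | .inr (.mk .hash _) => l1 n k
  | .inr (.mk .g _) => l2 n k
  | .inl (.mk .b0 _) => 1
  | .inl (.mk .b1 _) => 1
  | .inl _ => 0

theorem chg_match (n k : ℕ) {x y : RL} (h : LMatches x y) :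
    Sum.elim (wt n k) (wt n k) x = chg n k x + chg n k y := by
  rcases x with x | x <;> rcases y with y | y <;> simp only [LMatches] at h <;> subst h <;>
    rcases x with _ | _ | _ | ⟨b, p⟩ <;> first | (simp [chg, wt]; done) | (cases b <;> simp [chg, wt])

def TT (A : Finset (ℕ × ℕ)) (i j : ℕ) : Prop := (i, j) ∈ A ∨ (j, i) ∈ A

theorem nc_of_folding {S : List RL} {A : Finset (ℕ × ℕ)} (h : IsFolding S A) :
    NC (fun i => S[i]?) (TT A) := by
  obtain ⟨h1, h2⟩ := h
  have key : ∀ p ∈ A, ∀ q ∈ A, Crosses p q → p = q := by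
    intro p hp q hq hc
    by_contra hh
    exact h2 p hp q hq hh hc
  refine ⟨fun i j => Or.symm, ?_, ?_, ?_⟩
  · rintro i j j' (ha | ha) (hb | hb)
    · have := key _ ha _ hb (by simp [Crosses]); simpa using this
    · have := key _ ha _ hb (by simp [Crosses])
      have h3 := (h1 _ ha).1
      simp at this h3; omega
    · have := key _ ha _ hb (by simp [Crosses])
      have h3 := (h1 _ ha).1
      simp at this h3; omega
    · have := key _ ha _ hb (by simp [Crosses]); simpa using this
  · rintro i j (ha | ha)
    · obtain ⟨_, _, x, hx, y, hy, hm⟩ := h1 _ ha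
      exact ⟨x, y, hx, hy, hm⟩
    · obtain ⟨_, _, x, hx, y, hy, hm⟩ := h1 _ ha
      refine ⟨y, x, hy, hx, ?_⟩
      rcases x with x | x <;> rcases y with y | y <;> simp only [LMatches] at hm ⊢ <;> exact hm.symm
  · rintro i j i' j' ha hb c1 c2 c3
    have ha : (i, j) ∈ A := by
      rcases ha with ha | ha
      · exact ha
      · have := (h1 _ ha).1; simp at this; omega
    have hb : (i', j') ∈ A := by
      rcases hb with ha | ha
      · exact ha
      · have := (h1 _ ha).1; simp at this; omega
    have := key _ ha _ hb (by simp only [Crosses]; omega)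
    simp at this; omega

open Classical in
theorem mc_sum (f : RL → ℕ) (M : ℕ → Prop) (o : ℕ) (S : List RL) :
    mc f M o S = ∑ i ∈ Finset.range S.length, if M (o + i) then (S.map f).getD i 0 else 0 := by
  induction S generalizing o with
  | nil => simp [mc]
  | cons x S ih =>
    rw [mc, ih, List.length_cons, Finset.sum_range_succ', add_comm]
    congr 1
    · apply Finset.sum_congr rfl
      intro i _
      rw [show o + 1 + i = o + (i + 1) by omega]
      simp

theorem score_eq (n k : ℕ) {S : List RL} {A : Finset (ℕ × ℕ)} (h : IsFolding S A) :
    ∑ p ∈ A, (S.map (Sum.elim (wt n k) (wt n k))).getD p.1 0 =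
      mc (chg n k) (Mtd (TT A)) 0 S := by
  classical
  have H := nc_of_folding h
  obtain ⟨h1, h2⟩ := h
  have e1 : ∀ p ∈ A, (S.map (Sum.elim (wt n k) (wt n k))).getD p.1 0 =
      (S.map (chg n k)).getD p.1 0 + (S.map (chg n k)).getD p.2 0 := by
    intro p hp
    obtain ⟨_, _, x, hx, y, hy, hm⟩ := h1 _ hp
    simp only [Option.mem_def] at hx hy
    simp [List.getD_eq_getElem?_getD, hx, hy, chg_match n k hm]
  rw [Finset.sum_congr rfl e1, Finset.sum_add_distrib, mc_sum]
  rw [← Finset.sum_filter]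
  have e2 : (Finset.range S.length).filter (fun i => Mtd (TT A) (0 + i)) =
      A.image Prod.fst ∪ A.image Prod.snd := by
    ext i
    simp only [Finset.mem_filter, Finset.mem_range, Finset.mem_union, Finset.mem_image, zero_add,
      Mtd, TT, Prod.exists]
    constructor
    · rintro ⟨_, j, h | h⟩
      · exact Or.inl ⟨i, j, h, rfl⟩
      · exact Or.inr ⟨j, i, h, rfl⟩
    · rintro (⟨a, b, h, rfl⟩ | ⟨a, b, h, rfl⟩)
      · have := h1 _ h
        exact ⟨by simp at this; omega, b, Or.inl h⟩
      · have := h1 _ h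
        exact ⟨by simp at this; omega, a, Or.inr h⟩
  rw [e2, Finset.sum_union, Finset.sum_image, Finset.sum_image]
  · rintro ⟨a, b⟩ ha ⟨c, d⟩ hb e
    simp at e
    subst e
    have := H.func _ _ _ (Or.inr ha) (Or.inr hb); simp [this]
  · rintro ⟨a, b⟩ ha ⟨c, d⟩ hb e
    simp at e
    subst e
    have := H.func _ _ _ (Or.inl ha) (Or.inl hb); simp [this]
  · rw [Finset.disjoint_left]
    intro i hi hj
    simp only [Finset.mem_image, Prod.exists, exists_and_right, exists_eq_right] at hi hj
    obtain ⟨b, hb⟩ := hi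
    obtain ⟨a, ha⟩ := hj
    have := H.func _ _ _ (Or.inl hb) (Or.inr ha)
    subst this
    have := (h1 _ hb).1
    have := (h1 _ ha).1
    simp at *; omega

/-- extraction of a common subsequence from a monotone partial matching -/
theorem extract {α : Type*} (X Y : List α) (R : ℕ → ℕ → Prop)
    (hR : ∀ i j, R i j → ∃ x, X[i]? = some x ∧ Y[j]? = some x)
    (hm : ∀ i j i' j', R i j → R i' j' → (i < i' ↔ j < j')) :
    ∃ Z : List α, Z.Sublist X ∧ Z.Sublist Y ∧
      (∀ P : α → Bool, (∀ i x, X[i]? = some x → P x = true → ∃ j, R i j) →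
        Z.countP P = X.countP P) ∧
      (∀ P : α → Bool, (∀ j x, Y[j]? = some x → P x = true → ∃ i, R i j) →
        Z.countP P = Y.countP P) := by
  induction X generalizing Y R with
  | nil =>
    refine ⟨[], by simp, by simp, by simp, ?_⟩
    intro P hP
    rw [List.countP_nil, eq_comm, List.countP_eq_zero]
    intro a ha hPa
    obtain ⟨j, hj⟩ := List.mem_iff_getElem?.1 ha
    obtain ⟨i, hi⟩ := hP j a hj hPa
    obtain ⟨x, hx, _⟩ := hR _ _ hi
    simp at hx
  | cons x X ih =>
    by_cases h0 : ∃ j, R 0 j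
    · obtain ⟨j, hj⟩ := h0
      obtain ⟨x', hx, hy⟩ := hR _ _ hj
      simp at hx
      subst hx
      have hjl : j < Y.length := by
        by_contra hh
        rw [List.getElem?_eq_none (by omega)] at hy; simp at hy
      have eY : Y = Y.take j ++ x :: Y.drop (j + 1) := by
        have := List.getElem?_eq_getElem hjl
        rw [hy] at this
        rw [Option.some.inj this, List.cons_getElem_drop_succ, List.take_append_drop]
      obtain ⟨Z, z1, z2, z3, z4⟩ := ih (Y.drop (j + 1)) (fun i j' => R (i + 1) (j + 1 + j'))
        (fun i j' h => by
          obtain ⟨y, h1, h2⟩ := hR _ _ h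
          exact ⟨y, by simpa using h1, by simpa using h2⟩)
        (fun i j' i' j'' h1 h2 => by
          have := hm _ _ _ _ h1 h2
          omega)
      refine ⟨x :: Z, z1.cons_cons x, ?_, ?_, ?_⟩
      · rw [eY]
        exact (z2.cons_cons x).trans (List.sublist_append_right _ _)
      · intro P hP
        rw [List.countP_cons, List.countP_cons, z3 P]
        intro i y hi hy
        obtain ⟨j', hj'⟩ := hP (i + 1) y (by simpa using hi) hy
        have := (hm _ _ _ _ hj hj').1 (by omega)
        exact ⟨j' - (j + 1), by rwa [show j + 1 + (j' - (j + 1)) = j' by omega]⟩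
      · intro P hP
        rw [eY, List.countP_append, List.countP_cons, List.countP_cons, z4 P]
        · rw [(List.countP_eq_zero (l := Y.take j)).2]
          · omega
          · intro a ha hPa
            obtain ⟨j', hj'⟩ := List.mem_iff_getElem?.1 ha
            have hlt : j' < j := by
              by_contra hh
              rw [List.getElem?_eq_none (by rw [List.length_take]; omega)] at hj'; simp at hj'
            rw [List.getElem?_take_of_lt hlt] at hj'
            obtain ⟨i, hi⟩ := hP _ _ hj' hPa
            have := (hm _ _ _ _ hi hj).2 hlt
            omega
        · intro j' y hj' hy
          obtain ⟨i, hi⟩ := hP (j + 1 + j') y (by simpa using hj') hy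
          have := (hm _ _ _ _ hj hi).2 (by omega)
          exact ⟨i - 1, by rwa [show i - 1 + 1 = i by omega]⟩
    · obtain ⟨Z, z1, z2, z3, z4⟩ := ih Y (fun i j' => R (i + 1) j')
        (fun i j' h => by
          obtain ⟨y, h1, h2⟩ := hR _ _ h
          exact ⟨y, by simpa using h1, h2⟩)
        (fun i j' i' j'' h1 h2 => by
          have := hm _ _ _ _ h1 h2
          omega)
      refine ⟨Z, z1.cons x, z2, ?_, ?_⟩
      · intro P hP
        have : ¬ P x = true := fun hx => h0 (hP 0 x (by simp) hx)
        rw [List.countP_cons_of_neg this, z3 P]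
        intro i y hi hy
        exact hP (i + 1) y (by simpa using hi) hy
      · intro P hP
        apply z4
        intro j y hj hy
        obtain ⟨i, hi⟩ := hP j y hj hy
        cases i with
        | zero => exact (h0 ⟨_, hi⟩).elim
        | succ i => exact ⟨i, hi⟩



def isb (x : RCore) : Bool := decide (x = (false, .b0) ∨ x = (false, .b1))
def ish (x : RCore) : Bool := decide (x = hsh)

theorem match_eq {p : PT} {x y : RCore} (h : LMatches (mark p x) (markP p y)) : x = y := by
  obtain ⟨a, x⟩ := x
  obtain ⟨b, y⟩ := y
  cases a <;> cases b <;> simp_all [mark, markP, LMatches]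

theorem bin_mem {n : ℕ} {v : Fin n} {x : RCore} (h : x ∈ bin n v) : isb x = true := by
  simp only [bin, List.mem_map] at h
  obtain ⟨i, _, rfl⟩ := h
  split <;> simp [isb]

def pl (x : RCore) : Prop := isb x = true ∨ x = dol ∨ x = hsh

theorem CNGr_pl {n k : ℕ} {t : Finset (Fin n)} {x : RCore} (h : x ∈ CNGr n k t) : pl x := by
  rw [CNGr_eq, List.mem_flatMap] at h
  obtain ⟨v, _, h⟩ := h
  simp only [NGr, List.mem_cons, List.mem_append, List.mem_replicate, List.not_mem_nil,
    or_false] at h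
  rcases h with h | ((h | h) | h) | h
  · exact Or.inr (Or.inr h)
  · exact Or.inr (Or.inl h.2)
  · exact Or.inl (bin_mem h)
  · exact Or.inr (Or.inl h.2)
  · exact Or.inr (Or.inr h)

theorem CLGr_pl {n k : ℕ} {G : SimpleGraph (Fin n)} {t : Finset (Fin n)} {x : RCore}
    (h : x ∈ CLGr n k G t) : pl x := by
  rw [CLGr_eq, List.mem_flatMap] at h
  obtain ⟨v, _, h⟩ := h
  simp only [LGr, List.mem_cons, List.mem_append, List.mem_flatMap, List.not_mem_nil,
    or_false] at h
  rcases h with h | (⟨_, _, h⟩ | ⟨_, _, h⟩) | h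
  · exact Or.inr (Or.inr h)
  · rcases h with (h | h) | h
    · exact Or.inr (Or.inl h)
    · exact Or.inl (bin_mem h)
    · exact Or.inr (Or.inl h)
  · exact Or.inr (Or.inl (by simpa using h))
  · exact Or.inr (Or.inr h)

theorem pl_ne_g {x : RCore} (h : pl x) : x ≠ gC := by
  rintro rfl
  simp [pl, isb, gC, dol, hsh] at h

theorem sum_flatMap_const {ι α : Type*} (l : List ι) (f : ι → List α) (g : α → ℕ) (c : ℕ)
    (h : ∀ v, ((f v).map g).sum = c) : ((l.flatMap f).map g).sum = l.length * c := by
  induction l with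
  | nil => simp
  | cons a l ih => simp [ih, h]; ring

theorem countP_flatMap_const {ι α : Type*} (l : List ι) (f : ι → List α) (g : α → Bool) (c : ℕ)
    (h : ∀ v, (f v).countP g = c) : (l.flatMap f).countP g = l.length * c := by
  induction l with
  | nil => simp
  | cons a l ih => rw [List.flatMap_cons, List.countP_append, ih, h]; simp; ring

theorem ish_zero {l : List RCore} (h : hsh ∉ l) : l.countP ish = 0 := by
  rw [List.countP_eq_zero]
  intro a ha hh
  simp only [ish, decide_eq_true_eq] at hh
  subst hh; exact h ha

theorem CNGr_ish {n k : ℕ} {t : Finset (Fin n)} (ht : t.card = k) :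
    (CNGr n k t).countP ish = k * k * 2 := by
  rw [CNGr_eq, countP_flatMap_const (c := 2), vsL_length, ht]
  intro v
  rw [List.countP_cons, List.countP_append, ish_zero (hsh_notMem_NGr n v)]
  rfl

theorem CLGr_ish {n k : ℕ} {G : SimpleGraph (Fin n)} {t : Finset (Fin n)} (ht : t.card = k) :
    (CLGr n k G t).countP ish = k * k * 2 := by
  rw [CLGr_eq, countP_flatMap_const (c := 2), usL_length, ht]
  intro v
  rw [List.countP_cons, List.countP_append, ish_zero (hsh_notMem_LGr n G v)]
  rfl

theorem bin_sum {n : ℕ} {v : Fin n} (f : RCore → ℕ) (c : ℕ) (h0 : f (false, .b0) = c)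
    (h1 : f (false, .b1) = c) : ((bin n v).map f).sum = 2 * Nat.clog 2 n * c := by
  have : (bin n v).map f = List.replicate (2 * Nat.clog 2 n) c := by
    rw [List.eq_replicate_iff]
    refine ⟨by simp [bin], ?_⟩
    intro b hb
    simp only [List.mem_map] at hb
    obtain ⟨x, hx, rfl⟩ := hb
    have := bin_mem hx
    simp only [isb, decide_eq_true_eq] at this
    rcases this with rfl | rfl <;> assumption
  rw [this]; simp

theorem UU_sum {n k : ℕ} (p : PT) {t : Finset (Fin n)} (ht : t.card = k) :
    ((UU n k p t).map (chg n k)).sum = k * k * (2 * Nat.clog 2 n) := by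
  rw [UU_eq, XX, List.map_map]
  have e : ((CNGr n k t).map (chg n k ∘ mark p)).sum = k * k * (2 * Nat.clog 2 n) := by
    rw [CNGr_eq, sum_flatMap_const (c := 2 * Nat.clog 2 n), vsL_length, ht]
    intro v
    have := bin_sum (v := v) (chg n k ∘ mark p) 1 rfl rfl
    simp [NGr, this]
    simp [mark, hsh, dol, chg]
  simp [e]
  simp [mark, gC, chg]

theorem VV_sum {n k : ℕ} {G : SimpleGraph (Fin n)} (p : PT) {t : Finset (Fin n)} (ht : t.card = k) :
    ((VV n k G p t).map (chg n k)).sum =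
      2 * l2 n k + k * k * (2 * l1 n k + 2 * n * (10 * logn n)) := by
  rw [VV_eq, XX, List.map_reverse, List.sum_reverse, List.map_map]
  have e : ((CLGr n k G t).map (chg n k ∘ markP p)).sum =
      k * k * (2 * l1 n k + 2 * n * (10 * logn n)) := by
    rw [CLGr_eq, sum_flatMap_const (c := (2 * l1 n k + 2 * n * (10 * logn n))), usL_length, ht]
    intro v
    have e1 : (((nbrs n G v).flatMap (fun u => [dol] ++ bin n u ++ [dol])).map
        (chg n k ∘ markP p)).sum = (nbrs n G v).length * (2 * (10 * logn n)) := by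
      apply sum_flatMap_const
      intro u
      have := bin_sum (v := u) (chg n k ∘ markP p) 0 rfl rfl
      simp [this]
      simp [markP, mark, dol, chg]; ring
    have e2 : (((nonNbrs n G v).flatMap (fun u => [dol, dol])).map
        (chg n k ∘ markP p)).sum = (nonNbrs n G v).length * (2 * (10 * logn n)) := by
      apply sum_flatMap_const
      intro u
      simp [markP, mark, dol, chg]; ring
    have e3 := nbrs_length_add n G v
    have e4 : chg n k (markP p hsh) = l1 n k := rfl
    rw [List.map_cons, List.sum_cons, LGr, List.map_append, List.map_append, List.sum_append,
      List.sum_append, e1, e2, ← add_mul, e3]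
    simp [e4]; ring
  have e4 : chg n k (markP p gC) = l2 n k := rfl
  simp [e, e4]; ring

theorem uv_adj {s : ℕ → Option RL} {T : ℕ → ℕ → Prop} (H : NC s T) {n k : ℕ} (hn : 2 ≤ n)
    (hl : 0 < l1 n k) (hlog : 0 < logn n) {G : SimpleGraph (Fin n)} (p : PT)
    {t t' : Finset (Fin n)} (ht : t.card = k) (ht' : t'.card = k) {oU oV : ℕ}
    (sU : Seg s oU (UU n k p t)) (sV : Seg s oV (VV n k G p t'))
    (hd : oU + (UU n k p t).length ≤ oV ∨ oV + (VV n k G p t').length ≤ oU)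
    (hUV : ∀ i j, oU ≤ i → i < oU + (UU n k p t).length → T i j →
      oV ≤ j ∧ j < oV + (VV n k G p t').length)
    (hVU : ∀ i j, oV ≤ i → i < oV + (VV n k G p t').length → T i j →
      oU ≤ j ∧ j < oU + (UU n k p t).length)
    (cU : mc (chg n k) (Mtd T) oU (UU n k p t) = ((UU n k p t).map (chg n k)).sum)
    (cV : mc (chg n k) (Mtd T) oV (VV n k G p t') = ((VV n k G p t').map (chg n k)).sum) :
    ∀ v ∈ t, ∀ u ∈ t', G.Adj u v := by
  have fU := mc_full _ _ _ _ cU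
  have fV := mc_full _ _ _ _ cV
  obtain ⟨X, hX⟩ : ∃ X, X = XX (CNGr n k t) := ⟨_, rfl⟩
  obtain ⟨Y, hY⟩ : ∃ Y, Y = XX (CLGr n k G t') := ⟨_, rfl⟩
  rw [UU_eq, ← hX] at sU hd fU
  simp only [UU_eq, VV_eq, ← hX, ← hY] at hUV hVU
  rw [VV_eq, ← hY] at sV hd fV
  simp only [List.length_map, List.length_reverse] at hd hUV hVU
  have gU : ∀ i x, X[i]? = some x → s (oU + i) = some (mark p x) := by
    intro i x hx
    apply sU
    rw [List.getElem?_map, hx]; rfl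
  have rev : ∀ j y, Y[j]? = some y → j < Y.length ∧
      ((Y.map (markP p)).reverse)[Y.length - 1 - j]? = some (markP p y) := by
    intro j y hy
    have hj : j < Y.length := by
      by_contra hh
      rw [List.getElem?_eq_none (by omega)] at hy; simp at hy
    refine ⟨hj, ?_⟩
    rw [List.getElem?_reverse (by simp; omega)]
    rw [List.length_map, show Y.length - 1 - (Y.length - 1 - j) = j by omega]
    simp [hy]
  have gV : ∀ j y, Y[j]? = some y → s (oV + (Y.length - 1 - j)) = some (markP p y) := by
    intro j y hy
    apply sV
    exact (rev j y hy).2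
  obtain ⟨Z, z1, z2, z3, z4⟩ := extract X Y
    (fun i j => i < X.length ∧ j < Y.length ∧ T (oU + i) (oV + (Y.length - 1 - j))) (by
      rintro i j ⟨h1, h2, h3⟩
      obtain ⟨x, y, hx, hy, hm⟩ := H.mtch _ _ h3
      rw [gU i _ (List.getElem?_eq_getElem h1)] at hx
      rw [gV j _ (List.getElem?_eq_getElem h2)] at hy
      cases Option.some.inj hx
      cases Option.some.inj hy
      have := match_eq hm
      exact ⟨X[i], List.getElem?_eq_getElem h1, by rw [this]; exact List.getElem?_eq_getElem h2⟩)
    (by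
      rintro i j i' j' ⟨h1, h2, h3⟩ ⟨h1', h2', h3'⟩
      have s3 := H.symm _ _ h3
      have s3' := H.symm _ _ h3'
      rcases lt_trichotomy i i' with c | c | c <;> rcases lt_trichotomy j j' with d | d | d
      · simp [c, d]
      · subst d; have := H.func _ _ _ s3 s3'; omega
      · rcases hd with hd | hd
        · exact (H.nc _ _ _ _ h3 h3' (by omega) (by omega) (by omega)).elim
        · exact (H.nc _ _ _ _ s3 s3' (by omega) (by omega) (by omega)).elim
      · subst c; have := H.func _ _ _ h3 h3'; omega
      · simp [c, d]
      · subst c; have := H.func _ _ _ h3 h3'; omega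
      · rcases hd with hd | hd
        · exact (H.nc _ _ _ _ h3' h3 (by omega) (by omega) (by omega)).elim
        · exact (H.nc _ _ _ _ s3' s3 (by omega) (by omega) (by omega)).elim
      · subst d; have := H.func _ _ _ s3 s3'; omega
      · omega)
  have k1 : Z.countP isb = X.countP isb := by
    apply z3
    intro i x hx hb
    have hi : i < X.length := by
      by_contra hh
      rw [List.getElem?_eq_none (by omega)] at hx; simp at hx
    obtain ⟨j, hj⟩ := fU i (mark p x) (by rw [List.getElem?_map, hx]; rfl) (by
      simp only [isb, decide_eq_true_eq] at hb
      rcases hb with rfl | rfl <;> simp [mark, chg])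
    have := hUV _ _ (by omega) (by omega) hj
    refine ⟨Y.length - 1 - (j - oV), hi, by omega, ?_⟩
    rwa [show oV + (Y.length - 1 - (Y.length - 1 - (j - oV))) = j by omega]
  have k2 : ∀ P : RCore → Bool, (∀ x, P x = true → x = dol ∨ x = hsh) →
      Z.countP P = Y.countP P := by
    intro P hP
    apply z4
    intro j y hy hb
    obtain ⟨hj, hr⟩ := rev j y hy
    obtain ⟨i, hi⟩ := fV _ _ hr (by
      rcases hP _ hb with rfl | rfl
      · simp [markP, mark, dol, chg, hlog]
      · simp [markP, mark, hsh, chg, hl])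
    have := hVU _ _ (by omega) (by omega) hi
    refine ⟨i - oU, by omega, hj, ?_⟩
    rw [show oU + (i - oU) = i by omega]
    exact H.symm _ _ hi
  have k3 := k2 pL (fun x hx => by simpa [pL] using hx)
  have k4 := k2 ish (fun x hx => Or.inr (by simpa [ish] using hx))
  -- remove g
  let ng : RCore → Bool := fun x => decide (x ≠ gC)
  have fX : X.filter ng = CNGr n k t := by
    rw [hX, XX]
    have : (CNGr n k t).filter ng = CNGr n k t := by
      rw [List.filter_eq_self]
      intro a ha
      simpa [ng] using pl_ne_g (CNGr_pl ha)
    have hg : ng gC = false := by simp [ng]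
    rw [List.filter_cons_of_neg (by simp [hg]), List.filter_append, this,
      List.filter_cons_of_neg (by simp [hg])]
    simp
  have fY : Y.filter ng = CLGr n k G t' := by
    rw [hY, XX]
    have : (CLGr n k G t').filter ng = CLGr n k G t' := by
      rw [List.filter_eq_self]
      intro a ha
      simpa [ng] using pl_ne_g (CLGr_pl ha)
    have hg : ng gC = false := by simp [ng]
    rw [List.filter_cons_of_neg (by simp [hg]), List.filter_append, this,
      List.filter_cons_of_neg (by simp [hg])]
    simp
  have y1 := z1.filter ng
  have y2 := z2.filter ng
  rw [fX] at y1
  rw [fY] at y2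
  have cnt : ∀ (P : RCore → Bool) (_ : P gC = false) (l : List RCore),
      l.countP P = (l.filter ng).countP P := by
    intro P hP l
    rw [List.countP_filter]
    congr 1
    funext a
    by_cases ha : a = gC
    · subst ha; simp [hP]
    · simp [ng, ha]
  rw [cnt isb (by decide) Z, cnt isb (by decide) X, fX] at k1
  rw [cnt ish (by decide) Z, cnt ish (by decide) Y, fY, CLGr_ish ht'] at k4
  rw [cnt pL (by decide) Z, cnt pL (by decide) Y, fY] at k3
  have pNs : ∀ l : List RCore, (∀ x ∈ l, pl x) → l.countP pN = l.countP isb + l.countP ish := by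
    intro l hl
    induction l with
    | nil => rfl
    | cons a l ih =>
      rw [List.countP_cons, List.countP_cons, List.countP_cons, ih (fun x hx => hl x (by simp [hx]))]
      have : (if pN a = true then 1 else 0) = (if isb a = true then 1 else 0) +
          (if ish a = true then 1 else 0) := by
        rcases hl a (by simp) with h | rfl | rfl
        · simp only [isb, decide_eq_true_eq] at h
          rcases h with rfl | rfl <;> decide
        · decide
        · decide
      omega
  refine full_adj hn ht ht' y1 y2 ?_ k3
  rw [pNs _ (fun x hx => CNGr_pl hx), pNs _ (fun x hx => CNGr_pl (y1.subset hx)), k1, k4,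
    CNGr_ish ht]



theorem blk_bound {τ : Type*} {S : List RL} {T : ℕ → ℕ → Prop} (H : NC (fun i => S[i]?) T)
    (q : RSig) (C : τ → List RL) (f : RL → ℕ) (l D M : ℕ)
    (hD0 : 0 < D) (hDl : D < l) (hfq : f (.inr q) = l) (hfq' : f (.inl q) = 0) (cl : List τ)
    (pre post : List RL) (hS : S = pre ++ (blk M q C cl ++ post))
    (hpre : .inl q ∉ pre) (hpost : .inl q ∉ post)
    (hC1 : ∀ t ∈ cl, ∀ x ∈ C t, x ≠ .inr q)
    (hC0 : ∀ t ∈ cl, ∀ x ∈ C t, x ≠ .inl q)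
    (hC2 : ∀ t ∈ cl, ∀ x ∈ C t, ∀ y ∈ C t, ¬ LMatches x y)
    (hC3 : ∀ t ∈ cl, ((C t).map f).sum = D) :
    mc f (Mtd T) pre.length (blk M q C cl) < 2 * cl.length * l + D ∨
      (mc f (Mtd T) pre.length (blk M q C cl) = 2 * cl.length * l + D ∧ ∃ t ∈ cl, ∃ oc,
        pre.length ≤ oc ∧
        oc + (C t).length ≤ pre.length + (blk M q C cl).length ∧ Seg (fun i => S[i]?) oc (C t) ∧
        mc f (Mtd T) oc (C t) = D ∧
        ∀ i, pre.length ≤ i → i < pre.length + (blk M q C cl).length → Mtd T i →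
          S[i]? ≠ some (.inr q) → S[i]? ≠ some (.inl q) → oc ≤ i ∧ i < oc + (C t).length) := by
  have hS' : S = pre ++ (List.replicate M (.inl q) ++ (gads q C cl ++
      (List.replicate M (.inl q) ++ post))) := by
    rw [hS, blk]; simp
  have sg0 : Seg (fun i => S[i]?) 0 (pre ++ (List.replicate M (.inl q) ++ (gads q C cl ++
      (List.replicate M (.inl q) ++ post)))) := by
    intro i x hx
    rw [← hS'] at hx
    simpa using hx
  obtain ⟨g1, sg0⟩ := seg_append sg0
  obtain ⟨g2, sg0⟩ := seg_append sg0
  obtain ⟨g3, sg0⟩ := seg_append sg0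
  obtain ⟨g4, g5⟩ := seg_append sg0
  simp only [zero_add, List.length_replicate] at g2 g3 g4 g5
  have hlen : S.length = pre.length + M + (gads q C cl).length + M + post.length := by
    rw [hS']; simp; omega
  have hblk : (blk M q C cl).length = M + (gads q C cl).length + M := by
    rw [blk]; simp; omega
  have hgm : .inl q ∉ gads q C cl := by
    intro h
    simp only [gads, List.mem_flatMap, List.mem_append, List.mem_singleton] at h
    obtain ⟨t, ht, (h | h) | h⟩ := h
    · cases h
    · exact hC0 t ht _ h rfl
    · cases h
  have hq : ∀ y, S[y]? = some (.inl q) ↔ (pre.length ≤ y ∧ y < pre.length + M) ∨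
      (pre.length + M + (gads q C cl).length ≤ y ∧
        y < pre.length + M + (gads q C cl).length + M) := by
    intro y
    constructor
    · intro h
      by_contra hc
      have hy : y < S.length := by
        by_contra hh
        rw [List.getElem?_eq_none (by omega)] at h; simp at h
      rcases lt_or_ge y pre.length with h1 | h1
      · obtain ⟨x, hx, e⟩ := seg_mem g1 (i := y) (by omega) (by omega)
        rw [h] at e; cases e; exact hpre hx
      rcases lt_or_ge y (pre.length + M + (gads q C cl).length) with h2 | h2
      · obtain ⟨x, hx, e⟩ := seg_mem g3 (i := y) (by omega) (by omega)
        rw [h] at e; cases e; exact hgm hx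
      · obtain ⟨x, hx, e⟩ := seg_mem g5 (i := y) (by omega) (by omega)
        rw [h] at e; cases e; exact hpost hx
    · rintro (h | h)
      · obtain ⟨x, hx, e⟩ := seg_mem g2 (i := y) (by omega) (by simp; omega)
        rw [List.eq_of_mem_replicate hx] at e; exact e
      · obtain ⟨x, hx, e⟩ := seg_mem g4 (i := y) (by omega) (by simp; omega)
        rw [List.eq_of_mem_replicate hx] at e; exact e
  have main := (gads_bound H q C f l D hD0 hDl hfq hq cl hC1 hC2 hC3 (pre.length + M) le_rfl
    le_rfl g3).1
  have rz : ∀ o, mc f (Mtd T) o (List.replicate M (.inl q)) = 0 := by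
    intro o
    have := mc_le f (Mtd T) o (List.replicate M (.inl q))
    simpa [hfq'] using this
  have e : mc f (Mtd T) pre.length (blk M q C cl) =
      mc f (Mtd T) (pre.length + M) (gads q C cl) := by
    rw [blk, mc_append, mc_append, rz, rz]; simp
  rw [e]
  rcases main with h | ⟨h, t, ht, oc, p1, p2, p3, p4, p5⟩
  · exact Or.inl h
  · right
    refine ⟨h, t, ht, oc, by omega, by omega, p3, p4, ?_⟩
    intro i h1 h2 h3 h4 h5
    have : ¬ _ := fun h => h5 ((hq i).2 h)
    exact p5 i (by omega) (by omega) h3 h4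

theorem XX_false {l : List RCore} (h : ∀ x ∈ l, pl x) : ∀ x ∈ XX l, x.1 = false := by
  intro x hx
  simp only [XX, List.mem_cons, List.mem_append, List.not_mem_nil, or_false] at hx
  rcases hx with rfl | hx | rfl
  · rfl
  · rcases h x hx with h | rfl | rfl
    · simp only [isb, decide_eq_true_eq] at h
      rcases h with rfl | rfl <;> rfl
    · rfl
    · rfl
  · rfl

theorem UU_mem {n k : ℕ} {p : PT} {t : Finset (Fin n)} {x : RL} (h : x ∈ UU n k p t) :
    ∃ b, x = .inl (.mk b p) := by
  rw [UU_eq, List.mem_map] at h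
  obtain ⟨⟨a, b⟩, hy, rfl⟩ := h
  have := XX_false (fun x hx => CNGr_pl hx) _ hy
  simp only at this
  subst this
  exact ⟨b, rfl⟩

theorem VV_mem {n k : ℕ} {G : SimpleGraph (Fin n)} {p : PT} {t : Finset (Fin n)} {x : RL}
    (h : x ∈ VV n k G p t) : ∃ b, x = .inr (.mk b p) := by
  rw [VV_eq, List.mem_reverse, List.mem_map] at h
  obtain ⟨⟨a, b⟩, hy, rfl⟩ := h
  have := XX_false (fun x hx => CLGr_pl hx) _ hy
  simp only at this
  subst this
  exact ⟨b, rfl⟩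

theorem UV_nomatch {n k : ℕ} {G : SimpleGraph (Fin n)} {p p' : PT} (hp : p ≠ p')
    {t : Finset (Fin n)} : ∀ x ∈ UU n k p t ++ VV n k G p' t,
    ∀ y ∈ UU n k p t ++ VV n k G p' t, ¬ LMatches x y := by
  intro x hx y hy h
  rw [List.mem_append] at hx hy
  rcases hx with hx | hx <;> rcases hy with hy | hy
  · obtain ⟨_, rfl⟩ := UU_mem hx; obtain ⟨_, rfl⟩ := UU_mem hy; simp [LMatches] at h
  · obtain ⟨_, rfl⟩ := UU_mem hx; obtain ⟨_, rfl⟩ := VV_mem hy; simp [LMatches] at h; exact hp h.2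
  · obtain ⟨_, rfl⟩ := VV_mem hx; obtain ⟨_, rfl⟩ := UU_mem hy; simp [LMatches] at h
    exact hp h.2.symm
  · obtain ⟨_, rfl⟩ := VV_mem hx; obtain ⟨_, rfl⟩ := VV_mem hy; simp [LMatches] at h

theorem UV_letter {n k : ℕ} {G : SimpleGraph (Fin n)} {p p' : PT}
    {t : Finset (Fin n)} : ∀ x ∈ UU n k p t ++ VV n k G p' t,
    x ≠ .inr .alpha ∧ x ≠ .inr .beta ∧ x ≠ .inr .gamma ∧
    x ≠ .inl .alpha ∧ x ≠ .inl .beta ∧ x ≠ .inl .gamma := by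
  intro x hx
  rw [List.mem_append] at hx
  rcases hx with hx | hx
  · obtain ⟨_, rfl⟩ := UU_mem hx; simp
  · obtain ⟨_, rfl⟩ := VV_mem hx; simp

theorem UV_sum {n k : ℕ} {G : SimpleGraph (Fin n)} {p p' : PT} {t : Finset (Fin n)}
    (ht : t.card = k) : ((UU n k p t ++ VV n k G p' t).map (chg n k)).sum = DD n k := by
  rw [List.map_append, List.sum_append, UU_sum p ht, VV_sum p' ht, DD, E1]
  ring

theorem blk_notMem {τ : Type*} {M : ℕ} {q q' : RSig} {C : τ → List RL} {cl : List τ} (hq : q ≠ q')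
    (hC : ∀ t ∈ cl, ∀ x ∈ C t, x ≠ .inl q) : .inl q ∉ blk M q' C cl := by
  intro h
  simp only [blk, gads, List.mem_append, List.mem_flatMap, List.mem_replicate,
    List.mem_singleton] at h
  rcases h with (h | ⟨t, ht, (h | h) | h⟩) | h
  · exact hq (by simpa using h.2)
  · cases h
  · exact hC t ht _ h rfl
  · cases h
  · exact hq (by simpa using h.2)

theorem log_pos' {n : ℕ} (hn : 2 ≤ n) : 0 < logn n := Nat.log_pos (by norm_num) hn

theorem l1_pos {n k : ℕ} (hk : 1 ≤ k) (hn : 2 ≤ n) : 0 < l1 n k := by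
  have := log_pos' hn
  unfold l1
  positivity

theorem DD_bounds {n k : ℕ} (hk : 1 ≤ k) (hn : 2 ≤ n) : 0 < DD n k ∧ DD n k < l3 n k := by
  have h1 := log_pos' hn
  have h2 := l1_pos hk hn
  have hc : Nat.clog 2 n ≤ 2 * logn n := by
    have : Nat.clog 2 n ≤ logn n + 1 := by
      rw [Nat.clog_le_iff_le_pow (by norm_num)]
      exact (Nat.lt_pow_succ_log_self (by norm_num) n).le
    omega
  have hl2 : l2 n k = 10 * (k * k * l1 n k) := by unfold l2; ring
  have e1 : k * k * (2 * n * (10 * logn n)) = 2 * l1 n k := by unfold l1; ring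
  have e2 : k * k * (2 * Nat.clog 2 n) ≤ l1 n k := by
    have : l1 n k = k * k * (10 * (n * logn n)) := by unfold l1; ring
    rw [this]
    apply Nat.mul_le_mul_left
    nlinarith
  have e3 : l1 n k ≤ k * k * l1 n k := by
    nlinarith [Nat.mul_le_mul hk hk]
  have e4 : DD n k = 2 * l2 n k + (2 * (k * k * l1 n k) + k * k * (2 * n * (10 * logn n)) +
      k * k * (2 * Nat.clog 2 n)) := by unfold DD E1; ring
  unfold l3
  omega



theorem mem_cl {n k : ℕ} {G : SimpleGraph (Fin n)} {t : Finset (Fin n)} :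
    t ∈ cliqueList n k G ↔ G.IsNClique k t := by
  classical
  simp [cliqueList]

theorem half_full {n k : ℕ} {G : SimpleGraph (Fin n)} {p p' : PT} {t : Finset (Fin n)}
    (ht : t.card = k) {M : ℕ → Prop} {o : ℕ}
    (h : mc (chg n k) M o (UU n k p t ++ VV n k G p' t) = DD n k) :
    mc (chg n k) M o (UU n k p t) = ((UU n k p t).map (chg n k)).sum ∧
    mc (chg n k) M (o + (UU n k p t).length) (VV n k G p' t) =
      ((VV n k G p' t).map (chg n k)).sum := by
  rw [← UV_sum (G := G) (p := p) (p' := p') ht, mc_append, List.map_append, List.sum_append] at h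
  have := mc_le (chg n k) M o (UU n k p t)
  have := mc_le (chg n k) M (o + (UU n k p t).length) (VV n k G p' t)
  omega

theorem half_loc {n k : ℕ} {G : SimpleGraph (Fin n)} {p p' : PT} {t : Finset (Fin n)} {o : ℕ}
    {s : ℕ → Option RL} (h : Seg s o (UU n k p t ++ VV n k G p' t)) {i : ℕ}
    (hi : o ≤ i ∧ i < o + (UU n k p t ++ VV n k G p' t).length) :
    ((o ≤ i ∧ i < o + (UU n k p t).length) ∧ ∃ b, s i = some (.inl (.mk b p))) ∨
    ((o + (UU n k p t).length ≤ i ∧ i < o + (UU n k p t).length + (VV n k G p' t).length) ∧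
      ∃ b, s i = some (.inr (.mk b p'))) := by
  obtain ⟨h1, h2⟩ := seg_append h
  rw [List.length_append] at hi
  by_cases c : i < o + (UU n k p t).length
  · left
    obtain ⟨x, hx, e⟩ := seg_mem h1 hi.1 c
    obtain ⟨b, rfl⟩ := UU_mem hx
    exact ⟨⟨hi.1, c⟩, b, e⟩
  · right
    obtain ⟨x, hx, e⟩ := seg_mem h2 (i := i) (by omega) (by omega)
    obtain ⟨b, rfl⟩ := VV_mem hx
    exact ⟨⟨by omega, by omega⟩, b, e⟩

theorem match_inl {s : ℕ → Option RL} {T : ℕ → ℕ → Prop} (H : NC s T) {i j : ℕ} {a : RSig}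
    (h : T i j) (e : s i = some (.inl a)) : s j = some (.inr a) := by
  obtain ⟨x, y, hx, hy, hm⟩ := H.mtch _ _ h
  rw [e] at hx
  cases hx
  cases y with
  | inl z => simp [LMatches] at hm
  | inr z => simp only [LMatches] at hm; subst hm; exact hy

theorem match_inr {s : ℕ → Option RL} {T : ℕ → ℕ → Prop} (H : NC s T) {i j : ℕ} {a : RSig}
    (h : T i j) (e : s i = some (.inr a)) : s j = some (.inl a) := by
  obtain ⟨x, y, hx, hy, hm⟩ := H.mtch _ _ h
  rw [e] at hx
  cases hx
  cases y with
  | inr z => simp [LMatches] at hm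
  | inl z => simp only [LMatches] at hm; subst hm; exact hy

/-- generic final step for one pair of halves -/
theorem pair_step {s : ℕ → Option RL} {T : ℕ → ℕ → Prop} (H : NC s T) {n k : ℕ} (hn : 2 ≤ n)
    (hl : 0 < l1 n k) (hlog : 0 < logn n) {G : SimpleGraph (Fin n)} (p : PT)
    {t t' : Finset (Fin n)} (ht : t.card = k) (ht' : t'.card = k) {oU oV : ℕ}
    (sU : Seg s oU (UU n k p t)) (sV : Seg s oV (VV n k G p t'))
    (hd : oU + (UU n k p t).length ≤ oV ∨ oV + (VV n k G p t').length ≤ oU)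
    (lU : ∀ i b, Mtd T i → s i = some (.inl (.mk b p)) → oU ≤ i ∧ i < oU + (UU n k p t).length)
    (lV : ∀ i b, Mtd T i → s i = some (.inr (.mk b p)) → oV ≤ i ∧ i < oV + (VV n k G p t').length)
    (cU : mc (chg n k) (Mtd T) oU (UU n k p t) = ((UU n k p t).map (chg n k)).sum)
    (cV : mc (chg n k) (Mtd T) oV (VV n k G p t') = ((VV n k G p t').map (chg n k)).sum) :
    ∀ v ∈ t, ∀ u ∈ t', G.Adj u v := by
  refine uv_adj H hn hl hlog p ht ht' sU sV hd ?_ ?_ cU cV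
  · intro i j h1 h2 h
    obtain ⟨x, hx, e⟩ := seg_mem sU h1 h2
    obtain ⟨b, rfl⟩ := UU_mem hx
    exact lV j b ⟨i, H.symm _ _ h⟩ (match_inl H h e)
  · intro i j h1 h2 h
    obtain ⟨x, hx, e⟩ := seg_mem sV h1 h2
    obtain ⟨b, rfl⟩ := VV_mem hx
    exact lU j b ⟨i, H.symm _ _ h⟩ (match_inr H h e)

theorem union_clique {n k : ℕ} {G : SimpleGraph (Fin n)} {t1 t2 t3 : Finset (Fin n)}
    (h1 : G.IsNClique k t1) (h2 : G.IsNClique k t2) (h3 : G.IsNClique k t3)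
    (a12 : ∀ v ∈ t1, ∀ u ∈ t2, G.Adj u v) (a13 : ∀ v ∈ t1, ∀ u ∈ t3, G.Adj u v)
    (a23 : ∀ v ∈ t2, ∀ u ∈ t3, G.Adj u v) : ∃ t : Finset (Fin n), G.IsNClique (3 * k) t := by
  classical
  refine ⟨t1 ∪ t2 ∪ t3, ?_, ?_⟩
  · intro x hx y hy hne
    simp only [Finset.coe_union, Set.mem_union, Finset.mem_coe] at hx hy
    rcases hx with (hx | hx) | hx <;> rcases hy with (hy | hy) | hy
    · exact h1.1 hx hy hne
    · exact (a12 _ hx _ hy).symm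
    · exact (a13 _ hx _ hy).symm
    · exact a12 _ hy _ hx
    · exact h2.1 hx hy hne
    · exact (a23 _ hx _ hy).symm
    · exact a13 _ hy _ hx
    · exact a23 _ hy _ hx
    · exact h3.1 hx hy hne
  · have d12 : Disjoint t1 t2 := Finset.disjoint_left.2 fun x hx hy => (a12 x hx x hy).ne rfl
    have d3 : Disjoint (t1 ∪ t2) t3 := by
      rw [Finset.disjoint_union_left]
      exact ⟨Finset.disjoint_left.2 fun x hx hy => (a13 x hx x hy).ne rfl,
        Finset.disjoint_left.2 fun x hx hy => (a23 x hx x hy).ne rfl⟩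
    rw [Finset.card_union_of_disjoint d3, Finset.card_union_of_disjoint d12, h1.2, h2.2, h3.2]
    ring

theorem upper {n k : ℕ} (hk : 1 ≤ k) (hn : 2 ≤ n) (G : SimpleGraph (Fin n))
    {A : Finset (ℕ × ℕ)} (hA : IsFolding (SG n k G) A) :
    mc (chg n k) (Mtd (TT A)) 0 (SG n k G) <
        3 * (2 * (cliqueList n k G).length * l3 n k + DD n k) ∨
      (mc (chg n k) (Mtd (TT A)) 0 (SG n k G) =
        3 * (2 * (cliqueList n k G).length * l3 n k + DD n k) ∧
        ∃ t : Finset (Fin n), G.IsNClique (3 * k) t) := by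
  have H := nc_of_folding hA
  obtain ⟨hD0, hDl⟩ := DD_bounds hk hn
  obtain ⟨Ba, hBa⟩ : ∃ B, B = blk (2 * n ^ k) .alpha (CGa n k G) (cliqueList n k G) := ⟨_, rfl⟩
  obtain ⟨Bb, hBb⟩ : ∃ B, B = blk (2 * n ^ k) .beta (CGb n k G) (cliqueList n k G) := ⟨_, rfl⟩
  obtain ⟨Bg, hBg⟩ : ∃ B, B = blk (2 * n ^ k) .gamma (CGg n k G) (cliqueList n k G) := ⟨_, rfl⟩
  have hS : SG n k G = Ba ++ Bb ++ Bg := by rw [hBa, hBb, hBg]; exact SG_eq n k G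
  have La : ∀ t, ∀ x ∈ CGa n k G t, _ := fun t => UV_letter (G := G) (p := .ag) (p' := .ab) (t := t)
  have Lb : ∀ t, ∀ x ∈ CGb n k G t, _ := fun t => UV_letter (G := G) (p := .ab) (p' := .bg) (t := t)
  have Lg : ∀ t, ∀ x ∈ CGg n k G t, _ := fun t => UV_letter (G := G) (p := .bg) (p' := .ag) (t := t)
  have ba := blk_bound H .alpha (CGa n k G) (chg n k) (l3 n k) (DD n k) (2 * n ^ k) hD0 hDl rfl rfl
    (cliqueList n k G) [] (Bb ++ Bg) (by rw [hS, hBa]; simp) (by simp) (by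
      rw [List.mem_append, hBb, hBg]
      rintro (h | h)
      · exact blk_notMem (by simp) (fun t _ x hx => (Lb t x hx).2.2.2.1) h
      · exact blk_notMem (by simp) (fun t _ x hx => (Lg t x hx).2.2.2.1) h)
    (fun t _ x hx => (La t x hx).1) (fun t _ x hx => (La t x hx).2.2.2.1)
    (fun t _ => UV_nomatch (by decide)) (fun t ht => UV_sum (mem_cl.1 ht).2)
  have bb := blk_bound H .beta (CGb n k G) (chg n k) (l3 n k) (DD n k) (2 * n ^ k) hD0 hDl rfl rfl
    (cliqueList n k G) Ba Bg (by rw [hS, hBb]; simp) (by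
      rw [hBa]
      exact blk_notMem (by simp) (fun t _ x hx => (La t x hx).2.2.2.2.1)) (by
      rw [hBg]
      exact blk_notMem (by simp) (fun t _ x hx => (Lg t x hx).2.2.2.2.1))
    (fun t _ x hx => (Lb t x hx).2.1) (fun t _ x hx => (Lb t x hx).2.2.2.2.1)
    (fun t _ => UV_nomatch (by decide)) (fun t ht => UV_sum (mem_cl.1 ht).2)
  have bg := blk_bound H .gamma (CGg n k G) (chg n k) (l3 n k) (DD n k) (2 * n ^ k) hD0 hDl rfl rfl
    (cliqueList n k G) (Ba ++ Bb) [] (by rw [hS, hBg]; simp) (by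
      rw [List.mem_append, hBa, hBb]
      rintro (h | h)
      · exact blk_notMem (by simp) (fun t _ x hx => (La t x hx).2.2.2.2.2) h
      · exact blk_notMem (by simp) (fun t _ x hx => (Lb t x hx).2.2.2.2.2) h) (by simp)
    (fun t _ x hx => (Lg t x hx).2.2.1) (fun t _ x hx => (Lg t x hx).2.2.2.2.2)
    (fun t _ => UV_nomatch (by decide)) (fun t ht => UV_sum (mem_cl.1 ht).2)
  rw [← hBa] at ba
  rw [← hBb] at bb
  rw [← hBg] at bg
  simp only [List.length_nil, List.length_append, zero_add] at ba bb bg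
  have tot : mc (chg n k) (Mtd (TT A)) 0 (SG n k G) = mc (chg n k) (Mtd (TT A)) 0 Ba +
      mc (chg n k) (Mtd (TT A)) Ba.length Bb +
      mc (chg n k) (Mtd (TT A)) (Ba.length + Bb.length) Bg := by
    rw [hS, mc_append, mc_append]; simp
  rw [tot]
  rcases ba with ba | ⟨ba, ta, hta, oa, a1, a2, a3, a4, a5⟩
  · left; rcases bb with bb | ⟨bb, _⟩ <;> rcases bg with bg | ⟨bg, _⟩ <;> omega
  rcases bb with bb | ⟨bb, tb, htb, ob, b1, b2, b3, b4, b5⟩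
  · left; rcases bg with bg | ⟨bg, _⟩ <;> omega
  rcases bg with bg | ⟨bg, tg, htg, og, g1, g2, g3, g4, g5⟩
  · left; omega
  right
  refine ⟨by omega, ?_⟩
  have cla := mem_cl.1 hta
  have clb := mem_cl.1 htb
  have clg := mem_cl.1 htg
  have fa := half_full (p := .ag) (p' := .ab) cla.2 a4
  have fb := half_full (p := .ab) (p' := .bg) clb.2 b4
  have fg := half_full (p := .bg) (p' := .ag) clg.2 g4
  have sa := seg_append (X := UU n k .ag ta) (Y := VV n k G .ab ta) a3
  have sb := seg_append (X := UU n k .ab tb) (Y := VV n k G .bg tb) b3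
  have sg := seg_append (X := UU n k .bg tg) (Y := VV n k G .ag tg) g3
  have eb : (CGb n k G tb).length = (UU n k .ab tb).length + (VV n k G .bg tb).length :=
    List.length_append
  have ea : (CGa n k G ta).length = (UU n k .ag ta).length + (VV n k G .ab ta).length :=
    List.length_append
  have eg : (CGg n k G tg).length = (UU n k .bg tg).length + (VV n k G .ag tg).length :=
    List.length_append
  have loc : ∀ i b p, Mtd (TT A) i → ((SG n k G)[i]? = some (.inl (.mk b p)) ∨
      (SG n k G)[i]? = some (.inr (.mk b p))) →
      (((oa ≤ i ∧ i < oa + (UU n k .ag ta).length) ∧ ∃ b, (SG n k G)[i]? = some (.inl (.mk b .ag))) ∨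
       ((oa + (UU n k .ag ta).length ≤ i ∧ i < oa + (UU n k .ag ta).length + (VV n k G .ab ta).length) ∧
        ∃ b, (SG n k G)[i]? = some (.inr (.mk b .ab)))) ∨
      (((ob ≤ i ∧ i < ob + (UU n k .ab tb).length) ∧ ∃ b, (SG n k G)[i]? = some (.inl (.mk b .ab))) ∨
       ((ob + (UU n k .ab tb).length ≤ i ∧ i < ob + (UU n k .ab tb).length + (VV n k G .bg tb).length) ∧
        ∃ b, (SG n k G)[i]? = some (.inr (.mk b .bg)))) ∨
      (((og ≤ i ∧ i < og + (UU n k .bg tg).length) ∧ ∃ b, (SG n k G)[i]? = some (.inl (.mk b .bg))) ∨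
       ((og + (UU n k .bg tg).length ≤ i ∧ i < og + (UU n k .bg tg).length + (VV n k G .ag tg).length) ∧
        ∃ b, (SG n k G)[i]? = some (.inr (.mk b .ag)))) := by
    intro i b p hM hi
    have hlt : i < Ba.length + Bb.length + Bg.length := by
      have : i < (SG n k G).length := by
        by_contra hh
        rw [List.getElem?_eq_none (by omega)] at hi
        simp at hi
      rw [hS] at this
      simpa [add_assoc] using this
    by_cases c1 : i < Ba.length
    · left
      exact half_loc (s := fun i => (SG n k G)[i]?) a3 (a5 i (by omega) c1 hM
        (by rcases hi with hi | hi <;> rw [hi] <;> simp)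
        (by rcases hi with hi | hi <;> rw [hi] <;> simp))
    by_cases c2 : i < Ba.length + Bb.length
    · right; left
      exact half_loc (s := fun i => (SG n k G)[i]?) b3 (b5 i (by omega) c2 hM
        (by rcases hi with hi | hi <;> rw [hi] <;> simp)
        (by rcases hi with hi | hi <;> rw [hi] <;> simp))
    · right; right
      exact half_loc (s := fun i => (SG n k G)[i]?) g3 (g5 i (by omega) hlt hM
        (by rcases hi with hi | hi <;> rw [hi] <;> simp)
        (by rcases hi with hi | hi <;> rw [hi] <;> simp))
  have hl := l1_pos hk hn
  have hlog := log_pos' hn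
  have A1 : ∀ v ∈ ta, ∀ u ∈ tg, G.Adj u v := by
    refine pair_step H hn hl hlog .ag cla.2 clg.2 sa.1 sg.2 (by omega) ?_ ?_ fa.1 fg.2
    · intro i b hM hi
      rcases loc i b _ hM (Or.inl hi) with
        (⟨h, c, e⟩ | ⟨h, c, e⟩) | (⟨h, c, e⟩ | ⟨h, c, e⟩) | (⟨h, c, e⟩ | ⟨h, c, e⟩) <;>
        first | exact h | (change (SG n k G)[i]? = _ at hi; rw [hi] at e; simp at e)
    · intro i b hM hi
      rcases loc i b _ hM (Or.inr hi) with
        (⟨h, c, e⟩ | ⟨h, c, e⟩) | (⟨h, c, e⟩ | ⟨h, c, e⟩) | (⟨h, c, e⟩ | ⟨h, c, e⟩) <;>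
        first | exact h | (change (SG n k G)[i]? = _ at hi; rw [hi] at e; simp at e)
  have A2 : ∀ v ∈ tb, ∀ u ∈ ta, G.Adj u v := by
    refine pair_step H hn hl hlog .ab clb.2 cla.2 sb.1 sa.2 (by omega) ?_ ?_ fb.1 fa.2
    · intro i b hM hi
      rcases loc i b _ hM (Or.inl hi) with
        (⟨h, c, e⟩ | ⟨h, c, e⟩) | (⟨h, c, e⟩ | ⟨h, c, e⟩) | (⟨h, c, e⟩ | ⟨h, c, e⟩) <;>
        first | exact h | (change (SG n k G)[i]? = _ at hi; rw [hi] at e; simp at e)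
    · intro i b hM hi
      rcases loc i b _ hM (Or.inr hi) with
        (⟨h, c, e⟩ | ⟨h, c, e⟩) | (⟨h, c, e⟩ | ⟨h, c, e⟩) | (⟨h, c, e⟩ | ⟨h, c, e⟩) <;>
        first | exact h | (change (SG n k G)[i]? = _ at hi; rw [hi] at e; simp at e)
  have A3 : ∀ v ∈ tg, ∀ u ∈ tb, G.Adj u v := by
    refine pair_step H hn hl hlog .bg clg.2 clb.2 sg.1 sb.2 (by omega) ?_ ?_ fg.1 fb.2
    · intro i b hM hi
      rcases loc i b _ hM (Or.inl hi) with
        (⟨h, c, e⟩ | ⟨h, c, e⟩) | (⟨h, c, e⟩ | ⟨h, c, e⟩) | (⟨h, c, e⟩ | ⟨h, c, e⟩) <;>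
        first | exact h | (change (SG n k G)[i]? = _ at hi; rw [hi] at e; simp at e)
    · intro i b hM hi
      rcases loc i b _ hM (Or.inr hi) with
        (⟨h, c, e⟩ | ⟨h, c, e⟩) | (⟨h, c, e⟩ | ⟨h, c, e⟩) | (⟨h, c, e⟩ | ⟨h, c, e⟩) <;>
        first | exact h | (change (SG n k G)[i]? = _ at hi; rw [hi] at e; simp at e)
  exact union_clique cla clb clg (fun v hv u hu => (A2 u hu v hv).symm) A1
    (fun v hv u hu => (A3 u hu v hv).symm)



theorem cl_len {n k : ℕ} (G : SimpleGraph (Fin n)) : (cliqueList n k G).length ≤ n ^ k := by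
  classical
  rw [cliqueList, Finset.length_toList]
  calc _ ≤ (Finset.powersetCard k (Finset.univ : Finset (Fin n))).card := by
        apply Finset.card_le_card
        intro t ht
        rw [Finset.mem_filter] at ht
        rw [Finset.mem_powersetCard]
        exact ⟨Finset.subset_univ _, ht.2.2⟩
    _ = n.choose k := by simp
    _ ≤ n ^ k := Nat.choose_le_pow n k

theorem SG_zero (n : ℕ) (G G' : SimpleGraph (Fin n)) : SG n 0 G = SG n 0 G' := by
  classical
  have h1 : cliqueList n 0 G = cliqueList n 0 G' := by
    unfold cliqueList
    congr 1
    ext t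
    simp
  have hL : ∀ t, CLGr n 0 G t = CLGr n 0 G' t := by intro t; simp [CLGr, rep]
  have ha : CGa n 0 G = CGa n 0 G' := by funext t; simp [CGa, hL]
  have hb : CGb n 0 G = CGb n 0 G' := by funext t; simp [CGb, hL]
  have hg : CGg n 0 G = CGg n 0 G' := by funext t; simp [CGg, hL]
  simp only [SG_eq, h1, ha, hb, hg]

theorem lower {n k : ℕ} {G : SimpleGraph (Fin n)} {t : Finset (Fin n)}
    (ht : G.IsNClique (3 * k) t) :
    Fold (wt n k) (SG n k G) (3 * (2 * (cliqueList n k G).length * l3 n k + DD n k)) := by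
  classical
  obtain ⟨hc, hk⟩ := ht
  obtain ⟨t1, s1, c1⟩ := Finset.exists_subset_card_eq (s := t) (n := k) (by omega)
  have hd : (t \ t1).card = 2 * k := by rw [Finset.card_sdiff_of_subset s1]; omega
  obtain ⟨t2, s2, c2⟩ := Finset.exists_subset_card_eq (s := t \ t1) (n := k) (by omega)
  have hd2 : ((t \ t1) \ t2).card = k := by rw [Finset.card_sdiff_of_subset s2]; omega
  have s3 : (t \ t1) \ t2 ⊆ t := Finset.sdiff_subset.trans Finset.sdiff_subset
  have s2' : t2 ⊆ t := s2.trans Finset.sdiff_subset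
  have adj : ∀ v ∈ t, ∀ u ∈ t, u ≠ v → G.Adj u v := fun v hv u hu h => hc hu hv h
  refine fold_total t1 t2 ((t \ t1) \ t2) (mem_cl.2 ⟨hc.subset (by exact_mod_cast s1), c1⟩)
    (mem_cl.2 ⟨hc.subset (by exact_mod_cast s2'), c2⟩)
    (mem_cl.2 ⟨hc.subset (by exact_mod_cast s3), hd2⟩) c1 c2 hd2 ?_ ?_ ?_ (cl_len G)
  · intro v hv u hu
    refine adj v (s1 hv) u (s2' hu) ?_
    rintro rfl
    exact (Finset.mem_sdiff.1 (s2 hu)).2 hv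
  · intro v hv u hu
    refine adj v (s1 hv) u (s3 hu) ?_
    rintro rfl
    exact (Finset.mem_sdiff.1 (Finset.mem_sdiff.1 hu).1).2 hv
  · intro v hv u hu
    refine adj v (s2' hv) u (s3 hu) ?_
    rintro rfl
    exact (Finset.mem_sdiff.1 hu).2 hv


/-- Claim 3.7 of the paper.
Let `N = |C_k|` be the number of `k`-cliques of `G`. There is an integer `E_C` depending only
on `n`, `k` and `N` (the paper computes `E_C = 6N·ℓ₃ + E₃`) such that the weighted RNA folding
score of the clique-detecting sequence `S_G` equals `E_C` if `G` contains a `3k`-clique, and is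
at most `E_C − 1` otherwise. -/
theorem wrna_clique_detecting_sequence (n k N : ℕ) :
    ∃ EC : ℕ, ∀ G : SimpleGraph (Fin n), (cliqueList n k G).length = N →
      ((∃ t : Finset (Fin n), G.IsNClique (3 * k) t) → WRNA (wt n k) (SG n k G) = EC) ∧
      (¬ (∃ t : Finset (Fin n), G.IsNClique (3 * k) t) →
        WRNA (wt n k) (SG n k G) ≤ EC - 1) := by
  classical
  rcases Nat.eq_zero_or_pos k with rfl | hk
  · refine ⟨WRNA (wt n 0) (SG n 0 ⊥), fun G _ => ⟨fun _ => by rw [SG_zero n G ⊥], fun h => ?_⟩⟩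
    exact (h ⟨∅, by simp⟩).elim
  by_cases hn : n < 3 * k
  · refine ⟨(∑ G : SimpleGraph (Fin n), WRNA (wt n k) (SG n k G)) + 1, fun G _ => ⟨?_, fun _ => ?_⟩⟩
    · rintro ⟨t, ht⟩
      have := Finset.card_le_univ t
      rw [ht.2, Fintype.card_fin] at this
      omega
    · exact Finset.single_le_sum (f := fun G : SimpleGraph (Fin n) => WRNA (wt n k) (SG n k G))
        (fun _ _ => Nat.zero_le _) (Finset.mem_univ G)
  have hn2 : 2 ≤ n := by omega
  refine ⟨3 * (2 * N * l3 n k + DD n k), ?_⟩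
  rintro G rfl
  have hne : {m | ∃ A : Finset (ℕ × ℕ), IsFolding (SG n k G) A ∧
      ∑ p ∈ A, ((SG n k G).map (Sum.elim (wt n k) (wt n k))).getD p.1 0 = m}.Nonempty :=
    ⟨0, ∅, by simp [IsFolding], by simp⟩
  have ub : ∀ m ∈ {m | ∃ A : Finset (ℕ × ℕ), IsFolding (SG n k G) A ∧
      ∑ p ∈ A, ((SG n k G).map (Sum.elim (wt n k) (wt n k))).getD p.1 0 = m},
      m ≤ 3 * (2 * (cliqueList n k G).length * l3 n k + DD n k) := by
    rintro m ⟨A, hA, rfl⟩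
    rw [score_eq n k hA]
    rcases upper hk hn2 G hA with h | ⟨h, _⟩
    · exact h.le
    · exact h.le
  constructor
  · rintro ⟨t, ht⟩
    apply le_antisymm
    · exact csSup_le hne ub
    · exact le_csSup ⟨_, ub⟩ (Fold.sound (lower ht))
  · intro hno
    apply csSup_le hne
    rintro m ⟨A, hA, rfl⟩
    rw [score_eq n k hA]
    rcases upper hk hn2 G hA with h | ⟨_, h⟩
    · omega
    · exact (hno h).elim


end RNAFolding
end

section
/- Consider an optimal alignment of a string w over a bracket alphabet. Let Z be a maximal substring of w consisting entirely of copies of some symbol z, and let Z₀ be a maximal substring of w consisting entirely of copies of some symbol z₀, with |Z| = |Z₀|, such that the alignment contains matches between Z and Z₀, and Z is the only maximal substring of w containing the symbol z. Then one can modify the alignment, increasing its cost by at most 2, so that the symbols of Z₀ that are matched to symbols of Z form a contiguous substring of Z₀ which is a suffix of Z₀ (or, if preferred, a prefix of Z₀), and all remaining symbols of Z₀ are deleted or mismatched among themselves. -/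
/-!
Formalization of Dyck edit distance from
"If the Current Clique Algorithms are Optimal, so is Valiant's Parser"
(Abboud, Backurs, Vassilevska Williams), Section 4.

Letters come from `Σ ∪ Σ'`, modelled as `σ ⊕ σ`: `Sum.inl a` is an opening bracket `a ∈ Σ` and
`Sum.inr a` is the corresponding closing bracket `a' ∈ Σ'`.
-/

namespace DyckEdit

/-- Two pairs of indices `(i₁,j₁)`, `(i₂,j₂)` with `i₁<j₁` and `i₂<j₂` "cross" iff they share an
index, or `i₁<i₂<j₁<j₂`, or `i₂<i₁<j₂<j₁`. -/
def Crosses (p q : ℕ × ℕ) : Prop :=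
  p.1 = q.1 ∨ p.1 = q.2 ∨ p.2 = q.1 ∨ p.2 = q.2 ∨
    (p.1 < q.1 ∧ q.1 < p.2 ∧ p.2 < q.2) ∨ (q.1 < p.1 ∧ p.1 < q.2 ∧ q.2 < p.2)

/-- `j` lies in the half-open interval `[lo, hi)`. -/
def inIco (lo hi j : ℕ) : Prop := lo ≤ j ∧ j < hi

/-- An alignment of `S`: a set of pairwise non-crossing pairs `(i,j)` with `i < j < |S|`. -/
def IsAlignment {σ : Type*} (S : List (σ ⊕ σ)) (A : Finset (ℕ × ℕ)) : Prop :=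
  (∀ p ∈ A, p.1 < p.2 ∧ p.2 < S.length) ∧
    ∀ p ∈ A, ∀ q ∈ A, p ≠ q → ¬ Crosses p q

/-- An aligned pair `(i,j)` is a match if `S[i] = σ ∈ Σ` and `S[j] = σ'`
(an opening bracket and the corresponding closing bracket); otherwise it is a mismatch. -/
def IsMatchPair {σ : Type*} (S : List (σ ⊕ σ)) (p : ℕ × ℕ) : Prop :=
  ∃ a : σ, S[p.1]? = some (.inl a) ∧ S[p.2]? = some (.inr a)

open Classical in
/-- The cost of an alignment: the number of mismatched pairs plus the number of deleted letters
(letters appearing in no pair of the alignment). -/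
noncomputable def cost {σ : Type*} (S : List (σ ⊕ σ)) (A : Finset (ℕ × ℕ)) : ℕ :=
  (A.filter (fun p => ¬ IsMatchPair S p)).card +
    ((Finset.range S.length).filter (fun i => ∀ p ∈ A, p.1 ≠ i ∧ p.2 ≠ i)).card

/-- The Dyck edit distance of `S`: the minimum cost of an alignment of `S`, which equals the
minimum number of substitutions and deletions needed to turn `S` into a string of the Dyck
language. -/
noncomputable def dyck {σ : Type*} (S : List (σ ⊕ σ)) : ℕ :=
  sInf {c | ∃ A : Finset (ℕ × ℕ), IsAlignment S A ∧ cost S A = c}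

open Classical in
/-- The contribution of the index interval `[lo, hi)` to the cost of an alignment: mismatched
pairs starting in the interval plus deleted letters in the interval. -/
noncomputable def contrib {σ : Type*} (S : List (σ ⊕ σ)) (A : Finset (ℕ × ℕ)) (lo hi : ℕ) : ℕ :=
  (A.filter (fun p => lo ≤ p.1 ∧ p.1 < hi ∧ ¬ IsMatchPair S p)).card +
    ((Finset.Ico lo hi).filter (fun i => ∀ p ∈ A, p.1 ≠ i ∧ p.2 ≠ i)).card


lemma swap_noncross (V E l l' u u' a b : ℕ) (P Q p : ℕ × ℕ)
    (hl : V ≤ l) (hll : l < l') (hl' : l' < E) (hu : u < V ∨ E ≤ u) (hu' : u' < V ∨ E ≤ u')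
    (hP : P = (l, u) ∨ P = (u, l)) (hQ : Q = (l', u') ∨ Q = (u', l'))
    (hP1 : P.1 < P.2) (hQ1 : Q.1 < Q.2) (hp1 : p.1 < p.2)
    (hPQ : ¬ Crosses P Q) (hpP : ¬ Crosses p P) (hpQ : ¬ Crosses p Q)
    (hab : a < b) (hR : (a = u ∧ b = u') ∨ (a = u' ∧ b = u))
    (h1 : V ≤ p.1 → p.1 < E → (p.2 < V ∨ E ≤ p.2) → ¬ (l < p.1 ∧ p.1 < l'))
    (h2 : V ≤ p.2 → p.2 < E → (p.1 < V ∨ E ≤ p.1) → ¬ (l < p.2 ∧ p.2 < l')) :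
    ¬ Crosses p (l, l') ∧ ¬ Crosses p (a, b) ∧ ¬ Crosses (l, l') (a, b) := by
  obtain ⟨x, y⟩ := p
  unfold Crosses at *
  rcases hP with rfl | rfl <;> rcases hQ with rfl | rfl <;> rcases hR with ⟨rfl, rfl⟩ | ⟨rfl, rfl⟩ <;>
    dsimp only at * <;> refine ⟨?_, ?_, ?_⟩ <;> rcases hu with hu | hu <;> rcases hu' with hu' | hu' <;> 
    first
    | (exfalso; omega)
    | (rintro (h | h | h | h | h | h) <;> omega)

lemma crosses_symm {p q : ℕ × ℕ} (h : Crosses p q) : Crosses q p := by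
  unfold Crosses at *; omega

/-- number of pairs which are not matches and have exactly one endpoint in `[V,E)` -/
def IsOut {σ : Type*} (w : List (σ ⊕ σ)) (V E : ℕ) (p : ℕ × ℕ) : Prop :=
  ¬ IsMatchPair w p ∧ ((inIco V E p.1 ∧ ¬ inIco V E p.2) ∨ (inIco V E p.2 ∧ ¬ inIco V E p.1))

set_option maxHeartbeats 1600000 in
open Classical in
lemma swap {σ : Type*} (w : List (σ ⊕ σ)) (V E : ℕ) (A : Finset (ℕ × ℕ)) (hA : IsAlignment w A)
    (z₀ : σ ⊕ σ) (hZ0 : ∀ i, inIco V E i → w[i]? = some z₀)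
    (P Q : ℕ × ℕ) (hPA : P ∈ A) (hQA : Q ∈ A) (hPm : ¬ IsMatchPair w P) (hQm : ¬ IsMatchPair w Q)
    (l l' u u' : ℕ) 
    (hl : V ≤ l) (hll : l < l') (hl' : l' < E) (hu : u < V ∨ E ≤ u) (hu' : u' < V ∨ E ≤ u')
    (hP : P = (l, u) ∨ P = (u, l)) (hQ : Q = (l', u') ∨ Q = (u', l'))
    (h1 : ∀ p ∈ A, V ≤ p.1 → p.1 < E → (p.2 < V ∨ E ≤ p.2) → ¬ (l < p.1 ∧ p.1 < l'))
    (h2 : ∀ p ∈ A, V ≤ p.2 → p.2 < E → (p.1 < V ∨ E ≤ p.1) → ¬ (l < p.2 ∧ p.2 < l')) :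
    ∃ A', IsAlignment w A' ∧ cost w A' ≤ cost w A ∧
      (A'.filter (IsOut w V E)).card < (A.filter (IsOut w V E)).card := by
  have hPQne : P ≠ Q := by
    rintro rfl
    rcases hP with hP | hP <;> rcases hQ with hQ | hQ <;> rw [hP] at hQ <;> simp at hQ <;> omega
  have hP1 := hA.1 P hPA
  have hQ1 := hA.1 Q hQA
  have hPQ := hA.2 P hPA Q hQA hPQne
  have huu : u ≠ u' := by
    rintro rfl
    apply hPQ
    unfold Crosses
    rcases hP with rfl | rfl <;> rcases hQ with rfl | rfl <;> simp
  obtain ⟨a, b, hab, hR⟩ : ∃ a b, a < b ∧ ((a = u ∧ b = u') ∨ (a = u' ∧ b = u)) := by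
    rcases lt_or_gt_of_ne huu with h | h
    · exact ⟨u, u', h, by simp⟩
    · exact ⟨u', u, h, by simp⟩
  have hulen : u < w.length ∧ l < w.length := by
    rcases hP with rfl | rfl <;> simp at hP1 <;> omega
  have hulen' : u' < w.length ∧ l' < w.length := by
    rcases hQ with rfl | rfl <;> simp at hQ1 <;> omega
  have key : ∀ p ∈ A, p ≠ P → p ≠ Q →
      ¬ Crosses p (l, l') ∧ ¬ Crosses p (a, b) ∧ ¬ Crosses (l, l') (a, b) := fun p hp h3 h4 =>
    swap_noncross V E l l' u u' a b P Q p hl hll hl' hu hu' hP hQ hP1.1 hQ1.1 (hA.1 p hp).1 hPQ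
      (hA.2 p hp P hPA h3) (hA.2 p hp Q hQA h4) hab hR (h1 p hp) (h2 p hp)
  have hnew : ¬ Crosses (l, l') (a, b) := by
    unfold Crosses at *
    rcases hP with rfl | rfl <;> rcases hQ with rfl | rfl <;> dsimp only at * <;> omega
  set B := (A.erase P).erase Q with hB
  have hBm : ∀ p, p ∈ B ↔ p ∈ A ∧ p ≠ P ∧ p ≠ Q := by
    intro p; rw [hB]; simp only [Finset.mem_erase]; tauto
  have hmm : ¬ IsMatchPair w (l, l') := by
    rintro ⟨c, hc1, hc2⟩
    dsimp only at hc1 hc2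
    rw [hZ0 l ⟨hl, by omega⟩] at hc1
    rw [hZ0 l' ⟨by omega, hl'⟩] at hc2
    rw [hc1] at hc2; simp at hc2
  refine ⟨insert (l, l') (insert (a, b) B), ⟨?_, ?_⟩, ?_, ?_⟩
  · intro p hp
    simp only [Finset.mem_insert] at hp
    rcases hp with rfl | rfl | hp
    · exact ⟨hll, hulen'.2⟩
    · refine ⟨hab, ?_⟩
      dsimp only; omega
    · exact hA.1 p ((hBm p).1 hp).1
  · intro p hp q hq hne
    simp only [Finset.mem_insert] at hp hq
    rcases hp with rfl | rfl | hp <;> rcases hq with rfl | rfl | hq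
    · exact absurd rfl hne
    · exact hnew
    · obtain ⟨x, y, t⟩ := (hBm q).1 hq
      exact fun h => (key q x y t).1 (crosses_symm h)
    · exact fun h => hnew (crosses_symm h)
    · exact absurd rfl hne
    · obtain ⟨x, y, t⟩ := (hBm q).1 hq
      exact fun h => (key q x y t).2.1 (crosses_symm h)
    · obtain ⟨x, y, t⟩ := (hBm p).1 hp
      exact (key p x y t).1
    · obtain ⟨x, y, t⟩ := (hBm p).1 hp
      exact (key p x y t).2.1
    · exact hA.2 p ((hBm p).1 hp).1 q ((hBm q).1 hq).1 hne
  · unfold cost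
    apply Nat.add_le_add
    · have e1 : (insert (l, l') (insert (a, b) B)).filter (fun p => ¬ IsMatchPair w p) ⊆
          insert (l, l') (insert (a, b) (B.filter (fun p => ¬ IsMatchPair w p))) := by
        intro p; simp only [Finset.mem_filter, Finset.mem_insert]
        rintro ⟨h | h | h, h'⟩
        exacts [Or.inl h, Or.inr (Or.inl h), Or.inr (Or.inr ⟨h, h'⟩)]
      have e2 : A.filter (fun p => ¬ IsMatchPair w p) =
          insert P (insert Q (B.filter (fun p => ¬ IsMatchPair w p))) := by
        ext p; simp only [Finset.mem_filter, Finset.mem_insert, hBm]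
        constructor
        · rintro ⟨h, h'⟩
          by_cases e : p = P
          · exact Or.inl e
          · by_cases e' : p = Q
            · exact Or.inr (Or.inl e')
            · exact Or.inr (Or.inr ⟨⟨h, e, e'⟩, h'⟩)
        · rintro (rfl | rfl | h)
          · exact ⟨hPA, hPm⟩
          · exact ⟨hQA, hQm⟩
          · exact ⟨h.1.1, h.2⟩
      rw [e2, Finset.card_insert_of_notMem, Finset.card_insert_of_notMem]
      · refine (Finset.card_le_card e1).trans ((Finset.card_insert_le _ _).trans ?_)
        have := Finset.card_insert_le (a, b) (B.filter (fun p => ¬ IsMatchPair w p))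
        omega
      · simp [hBm]
      · simp [hBm, hPQne]
    · apply Finset.card_le_card
      intro i
      simp only [Finset.mem_filter, Finset.mem_insert]
      rintro ⟨hi, h⟩
      refine ⟨hi, fun p hp => ?_⟩
      have c1 := h (l, l') (Or.inl rfl)
      have c2 := h (a, b) (Or.inr (Or.inl rfl))
      dsimp only at c1 c2
      by_cases e : p = P
      · subst e
        rcases hP with rfl | rfl <;> dsimp only <;> omega
      · by_cases e' : p = Q
        · subst e'
          rcases hQ with rfl | rfl <;> dsimp only <;> omega
        · exact h p (Or.inr (Or.inr ((hBm p).2 ⟨hp, e, e'⟩)))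
  · apply Finset.card_lt_card
    refine ⟨?_, ?_⟩
    · intro p
      simp only [Finset.mem_filter, Finset.mem_insert]
      rintro ⟨rfl | rfl | h, h'⟩
      · exfalso
        unfold IsOut inIco at h'
        dsimp only at h'; omega
      · exfalso
        unfold IsOut inIco at h'
        dsimp only at h'; omega
      · exact ⟨((hBm p).1 h).1, h'⟩
    · intro h
      have : P ∈ A.filter (IsOut w V E) := by
        simp only [Finset.mem_filter]
        refine ⟨hPA, hPm, ?_⟩
        unfold inIco
        rcases hP with rfl | rfl <;> dsimp only <;> omega
      have := h this
      simp only [Finset.mem_filter, Finset.mem_insert, hBm] at this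
      rcases this.1 with h | h | h
      · rcases hP with rfl | rfl <;> simp at h <;> omega
      · rcases hP with rfl | rfl <;> simp at h <;> omega
      · exact h.2.1 rfl


/-- `l` in `[V,E)` is in a mismatched pair with `u` outside of `[V,E)` -/
def OL {σ : Type*} (w : List (σ ⊕ σ)) (A : Finset (ℕ × ℕ)) (V E l u : ℕ) : Prop :=
  V ≤ l ∧ l < E ∧ (u < V ∨ E ≤ u) ∧ ∃ P ∈ A, ¬ IsMatchPair w P ∧ (P = (l, u) ∨ P = (u, l))

/-- `i` is matched -/
def ML {σ : Type*} (w : List (σ ⊕ σ)) (A : Finset (ℕ × ℕ)) (i : ℕ) : Prop :=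
  ∃ p ∈ A, IsMatchPair w p ∧ (p.1 = i ∨ p.2 = i)

/-- facts about the run structure -/
structure Runs {σ : Type*} (w : List (σ ⊕ σ)) (V E W F : ℕ) : Prop where
  h1 : ∀ p : ℕ × ℕ, p.1 < p.2 → IsMatchPair w p → inIco V E p.1 → inIco W F p.2
  h1' : ∀ p : ℕ × ℕ, p.1 < p.2 → IsMatchPair w p → inIco V E p.2 → inIco W F p.1
  h2 : ∀ p : ℕ × ℕ, p.1 < p.2 → inIco V E p.1 → inIco W F p.2 → IsMatchPair w p
  h2' : ∀ p : ℕ × ℕ, p.1 < p.2 → inIco V E p.2 → inIco W F p.1 → IsMatchPair w p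
  dis : E ≤ W ∨ F ≤ V

lemma ML_pair {σ : Type*} {w : List (σ ⊕ σ)} {A : Finset (ℕ × ℕ)} (hA : IsAlignment w A)
    {V E W F : ℕ} (R : Runs w V E W F) {i : ℕ} (hi : inIco V E i) (h : ML w A i) :
    ∃ j, inIco W F j ∧ ∃ p ∈ A, IsMatchPair w p ∧ (p = (i, j) ∨ p = (j, i)) := by
  obtain ⟨⟨x, y⟩, hp, hm, rfl | rfl⟩ := h
  · exact ⟨y, R.h1 _ (hA.1 _ hp).1 hm hi, (x, y), hp, hm, Or.inl rfl⟩
  · exact ⟨x, R.h1' _ (hA.1 _ hp).1 hm hi, (x, y), hp, hm, Or.inr rfl⟩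

lemma between_cross (V E W F l u i j i' j' : ℕ) (P p q : ℕ × ℕ)
    (hdis : E ≤ W ∨ F ≤ V) (hj : W ≤ j ∧ j < F) (hj' : W ≤ j' ∧ j' < F)
    (hi : V ≤ i) (hil : i < l) (hli : l < i') (hi' : i' < E) (hu : u < V ∨ E ≤ u)
    (hP : P = (l, u) ∨ P = (u, l)) (hp : p = (i, j) ∨ p = (j, i)) (hq : q = (i', j') ∨ q = (j', i'))
    (hP1 : P.1 < P.2) (hp1 : p.1 < p.2) (hq1 : q.1 < q.2)
    (c1 : ¬ Crosses P p) (c2 : ¬ Crosses P q) (c3 : ¬ Crosses p q) : W ≤ u ∧ u < F := by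
  unfold Crosses at *
  rcases hP with rfl | rfl <;> rcases hp with rfl | rfl <;> rcases hq with rfl | rfl <;>
    dsimp only at * <;> rcases hdis with hd | hd <;> omega

lemma no_between {σ : Type*} {w : List (σ ⊕ σ)} {A : Finset (ℕ × ℕ)} (hA : IsAlignment w A)
    {V E W F : ℕ} (R : Runs w V E W F) {l u i i' : ℕ} (hl : OL w A V E l u)
    (hi : V ≤ i) (hil : i < l) (hli : l < i') (hi' : i' < E) (h : ML w A i) (h' : ML w A i') :
    False := by
  obtain ⟨hl1, hl2, hu, P, hPA, hPm, hP⟩ := hl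
  obtain ⟨j, hj, p, hpA, hpm, hp⟩ := ML_pair hA R ⟨hi, by omega⟩ h
  obtain ⟨j', hj', q, hqA, hqm, hq⟩ := ML_pair hA R ⟨by omega, hi'⟩ h'
  have hpq : p ≠ q := by
    have := R.dis
    unfold inIco at *
    rintro rfl
    rcases hp with rfl | rfl <;> rcases hq with hq | hq <;> simp at hq <;> omega
  have hPp : P ≠ p := by rintro rfl; exact hPm hpm
  have hPq : P ≠ q := by rintro rfl; exact hPm hqm
  have hP1 := (hA.1 _ hPA).1
  have key := between_cross V E W F l u i j i' j' P p q R.dis hj hj' hi hil hli hi' hu hP hp hq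
    hP1 (hA.1 _ hpA).1 (hA.1 _ hqA).1 (hA.2 _ hPA _ hpA hPp) (hA.2 _ hPA _ hqA hPq)
    (hA.2 _ hpA _ hqA hpq)
  apply hPm
  rcases hP with rfl | rfl
  · exact R.h2 _ hP1 ⟨hl1, hl2⟩ key
  · exact R.h2' _ hP1 ⟨hl1, hl2⟩ key

/-- a pair of outside letters with no matched letter in between -/
def Good {σ : Type*} (w : List (σ ⊕ σ)) (A : Finset (ℕ × ℕ)) (V E l l' : ℕ) : Prop :=
  l < l' ∧ (∃ u, OL w A V E l u) ∧ (∃ u, OL w A V E l' u) ∧ ∀ i, l < i → i < l' → ¬ ML w A i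

lemma good_of_three {σ : Type*} {w : List (σ ⊕ σ)} {A : Finset (ℕ × ℕ)} (hA : IsAlignment w A)
    {V E W F : ℕ} (R : Runs w V E W F) {l₁ l₂ l₃ u₁ u₂ u₃ : ℕ} (h₁ : OL w A V E l₁ u₁)
    (h₂ : OL w A V E l₂ u₂) (h₃ : OL w A V E l₃ u₃) (h12 : l₁ < l₂) (h23 : l₂ < l₃) :
    ∃ l l', Good w A V E l l' := by
  by_cases h : ∀ i, l₁ < i → i < l₂ → ¬ ML w A i
  · exact ⟨l₁, l₂, h12, ⟨_, h₁⟩, ⟨_, h₂⟩, h⟩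
  by_cases h' : ∀ i, l₂ < i → i < l₃ → ¬ ML w A i
  · exact ⟨l₂, l₃, h23, ⟨_, h₂⟩, ⟨_, h₃⟩, h'⟩
  push Not at h h'
  obtain ⟨i, a1, a2, a3⟩ := h
  obtain ⟨i', b1, b2, b3⟩ := h'
  have := h₁.1
  have := h₃.2.1
  exact (no_between hA R h₂ (by omega) a2 b1 (by omega) a3 b3).elim

lemma good_adj {σ : Type*} {w : List (σ ⊕ σ)} {A : Finset (ℕ × ℕ)}
    {V E : ℕ} (n : ℕ) : ∀ l l', l' - l ≤ n → Good w A V E l l' →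
    ∃ l l', Good w A V E l l' ∧ ∀ i u, l < i → i < l' → ¬ OL w A V E i u := by
  induction n with
  | zero => intro l l' h g; have := g.1; omega
  | succ n ih =>
    intro l l' h g
    by_cases c : ∀ i u, l < i → i < l' → ¬ OL w A V E i u
    · exact ⟨l, l', g, c⟩
    · push Not at c
      obtain ⟨i, u, h1, h2, h3⟩ := c
      exact ih l i (by omega) ⟨h1, g.2.1, ⟨u, h3⟩, fun t a b => g.2.2.2 t a (by omega)⟩

lemma out_OL {σ : Type*} {w : List (σ ⊕ σ)} {A : Finset (ℕ × ℕ)} {V E : ℕ} {p : ℕ × ℕ}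
    (hp : p ∈ A) (h : IsOut w V E p) : ∃ l u, OL w A V E l u ∧ (p = (l, u) ∨ p = (u, l)) := by
  obtain ⟨hm, h⟩ := h
  unfold inIco at h
  obtain ⟨x, y⟩ := p
  dsimp only at h
  rcases h with h | h
  · exact ⟨x, y, ⟨by omega, by omega, by omega, _, hp, hm, Or.inl rfl⟩, Or.inl rfl⟩
  · exact ⟨y, x, ⟨by omega, by omega, by omega, _, hp, hm, Or.inr rfl⟩, Or.inr rfl⟩

lemma out_ne {σ : Type*} {w : List (σ ⊕ σ)} {A : Finset (ℕ × ℕ)} (hA : IsAlignment w A)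
    {p q : ℕ × ℕ} (hp : p ∈ A) (hq : q ∈ A) (hpq : p ≠ q) {l u l' u' : ℕ}
    (h : p = (l, u) ∨ p = (u, l)) (h' : q = (l', u') ∨ q = (u', l')) : l ≠ l' := by
  have := hA.2 _ hp _ hq hpq
  unfold Crosses at this
  rcases h with rfl | rfl <;> rcases h' with rfl | rfl <;> dsimp only at * <;> omega

open Classical in
lemma exists_good {σ : Type*} {w : List (σ ⊕ σ)} {A : Finset (ℕ × ℕ)} (hA : IsAlignment w A)
    {V E W F : ℕ} (R : Runs w V E W F) (h : 2 < (A.filter (IsOut w V E)).card) :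
    ∃ l l', Good w A V E l l' := by
  rw [Finset.two_lt_card] at h
  obtain ⟨a, ha, b, hb, c, hc, hab, hac, hbc⟩ := h
  rw [Finset.mem_filter] at ha hb hc
  obtain ⟨l₁, u₁, o₁, e₁⟩ := out_OL ha.1 ha.2
  obtain ⟨l₂, u₂, o₂, e₂⟩ := out_OL hb.1 hb.2
  obtain ⟨l₃, u₃, o₃, e₃⟩ := out_OL hc.1 hc.2
  have n12 := out_ne hA ha.1 hb.1 hab e₁ e₂
  have n13 := out_ne hA ha.1 hc.1 hac e₁ e₃
  have n23 := out_ne hA hb.1 hc.1 hbc e₂ e₃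
  rcases lt_or_gt_of_ne n12 with h | h <;> rcases lt_or_gt_of_ne n13 with h' | h' <;>
    rcases lt_or_gt_of_ne n23 with h'' | h''
  · exact good_of_three hA R o₁ o₂ o₃ h h''
  · exact good_of_three hA R o₁ o₃ o₂ h' h''
  · omega
  · exact good_of_three hA R o₃ o₁ o₂ h' h
  · exact good_of_three hA R o₂ o₁ o₃ h h'
  · omega
  · exact good_of_three hA R o₂ o₃ o₁ h'' h'
  · exact good_of_three hA R o₃ o₂ o₁ h'' h

open Classical in
lemma reduce {σ : Type*} {w : List (σ ⊕ σ)} {V E W F : ℕ} (R : Runs w V E W F)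
    (z₀ : σ ⊕ σ) (hZ0 : ∀ i, inIco V E i → w[i]? = some z₀) (n : ℕ) :
    ∀ A : Finset (ℕ × ℕ), IsAlignment w A → (A.filter (IsOut w V E)).card ≤ n →
    ∃ A', IsAlignment w A' ∧ cost w A' ≤ cost w A ∧ (A'.filter (IsOut w V E)).card ≤ 2 := by
  induction n with
  | zero => intro A hA h; exact ⟨A, hA, le_rfl, by omega⟩
  | succ n ih =>
    intro A hA h
    by_cases c : (A.filter (IsOut w V E)).card ≤ 2
    · exact ⟨A, hA, le_rfl, c⟩
    obtain ⟨l, l', g⟩ := exists_good hA R (by omega)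
    obtain ⟨l, l', ⟨hll, ⟨u, a1, a2, a3, P, hPA, hPm, hP⟩, ⟨u', b1, b2, b3, Q, hQA, hQm, hQ⟩, hno⟩, hadj⟩ :=
      good_adj _ l l' le_rfl g
    obtain ⟨A', q1, q2, q3⟩ := swap w V E A hA z₀ hZ0 P Q hPA hQA hPm hQm l l' u u' a1 hll b2 a3 b3 hP hQ
      (by
        intro p hp x1 x2 x3 ⟨x4, x5⟩
        by_cases hm : IsMatchPair w p
        · exact hno _ x4 x5 ⟨p, hp, hm, Or.inl rfl⟩
        · exact hadj _ _ x4 x5 ⟨x1, x2, x3, p, hp, hm, Or.inl rfl⟩)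
      (by
        intro p hp x1 x2 x3 ⟨x4, x5⟩
        by_cases hm : IsMatchPair w p
        · exact hno _ x4 x5 ⟨p, hp, hm, Or.inr rfl⟩
        · exact hadj _ _ x4 x5 ⟨x1, x2, x3, p, hp, hm, Or.inr rfl⟩)
    obtain ⟨A'', r1, r2, r3⟩ := ih A' q1 (by omega)
    exact ⟨A'', r1, r2.trans q2, r3⟩


/-- shift map: push the elements of `I` to the end of `[V, E)` -/
def shiftMap (I : Finset ℕ) (V E i : ℕ) : ℕ :=
  if V ≤ i ∧ i < E then E - (I.filter (fun t => i ≤ t)).card else i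

lemma shift_out {I : Finset ℕ} {V E i : ℕ} (h : ¬ (V ≤ i ∧ i < E)) : shiftMap I V E i = i := by
  unfold shiftMap; rw [if_neg h]

lemma shift_in {I : Finset ℕ} {V E i : ℕ} (hI : ∀ i ∈ I, V ≤ i ∧ i < E) (hi : i ∈ I) :
    E - I.card ≤ shiftMap I V E i ∧ shiftMap I V E i < E := by
  unfold shiftMap; rw [if_pos (hI i hi)]
  have h1 : (I.filter (fun t => i ≤ t)).card ≤ I.card := Finset.card_filter_le _ _
  have h2 : 0 < (I.filter (fun t => i ≤ t)).card :=
    Finset.card_pos.2 ⟨i, by simp [hi]⟩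
  have := hI i hi
  omega

lemma card_I {I : Finset ℕ} {V E : ℕ} (hI : ∀ i ∈ I, V ≤ i ∧ i < E) : I.card ≤ E - V := by
  have : I ⊆ Finset.Ico V E := fun i hi => by simpa using hI i hi
  simpa using Finset.card_le_card this

lemma shift_lt {I : Finset ℕ} {V E i j : ℕ} (hI : ∀ i ∈ I, V ≤ i ∧ i < E)
    (hi : i ∈ I ∨ ¬ (V ≤ i ∧ i < E)) (hj : j ∈ I ∨ ¬ (V ≤ j ∧ j < E)) (hij : i < j) :
    shiftMap I V E i < shiftMap I V E j := by
  have hc := card_I hI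
  rcases hi with hi | hi <;> rcases hj with hj | hj
  · have h1 : (I.filter (fun t => i ≤ t)).card ≤ I.card := Finset.card_filter_le _ _
    have h2 : (I.filter (fun t => j ≤ t)).card < (I.filter (fun t => i ≤ t)).card := by
      apply Finset.card_lt_card
      refine ⟨fun t => ?_, fun h => ?_⟩
      · simp only [Finset.mem_filter]; exact fun ⟨a, b⟩ => ⟨a, by omega⟩
      · have := h (Finset.mem_filter.2 ⟨hi, le_rfl⟩)
        simp at this; omega
    have := hI i hi
    have := hI j hj
    unfold shiftMap
    rw [if_pos (by omega), if_pos (by omega)]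
    omega
  · have := shift_in hI hi
    have := hI i hi
    rw [shift_out hj]; omega
  · have := shift_in hI hj
    have := hI j hj
    rw [shift_out hi]; omega
  · rwa [shift_out hi, shift_out hj]

lemma shift_surj {I : Finset ℕ} {V E j : ℕ} (hI : ∀ i ∈ I, V ≤ i ∧ i < E)
    (h1 : E - I.card ≤ j) (h2 : j < E) : ∃ i ∈ I, shiftMap I V E i = j := by
  have hsub : I.image (shiftMap I V E) ⊆ Finset.Ico (E - I.card) E := by
    intro x hx
    obtain ⟨i, hi, rfl⟩ := Finset.mem_image.1 hx
    simpa using shift_in hI hi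
  have hinj : Set.InjOn (shiftMap I V E) I := by
    intro a ha b hb h
    rcases lt_trichotomy a b with c | c | c
    · have := shift_lt hI (Or.inl ha) (Or.inl hb) c; omega
    · exact c
    · have := shift_lt hI (Or.inl hb) (Or.inl ha) c; omega
  have hc := card_I hI
  have : I.image (shiftMap I V E) = Finset.Ico (E - I.card) E := by
    apply Finset.eq_of_subset_of_card_le hsub
    rw [Finset.card_image_of_injOn hinj]
    simp; omega
  have hj : j ∈ I.image (shiftMap I V E) := by rw [this]; simp [h1, h2]
  simpa using hj

lemma shift_cross {I : Finset ℕ} {V E : ℕ} (hI : ∀ i ∈ I, V ≤ i ∧ i < E) {p q : ℕ × ℕ}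
    (a : p.1 ∈ I ∨ ¬ (V ≤ p.1 ∧ p.1 < E)) (b : p.2 ∈ I ∨ ¬ (V ≤ p.2 ∧ p.2 < E))
    (c : q.1 ∈ I ∨ ¬ (V ≤ q.1 ∧ q.1 < E)) (d : q.2 ∈ I ∨ ¬ (V ≤ q.2 ∧ q.2 < E))
    (h : Crosses (Prod.map (shiftMap I V E) (shiftMap I V E) p)
      (Prod.map (shiftMap I V E) (shiftMap I V E) q)) : Crosses p q := by
  have lt : ∀ {i j}, (i ∈ I ∨ ¬ (V ≤ i ∧ i < E)) → (j ∈ I ∨ ¬ (V ≤ j ∧ j < E)) →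
      shiftMap I V E i < shiftMap I V E j → i < j := by
    intro i j hi hj h
    rcases lt_trichotomy i j with c | c | c
    · exact c
    · subst c; omega
    · have := shift_lt hI hj hi c; omega
  have eq : ∀ {i j}, (i ∈ I ∨ ¬ (V ≤ i ∧ i < E)) → (j ∈ I ∨ ¬ (V ≤ j ∧ j < E)) →
      shiftMap I V E i = shiftMap I V E j → i = j := by
    intro i j hi hj h
    rcases lt_trichotomy i j with c | c | c
    · have := shift_lt hI hi hj c; omega
    · exact c
    · have := shift_lt hI hj hi c; omega
  unfold Crosses at *
  simp only [Prod.map_fst, Prod.map_snd] at h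
  rcases h with h | h | h | h | ⟨h, h', h''⟩ | ⟨h, h', h''⟩
  · exact Or.inl (eq a c h)
  · exact Or.inr (Or.inl (eq a d h))
  · exact Or.inr (Or.inr (Or.inl (eq b c h)))
  · exact Or.inr (Or.inr (Or.inr (Or.inl (eq b d h))))
  · exact Or.inr (Or.inr (Or.inr (Or.inr (Or.inl ⟨lt a c h, lt c b h', lt b d h''⟩))))
  · exact Or.inr (Or.inr (Or.inr (Or.inr (Or.inr ⟨lt c a h, lt a d h', lt d b h''⟩))))

set_option maxHeartbeats 1600000 in
open Classical in
lemma final_step {σ : Type*} {w : List (σ ⊕ σ)} {V m W F : ℕ} (R : Runs w V (V + m) W F)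
    (z₀ : σ ⊕ σ) (hZ0 : ∀ i, inIco V (V + m) i → w[i]? = some z₀) (hlen : V + m ≤ w.length)
    (A : Finset (ℕ × ℕ)) (hA : IsAlignment w A)
    (hO : (A.filter (IsOut w V (V + m))).card ≤ 2) :
    ∃ A' : Finset (ℕ × ℕ), IsAlignment w A' ∧ cost w A' ≤ cost w A + 2 ∧
      ∃ s ≤ m,
        (∀ j, inIco V (V + m) j →
          ((∃ p ∈ A', IsMatchPair w p ∧
              ((p.1 = j ∧ inIco W F p.2) ∨
               (p.2 = j ∧ inIco W F p.1))) ↔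
            V + m - s ≤ j)) ∧
        (∀ p ∈ A',
          (inIco V (V + m - s) p.1 ∨ inIco V (V + m - s) p.2) →
          (inIco V (V + m - s) p.1 ∧ inIco V (V + m - s) p.2 ∧
            ¬ IsMatchPair w p)) := by
  set I : Finset ℕ := (Finset.Ico V (V + m)).filter (fun i => ML w A i) with hIdef
  have hI : ∀ i ∈ I, V ≤ i ∧ i < V + m := by
    intro i hi; rw [hIdef, Finset.mem_filter, Finset.mem_Ico] at hi; exact hi.1
  have hkm : I.card ≤ m := by have := card_I hI; omega
  set f := shiftMap I V (V + m) with hf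
  set g : ℕ × ℕ → ℕ × ℕ := Prod.map f f with hg
  set B := A.filter (fun p => IsMatchPair w p ∨ (¬ inIco V (V + m) p.1 ∧ ¬ inIco V (V + m) p.2))
    with hB
  set h := (m - I.card) / 2 with hh
  set S := (Finset.range h).image (fun t => (V + 2 * t, V + 2 * t + 1)) with hS
  have hfw : ∀ i, (i ∈ I ∨ ¬ (V ≤ i ∧ i < V + m)) → w[f i]? = w[i]? := by
    rintro i (hi | hi)
    · have := shift_in hI hi
      rw [hZ0 i (hI i hi), hZ0 (f i)]
      unfold inIco; rw [hf]; omega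
    · rw [hf, shift_out hi]
  have hBD : ∀ p ∈ B, p ∈ A ∧ (p.1 ∈ I ∨ ¬ (V ≤ p.1 ∧ p.1 < V + m)) ∧
      (p.2 ∈ I ∨ ¬ (V ≤ p.2 ∧ p.2 < V + m)) := by
    intro p hp
    rw [hB, Finset.mem_filter] at hp
    refine ⟨hp.1, ?_, ?_⟩
    · by_cases c : (V ≤ p.1 ∧ p.1 < V + m)
      · left
        rw [hIdef, Finset.mem_filter, Finset.mem_Ico]
        exact ⟨c, p, hp.1, hp.2.resolve_right (fun x => x.1 c), Or.inl rfl⟩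
      · exact Or.inr c
    · by_cases c : (V ≤ p.2 ∧ p.2 < V + m)
      · left
        rw [hIdef, Finset.mem_filter, Finset.mem_Ico]
        exact ⟨c, p, hp.1, hp.2.resolve_right (fun x => x.2 c), Or.inr rfl⟩
      · exact Or.inr c
  have hgm : ∀ p ∈ B, (IsMatchPair w (g p) ↔ IsMatchPair w p) := by
    intro p hp
    obtain ⟨-, a, b⟩ := hBD p hp
    unfold IsMatchPair
    simp only [hg, Prod.map_fst, Prod.map_snd, hfw _ a, hfw _ b]
  have hfr : ∀ i, (i ∈ I ∨ ¬ (V ≤ i ∧ i < V + m)) → f i < V ∨ V + m - I.card ≤ f i := by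
    rintro i (hi | hi)
    · exact Or.inr (shift_in hI hi).1
    · rw [hf, shift_out hi]; omega
  have hSm : ∀ p ∈ S, ∃ t < h, p = (V + 2 * t, V + 2 * t + 1) := by
    intro p hp
    obtain ⟨t, ht, rfl⟩ := Finset.mem_image.1 hp
    exact ⟨t, by simpa using ht, rfl⟩
  have hselfm : ∀ p : ℕ × ℕ, inIco V (V + m) p.1 → inIco V (V + m) p.2 → ¬ IsMatchPair w p := by
    rintro p a b ⟨c, c1, c2⟩
    rw [hZ0 _ a] at c1
    rw [hZ0 _ b, c1] at c2
    simp at c2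
  have hSS : ∀ p ∈ S, inIco V (V + m - I.card) p.1 ∧ inIco V (V + m - I.card) p.2 ∧
      ¬ IsMatchPair w p := by
    intro p hp
    obtain ⟨t, ht, rfl⟩ := hSm p hp
    refine ⟨?_, ?_, hselfm _ ?_ ?_⟩ <;> unfold inIco <;> dsimp only <;> omega
  refine ⟨B.image g ∪ S, ⟨?_, ?_⟩, ?_, I.card, hkm, ?_, ?_⟩
  · intro p hp
    rcases Finset.mem_union.1 hp with hp | hp
    · obtain ⟨q, hq, rfl⟩ := Finset.mem_image.1 hp
      obtain ⟨hqA, a, b⟩ := hBD q hq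
      have hq1 := hA.1 q hqA
      refine ⟨shift_lt hI a b hq1.1, ?_⟩
      simp only [hg, Prod.map_snd]
      rcases b with b | b
      · have := shift_in hI b
        rw [hf]; omega
      · rw [hf, shift_out b]; exact hq1.2
    · obtain ⟨t, ht, rfl⟩ := hSm p hp
      dsimp only; omega
  · have mixed : ∀ q ∈ B, ∀ p ∈ S, ¬ Crosses (g q) p := by
      intro q hq p hp
      obtain ⟨t, ht, rfl⟩ := hSm p hp
      obtain ⟨hqA, a, b⟩ := hBD q hq
      have := hfr _ a
      have := hfr _ b
      unfold Crosses
      simp only [hg, Prod.map_fst, Prod.map_snd]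
      omega
    intro p hp q hq hne
    rcases Finset.mem_union.1 hp with hp | hp <;> rcases Finset.mem_union.1 hq with hq | hq
    · obtain ⟨p, hpp, rfl⟩ := Finset.mem_image.1 hp
      obtain ⟨q, hqq, rfl⟩ := Finset.mem_image.1 hq
      obtain ⟨hpA, a, b⟩ := hBD p hpp
      obtain ⟨hqA, a', b'⟩ := hBD q hqq
      intro hc
      exact hA.2 p hpA q hqA (by rintro rfl; exact hne rfl) (shift_cross hI a b a' b' hc)
    · obtain ⟨p, hpp, rfl⟩ := Finset.mem_image.1 hp
      exact mixed p hpp q hq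
    · obtain ⟨q, hqq, rfl⟩ := Finset.mem_image.1 hq
      exact fun hc => mixed q hqq p hp (crosses_symm hc)
    · obtain ⟨t, ht, rfl⟩ := hSm p hp
      obtain ⟨t', ht', rfl⟩ := hSm q hq
      have : t ≠ t' := by rintro rfl; exact hne rfl
      unfold Crosses; dsimp only; omega
  · -- cost
    set K := A.filter (fun p => ¬ IsMatchPair w p ∧ ¬ inIco V (V + m) p.1 ∧ ¬ inIco V (V + m) p.2)
      with hK
    set O := A.filter (IsOut w V (V + m)) with hOd
    set T := A.filter (fun p => inIco V (V + m) p.1 ∧ inIco V (V + m) p.2) with hT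
    set D := (Finset.range w.length).filter (fun i => ∀ p ∈ A, p.1 ≠ i ∧ p.2 ≠ i) with hD
    set D1 := D.filter (fun i => inIco V (V + m) i) with hD1
    set D2 := D.filter (fun i => ¬ inIco V (V + m) i) with hD2
    have eD : D1.card + D2.card = D.card := Finset.card_filter_add_card_filter_not _
    have eM : K.card + O.card + T.card ≤ (A.filter (fun p => ¬ IsMatchPair w p)).card := by
      rw [← Finset.card_union_of_disjoint, ← Finset.card_union_of_disjoint]
      · apply Finset.card_le_card
        intro p hp
        simp only [hK, hOd, hT, Finset.mem_union, Finset.mem_filter] at hp ⊢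
        rcases hp with (hp | hp) | hp
        · exact ⟨hp.1, hp.2.1⟩
        · exact ⟨hp.1, hp.2.1⟩
        · exact ⟨hp.1, hselfm _ hp.2.1 hp.2.2⟩
      · rw [Finset.disjoint_left]
        intro p hp hp'
        simp only [hK, hOd, hT, Finset.mem_union, Finset.mem_filter] at hp hp'
        rcases hp with hp | hp
        · exact hp.2.2.1 hp'.2.1
        · rcases hp.2.2 with x | x
          · exact x.2 hp'.2.2
          · exact x.2 hp'.2.1
      · rw [Finset.disjoint_left]
        intro p hp hp'
        simp only [hK, hOd, Finset.mem_filter] at hp hp'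
        rcases hp'.2.2 with x | x
        · exact hp.2.2.1 x.1
        · exact hp.2.2.2 x.1
    have eZ : m ≤ I.card + O.card + T.card + T.card + D1.card := by
      have hsub : Finset.Ico V (V + m) ⊆ I ∪ O.image (fun p => if inIco V (V + m) p.1 then p.1 else p.2)
          ∪ T.image Prod.fst ∪ T.image Prod.snd ∪ D1 := by
        intro i hi
        have hi' : inIco V (V + m) i := by simpa [inIco] using hi
        simp only [Finset.mem_union]
        by_cases c : ∀ p ∈ A, p.1 ≠ i ∧ p.2 ≠ i
        · right
          simp only [hD1, hD, Finset.mem_filter, Finset.mem_range]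
          refine ⟨⟨?_, c⟩, hi'⟩
          have := hi'.2; omega
        left
        obtain ⟨p, hp, hpi⟩ : ∃ p ∈ A, p.1 = i ∨ p.2 = i := by
          by_contra hcon
          push Not at hcon
          exact c hcon
        by_cases hm : IsMatchPair w p
        · left; left; left
          rw [hIdef, Finset.mem_filter]
          exact ⟨hi, p, hp, hm, hpi⟩
        by_cases x1 : inIco V (V + m) p.1 <;> by_cases x2 : inIco V (V + m) p.2
        · have : p ∈ T := by rw [hT, Finset.mem_filter]; exact ⟨hp, x1, x2⟩
          rcases hpi with rfl | rfl
          · left; right; exact Finset.mem_image_of_mem _ this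
          · right; exact Finset.mem_image_of_mem _ this
        · left; left; right
          refine Finset.mem_image.2 ⟨p, ?_, ?_⟩
          · rw [hOd, Finset.mem_filter]; exact ⟨hp, hm, Or.inl ⟨x1, x2⟩⟩
          · rw [if_pos x1]
            rcases hpi with rfl | rfl
            · rfl
            · exact absurd hi' x2
        · left; left; right
          refine Finset.mem_image.2 ⟨p, ?_, ?_⟩
          · rw [hOd, Finset.mem_filter]; exact ⟨hp, hm, Or.inr ⟨x2, x1⟩⟩
          · rw [if_neg x1]
            rcases hpi with rfl | rfl
            · exact absurd hi' x1
            · rfl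
        · rcases hpi with rfl | rfl
          · exact absurd hi' x1
          · exact absurd hi' x2
      have c0 := Finset.card_le_card hsub
      rw [Nat.card_Ico] at c0
      have c1 := Finset.card_union_le (I ∪ O.image (fun p => if inIco V (V + m) p.1 then p.1 else p.2)
          ∪ T.image Prod.fst ∪ T.image Prod.snd) D1
      have c2 := Finset.card_union_le (I ∪ O.image (fun p => if inIco V (V + m) p.1 then p.1 else p.2)
          ∪ T.image Prod.fst) (T.image Prod.snd)
      have c3 := Finset.card_union_le (I ∪ O.image (fun p => if inIco V (V + m) p.1 then p.1 else p.2))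
          (T.image Prod.fst)
      have c4 := Finset.card_union_le I (O.image (fun p => if inIco V (V + m) p.1 then p.1 else p.2))
      have c5 : (O.image (fun p => if inIco V (V + m) p.1 then p.1 else p.2)).card ≤ O.card :=
        Finset.card_image_le
      have c6 : (T.image Prod.fst).card ≤ T.card := Finset.card_image_le
      have c7 : (T.image Prod.snd).card ≤ T.card := Finset.card_image_le
      omega
    have eM' : ((B.image g ∪ S).filter (fun p => ¬ IsMatchPair w p)).card ≤ K.card + h := by
      have hsub : (B.image g ∪ S).filter (fun p => ¬ IsMatchPair w p) ⊆ K.image g ∪ S := by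
        intro p hp
        rw [Finset.mem_filter, Finset.mem_union] at hp
        obtain ⟨hp | hp, hm⟩ := hp
        · obtain ⟨q, hq, rfl⟩ := Finset.mem_image.1 hp
          rw [hgm q hq] at hm
          apply Finset.mem_union_left
          apply Finset.mem_image_of_mem
          rw [hB, Finset.mem_filter] at hq
          rw [hK, Finset.mem_filter]
          exact ⟨hq.1, hm, hq.2.resolve_left hm⟩
        · exact Finset.mem_union_right _ hp
      have c0 := Finset.card_le_card hsub
      have c1 := Finset.card_union_le (K.image g) S
      have c2 : (K.image g).card ≤ K.card := Finset.card_image_le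
      have c3 : S.card ≤ (Finset.range h).card := Finset.card_image_le
      rw [Finset.card_range] at c3
      omega
    have eD' : ((Finset.range w.length).filter
        (fun i => ∀ p ∈ B.image g ∪ S, p.1 ≠ i ∧ p.2 ≠ i)).card ≤
        D2.card + O.card + (m - I.card - 2 * h) := by
      have hsub : (Finset.range w.length).filter
          (fun i => ∀ p ∈ B.image g ∪ S, p.1 ≠ i ∧ p.2 ≠ i) ⊆
          D2 ∪ O.image (fun p => if inIco V (V + m) p.1 then p.2 else p.1) ∪
            Finset.Ico (V + 2 * h) (V + m - I.card) := by
        intro i hi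
        rw [Finset.mem_filter] at hi
        obtain ⟨hil, hi⟩ := hi
        simp only [Finset.mem_union]
        by_cases c : inIco V (V + m) i
        · right
          rw [Finset.mem_Ico]
          constructor
          · by_contra hlt
            have c1 := c.1
            have := hi (V + 2 * ((i - V) / 2), V + 2 * ((i - V) / 2) + 1)
              (Finset.mem_union_right _ (Finset.mem_image.2 ⟨(i - V) / 2, by
                rw [Finset.mem_range]; omega, rfl⟩))
            dsimp only at this
            omega
          · by_contra hlt
            obtain ⟨i', hi', he⟩ := shift_surj hI (not_lt.1 hlt) c.2
            have hi2 := hi'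
            rw [hIdef, Finset.mem_filter] at hi2
            obtain ⟨p, hp, hm, hpi⟩ := hi2.2
            have hpB : p ∈ B := by rw [hB, Finset.mem_filter]; exact ⟨hp, Or.inl hm⟩
            have := hi (g p) (Finset.mem_union_left _ (Finset.mem_image_of_mem _ hpB))
            simp only [hg, Prod.map_fst, Prod.map_snd] at this
            rcases hpi with e | e
            · rw [e] at this; exact this.1 he
            · rw [e] at this; exact this.2 he
        · left
          by_cases d : ∀ p ∈ A, p.1 ≠ i ∧ p.2 ≠ i
          · left
            simp only [hD2, hD, Finset.mem_filter]
            exact ⟨⟨hil, d⟩, c⟩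
          · right
            obtain ⟨p, hp, hpi⟩ : ∃ p ∈ A, p.1 = i ∨ p.2 = i := by
              by_contra hcon
              push Not at hcon
              exact d hcon
            have hnB : p ∉ B := by
              intro hpB
              have := hi (g p) (Finset.mem_union_left _ (Finset.mem_image_of_mem _ hpB))
              simp only [hg, Prod.map_fst, Prod.map_snd] at this
              have e := shift_out (I := I) c
              rcases hpi with rfl | rfl
              · exact this.1 e
              · exact this.2 e
            rw [hB, Finset.mem_filter] at hnB
            have hnB : ¬ IsMatchPair w p ∧ (¬ inIco V (V + m) p.1 → inIco V (V + m) p.2) :=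
              ⟨fun x => hnB ⟨hp, Or.inl x⟩, fun x => by
                by_contra y; exact hnB ⟨hp, Or.inr ⟨x, y⟩⟩⟩
            rw [Finset.mem_image]
            rcases hpi with rfl | rfl
            · refine ⟨p, ?_, by rw [if_neg c]⟩
              rw [hOd, Finset.mem_filter]
              exact ⟨hp, hnB.1, Or.inr ⟨hnB.2 c, c⟩⟩
            · have x : inIco V (V + m) p.1 := by
                by_contra x; exact c (hnB.2 x)
              refine ⟨p, ?_, by rw [if_pos x]⟩
              rw [hOd, Finset.mem_filter]
              exact ⟨hp, hnB.1, Or.inl ⟨x, c⟩⟩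
      have c0 := Finset.card_le_card hsub
      have c1 := Finset.card_union_le
        (D2 ∪ O.image (fun p => if inIco V (V + m) p.1 then p.2 else p.1))
        (Finset.Ico (V + 2 * h) (V + m - I.card))
      have c2 := Finset.card_union_le
        D2 (O.image (fun p => if inIco V (V + m) p.1 then p.2 else p.1))
      have c3 : (O.image (fun p => if inIco V (V + m) p.1 then p.2 else p.1)).card ≤ O.card :=
        Finset.card_image_le
      rw [Nat.card_Ico] at c1
      omega
    unfold cost
    rw [← hD]
    omega
  · intro j hj
    constructor
    · rintro ⟨p, hp, hm, hc⟩
      rcases Finset.mem_union.1 hp with hp | hp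
      · obtain ⟨q, hq, rfl⟩ := Finset.mem_image.1 hp
        obtain ⟨hqA, a, b⟩ := hBD q hq
        have h1 := hfr _ a
        have h2 := hfr _ b
        simp only [hg, Prod.map_fst, Prod.map_snd] at hc
        unfold inIco at hj
        omega
      · exact absurd hm (hSS p hp).2.2
    · intro hle
      obtain ⟨i, hi, he⟩ := shift_surj hI hle hj.2
      have hi2 := hi
      rw [hIdef, Finset.mem_filter] at hi2
      obtain ⟨j', hj', p, hp, hm, hpe⟩ := ML_pair hA R (hI i hi) hi2.2
      have hpB : p ∈ B := by rw [hB, Finset.mem_filter]; exact ⟨hp, Or.inl hm⟩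
      have hfj : f j' = j' := by
        rw [hf]; apply shift_out
        have := R.dis
        unfold inIco at hj'
        omega
      refine ⟨g p, Finset.mem_union_left _ (Finset.mem_image_of_mem _ hpB), (hgm p hpB).2 hm, ?_⟩
      simp only [hg, Prod.map_fst, Prod.map_snd]
      rcases hpe with rfl | rfl
      · left; dsimp only; rw [hfj]; exact ⟨he, hj'⟩
      · right; dsimp only; rw [hfj]; exact ⟨he, hj'⟩
  · intro p hp hc
    rcases Finset.mem_union.1 hp with hp | hp
    · obtain ⟨q, hq, rfl⟩ := Finset.mem_image.1 hp
      obtain ⟨hqA, a, b⟩ := hBD q hq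
      have h1 := hfr _ a
      have h2 := hfr _ b
      simp only [hg, Prod.map_fst, Prod.map_snd] at hc
      unfold inIco at hc
      omega
    · exact hSS p hp


lemma lawful_sum {σ : Type*} [DecidableEq σ] : LawfulBEq (σ ⊕ σ) where
  eq_of_beq := by
    rintro (a | a) (b | b) h
    · exact congrArg _ (eq_of_beq (α := σ) h)
    · exact absurd h (by simp [BEq.beq, Sum.instBEq.beq])
    · exact absurd h (by simp [BEq.beq, Sum.instBEq.beq])
    · exact congrArg _ (eq_of_beq (α := σ) h)
  rfl := by
    rintro (a | a)
    · exact beq_self_eq_true (α := σ) a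
    · exact beq_self_eq_true (α := σ) a

lemma run_get {σ : Type*} (w w₁ w₂ : List (σ ⊕ σ)) (z : σ ⊕ σ) (m : ℕ)
    (hw : w = w₁ ++ List.replicate m z ++ w₂) (i : ℕ) (hi : inIco w₁.length (w₁.length + m) i) :
    w[i]? = some z := by
  obtain ⟨h1, h2⟩ := hi
  rw [hw, List.getElem?_append_left (by simp; omega), List.getElem?_append_right h1,
    List.getElem?_replicate, if_pos (by omega)]

lemma run_only {σ : Type*} [DecidableEq σ] (w w₁ w₂ : List (σ ⊕ σ)) (z : σ ⊕ σ) (m : ℕ)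
    (hw : w = w₁ ++ List.replicate m z ++ w₂) (hc : w.count z = m) (i : ℕ)
    (h : w[i]? = some z) : inIco w₁.length (w₁.length + m) i := by
  haveI : LawfulBEq (σ ⊕ σ) := lawful_sum
  rw [hw, List.count_append, List.count_append, List.count_replicate_self] at hc
  have n1 : z ∉ w₁ := List.count_eq_zero.1 (by omega)
  have n2 : z ∉ w₂ := List.count_eq_zero.1 (by omega)
  rw [hw] at h
  by_contra hcon
  unfold inIco at hcon
  by_cases c : i < w₁.length
  · rw [List.append_assoc, List.getElem?_append_left c] at h
    exact n1 (List.mem_of_getElem? h)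
  · rw [List.getElem?_append_right (by simp; omega)] at h
    exact n2 (List.mem_of_getElem? h)

/-- Lemma 4.7 of the paper.
Consider an optimal alignment `A` of a string `w` over a bracket alphabet. Let
`Z = replicate m z` be a maximal substring of `w` consisting entirely of copies of some symbol
`z` (so `w = w₁ ++ replicate m z ++ w₂` with the neighboring symbols different from `z`), and
let `Z₀ = replicate m z₀` be a maximal substring of `w` consisting entirely of copies of some
symbol `z₀` (so `w = v₁ ++ replicate m z₀ ++ v₂`, again maximal), with `|Z| = |Z₀| = m`, such
that the alignment contains matches between `Z` and `Z₀`, and `Z` is the only maximal substring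
of `w` containing the symbol `z` (i.e. `z` occurs exactly `m` times in `w`). Then one can
modify the alignment, increasing its cost by at most 2, so that the symbols of `Z₀` that are
matched to symbols of `Z` form a contiguous substring of `Z₀` which is a suffix of `Z₀`, and
all remaining symbols of `Z₀` are deleted or mismatched among themselves. -/
theorem alignment_consolidate_run_matches {σ : Type*} [DecidableEq σ]
    (w w₁ w₂ v₁ v₂ : List (σ ⊕ σ)) (z z₀ : σ ⊕ σ) (m : ℕ)
    (hwZ : w = w₁ ++ List.replicate m z ++ w₂)
    (hmaxZl : ∀ s ∈ w₁.getLast?, s ≠ z) (hmaxZr : ∀ s ∈ w₂.head?, s ≠ z)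
    (hwZ0 : w = v₁ ++ List.replicate m z₀ ++ v₂)
    (hmaxZ0l : ∀ s ∈ v₁.getLast?, s ≠ z₀) (hmaxZ0r : ∀ s ∈ v₂.head?, s ≠ z₀)
    (honly : w.count z = m)
    (A : Finset (ℕ × ℕ)) (hA : IsAlignment w A) (hopt : cost w A = dyck w)
    (hmatch : ∃ p ∈ A, IsMatchPair w p ∧
      ((inIco w₁.length (w₁.length + m) p.1 ∧ inIco v₁.length (v₁.length + m) p.2) ∨
       (inIco v₁.length (v₁.length + m) p.1 ∧ inIco w₁.length (w₁.length + m) p.2))) :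
    ∃ A' : Finset (ℕ × ℕ), IsAlignment w A' ∧ cost w A' ≤ cost w A + 2 ∧
      ∃ s ≤ m,
        (∀ j, inIco v₁.length (v₁.length + m) j →
          ((∃ p ∈ A', IsMatchPair w p ∧
              ((p.1 = j ∧ inIco w₁.length (w₁.length + m) p.2) ∨
               (p.2 = j ∧ inIco w₁.length (w₁.length + m) p.1))) ↔
            v₁.length + m - s ≤ j)) ∧
        (∀ p ∈ A',
          (inIco v₁.length (v₁.length + m - s) p.1 ∨ inIco v₁.length (v₁.length + m - s) p.2) →
          (inIco v₁.length (v₁.length + m - s) p.1 ∧ inIco v₁.length (v₁.length + m - s) p.2 ∧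
            ¬ IsMatchPair w p)) := by
  have hZ := run_get w w₁ w₂ z m hwZ
  have hZi := run_only w w₁ w₂ z m hwZ honly
  have hZ0 := run_get w v₁ v₂ z₀ m hwZ0
  have hlen : v₁.length + m ≤ w.length := by
    rw [hwZ0]; simp
  have hne : z ≠ z₀ → w₁.length + m ≤ v₁.length ∨ v₁.length + m ≤ w₁.length ∨ m = 0 := by
    intro hne
    by_contra hcon
    have a1 := hZ (max w₁.length v₁.length) ⟨by omega, by omega⟩
    have a2 := hZ0 (max w₁.length v₁.length) ⟨by omega, by omega⟩
    rw [a1] at a2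
    exact hne (by simpa using a2)
  have R : Runs w v₁.length (v₁.length + m) w₁.length (w₁.length + m) := by
    obtain ⟨p, hpA, ⟨a, ha1, ha2⟩, ⟨hp1, hp2⟩ | ⟨hp1, hp2⟩⟩ := hmatch
    · rw [hZ _ hp1] at ha1
      rw [hZ0 _ hp2] at ha2
      have e1 : z = .inl a := by simpa using ha1
      have e2 : z₀ = .inr a := by simpa using ha2
      have hlt := (hA.1 p hpA).1
      have hord := hne (by rw [e1, e2]; simp)
      unfold inIco at hp1 hp2
      refine ⟨?_, ?_, ?_, ?_, by omega⟩
      · rintro q hq ⟨b, hb1, hb2⟩ hi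
        rw [hZ0 _ hi, e2] at hb1; simp at hb1
      · rintro q hq ⟨b, hb1, hb2⟩ hi
        rw [hZ0 _ hi, e2] at hb2
        apply hZi
        rw [hb1, e1]; simp at hb2; rw [hb2]
      · intro q hq x y
        unfold inIco at x y; omega
      · intro q hq x y
        exact ⟨a, by rw [hZ _ y, e1], by rw [hZ0 _ x, e2]⟩
    · rw [hZ0 _ hp1] at ha1
      rw [hZ _ hp2] at ha2
      have e1 : z₀ = .inl a := by simpa using ha1
      have e2 : z = .inr a := by simpa using ha2
      have hlt := (hA.1 p hpA).1
      have hord := hne (by rw [e1, e2]; simp)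
      unfold inIco at hp1 hp2
      refine ⟨?_, ?_, ?_, ?_, by omega⟩
      · rintro q hq ⟨b, hb1, hb2⟩ hi
        rw [hZ0 _ hi, e1] at hb1
        apply hZi
        rw [hb2, e2]; simp at hb1; rw [hb1]
      · rintro q hq ⟨b, hb1, hb2⟩ hi
        rw [hZ0 _ hi, e1] at hb2; simp at hb2
      · intro q hq x y
        exact ⟨a, by rw [hZ0 _ x, e1], by rw [hZ _ y, e2]⟩
      · intro q hq x y
        unfold inIco at x y; omega
  obtain ⟨A₁, r1, r2, r3⟩ := reduce R z₀ hZ0 _ A hA le_rfl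
  obtain ⟨A', s1, s2, s3⟩ := final_step R z₀ hZ0 hlen A₁ r1 r3
  exact ⟨A', s1, by omega, s3⟩

end DyckEdit
end
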